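/- Let C be any class of 2-frames each of which is a frame for the commutator [DisK4.3, Diff], and suppose that either the product frame ⟨ω+1,>⟩ × ⟨ω,≠⟩ or the product frame ⟨{∞}∪ℤ,>⟩ × ⟨ω,≠⟩ belongs to C. Then the C-satisfiability problem (given a bimodal formula φ, is φ satisfied in some model based on some member of C) is Σ₁¹-hard; in particular, the counter-machine recurrence problem (given a counter machine M and states q₀, q_r, does M have an infinite run starting with ⟨q₀,𝟎⟩ and visiting q_r infinitely often), which is Σ₁¹-hard, is computably many-one reducible to it. -/

import Mathlib

namespace HK

/-! ## Bimodal formulas -/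

/-- Bimodal formulas: `φ ::= P | ¬φ | φ∧ψ | ◇₀φ | ◇₁φ`. -/
inductive BForm : Type
  | var : ℕ → BForm
  | neg : BForm → BForm
  | and : BForm → BForm → BForm
  | dia0 : BForm → BForm
  | dia1 : BForm → BForm

namespace BForm

def imp (φ ψ : BForm) : BForm := neg (and φ (neg ψ))
def bot : BForm := and (var 0) (neg (var 0))
def top : BForm := neg bot
def box0 (φ : BForm) : BForm := neg (dia0 (neg φ))
def box1 (φ : BForm) : BForm := neg (dia1 (neg φ))
/-- `□₀⁺φ := φ ∧ □₀φ` -/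
def boxP0 (φ : BForm) : BForm := and φ (box0 φ)
/-- `□₁⁺φ := φ ∧ □₁φ` -/
def boxP1 (φ : BForm) : BForm := and φ (box1 φ)

/-- Modal nesting depth. -/
def depth : BForm → ℕ
  | var _ => 0
  | neg φ => depth φ
  | and φ ψ => max (depth φ) (depth ψ)
  | dia0 φ => depth φ + 1
  | dia1 φ => depth φ + 1

/-- The propositional variable `k` occurs in the formula. -/
def Occurs (k : ℕ) : BForm → Prop
  | var n => k = n
  | neg φ => Occurs k φ
  | and φ ψ => Occurs k φ ∨ Occurs k ψ
  | dia0 φ => Occurs k φ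
  | dia1 φ => Occurs k φ

/-- The formula uses only the modal operator `◇₀`. -/
def OnlyDia0 : BForm → Prop
  | var _ => True
  | neg φ => OnlyDia0 φ
  | and φ ψ => OnlyDia0 φ ∧ OnlyDia0 ψ
  | dia0 φ => OnlyDia0 φ
  | dia1 _ => False

/-- The formula uses only the modal operator `◇₁`. -/
def OnlyDia1 : BForm → Prop
  | var _ => True
  | neg φ => OnlyDia1 φ
  | and φ ψ => OnlyDia1 φ ∧ OnlyDia1 ψ
  | dia0 _ => False
  | dia1 φ => OnlyDia1 φ

/-- Relativisation `φ^D` of each diamond to the variable `d`: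
each subformula `◇ᵢψ` is replaced by `◇ᵢ(D ∧ ψ^D)`. -/
def relativize (d : ℕ) : BForm → BForm
  | var n => var n
  | neg φ => neg (relativize d φ)
  | and φ ψ => and (relativize d φ) (relativize d ψ)
  | dia0 φ => dia0 (and (var d) (relativize d φ))
  | dia1 φ => dia1 (and (var d) (relativize d φ))

/-- `□₀^k φ` -/
def iterBox0 : ℕ → BForm → BForm
  | 0, φ => φ
  | n+1, φ => box0 (iterBox0 n φ)

/-- `□₁^k φ` -/
def iterBox1 : ℕ → BForm → BForm
  | 0, φ => φ
  | n+1, φ => box1 (iterBox1 n φ)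

/-- `□₀^{≤n} φ := ⋀_{k ≤ n} □₀^k φ` -/
def boxLe0 : ℕ → BForm → BForm
  | 0, φ => φ
  | n+1, φ => and (boxLe0 n φ) (iterBox0 (n+1) φ)

/-- `□₁^{≤n} φ := ⋀_{k ≤ n} □₁^k φ` -/
def boxLe1 : ℕ → BForm → BForm
  | 0, φ => φ
  | n+1, φ => and (boxLe1 n φ) (iterBox1 (n+1) φ)

/-- Uniform substitution. -/
def subst (s : ℕ → BForm) : BForm → BForm
  | var n => s n
  | neg φ => neg (subst s φ)
  | and φ ψ => and (subst s φ) (subst s ψ)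
  | dia0 φ => dia0 (subst s φ)
  | dia1 φ => dia1 (subst s φ)

end BForm

/-- Kripke truth over a 2-frame `⟨W, R0, R1⟩` with valuation `val`. -/
def BSat {W : Type} (R0 R1 : W → W → Prop) (val : ℕ → W → Prop) : W → BForm → Prop
  | w, .var n => val n w
  | w, .neg φ => ¬ BSat R0 R1 val w φ
  | w, .and φ ψ => BSat R0 R1 val w φ ∧ BSat R0 R1 val w ψ
  | w, .dia0 φ => ∃ v, R0 w v ∧ BSat R0 R1 val v φ
  | w, .dia1 φ => ∃ v, R1 w v ∧ BSat R0 R1 val v φ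

/-! ## Frames -/

/-- A (unimodal) frame: a nonempty set with a binary relation. -/
structure Frame : Type 1 where
  W : Type
  R : W → W → Prop
  ne : Nonempty W

/-- A 2-frame: a nonempty set with two binary relations. -/
structure Frame2 : Type 1 where
  W : Type
  R0 : W → W → Prop
  R1 : W → W → Prop
  ne : Nonempty W

/-- Validity of a bimodal formula in a 2-frame. -/
def Frame2.Valid (F : Frame2) (φ : BForm) : Prop :=
  ∀ (val : ℕ → F.W → Prop) (w : F.W), BSat F.R0 F.R1 val w φ

/-- Satisfaction of a bimodal formula in some model based on the 2-frame. -/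
def Frame2.Sat (F : Frame2) (φ : BForm) : Prop :=
  ∃ (val : ℕ → F.W → Prop) (w : F.W), BSat F.R0 F.R1 val w φ

/-- Horizontal relation of a product frame. -/
def prodR0 {A B : Type} (R : A → A → Prop) : A × B → A × B → Prop :=
  fun p q => R p.1 q.1 ∧ p.2 = q.2

/-- Vertical relation of a product frame. -/
def prodR1 {A B : Type} (S : B → B → Prop) : A × B → A × B → Prop :=
  fun p q => p.1 = q.1 ∧ S p.2 q.2

/-- `φ` is satisfied in some model based on the product frame `⟨A,R⟩ × ⟨B,S⟩`. -/
def ProdSat {A B : Type} (R : A → A → Prop) (S : B → B → Prop) (φ : BForm) : Prop :=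
  ∃ (val : ℕ → A × B → Prop) (w : A × B), BSat (prodR0 R) (prodR1 S) val w φ

/-- `φ` is valid in the product frame `⟨A,R⟩ × ⟨B,S⟩`. -/
def ProdValid {A B : Type} (R : A → A → Prop) (S : B → B → Prop) (φ : BForm) : Prop :=
  ∀ (val : ℕ → A × B → Prop) (w : A × B), BSat (prodR0 R) (prodR1 S) val w φ

/-- The product 2-frame of two frames. -/
def prodFrame2 (A B : Type) [Nonempty A] [Nonempty B]
    (R : A → A → Prop) (S : B → B → Prop) : Frame2 :=
  ⟨A × B, prodR0 R, prodR1 S, inferInstance⟩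

/-- Linear order: irreflexive, transitive and trichotomous. -/
def IsLin {T : Type} (R : T → T → Prop) : Prop :=
  (∀ x, ¬ R x x) ∧ (∀ x y z, R x y → R y z → R x z) ∧ (∀ x y, R x y ∨ x = y ∨ R y x)

/-- Weak order: transitive and weakly connected. -/
def WeakOrd {T : Type} (R : T → T → Prop) : Prop :=
  (∀ x y z, R x y → R y z → R x z) ∧ (∀ x y z, R x y → R x z → y = z ∨ R y z ∨ R z y)

/-- Modal discreteness. -/
def ModallyDiscrete {T : Type} (R : T → T → Prop) : Prop :=
  ¬ ∃ (x : ℕ → T) (xω : T), (∀ i, R (x i) (x (i+1))) ∧ (∀ i, x i ≠ x (i+1)) ∧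
      (∀ i, R (x i) xω) ∧ (∀ i, ¬ R xω (x i))

/-- No infinite ascending chains of distinct points. -/
def Noetherian {T : Type} (R : T → T → Prop) : Prop :=
  ¬ ∃ x : ℕ → T, (∀ i, R (x i) (x (i+1))) ∧ (∀ i, x i ≠ x (i+1))

/-- The frame is (isomorphic to) `⟨ω,<⟩`. -/
def IsOmegaFrame (F : Frame) : Prop :=
  ∃ e : F.W ≃ ℕ, ∀ a b, F.R a b ↔ e a < e b

/-- The frame is a finite linear order. -/
def IsFinLinFrame (F : Frame) : Prop := Finite F.W ∧ IsLin F.R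

/-- `F` contains an `⟨ω+1,>⟩`-type chain: distinct points `x₀,…,x_n,…,x_ω` with
`x_n R x_m` iff `n > m` (for `n ≠ m`). -/
def HasOmegaPlusOneChain (F : Frame) : Prop :=
  ∃ (x : ℕ → F.W) (xω : F.W), Function.Injective x ∧ (∀ n, x n ≠ xω) ∧
    (∀ n m, n ≠ m → (F.R (x n) (x m) ↔ m < n)) ∧
    (∀ n, F.R xω (x n)) ∧ (∀ n, ¬ F.R (x n) xω)

/-! ## Two-dimensional (expanding/decreasing) 2-frames `H_{F,Ḡ}` -/

/-- A 2-frame `H_{F,Ḡ}` built from a horizontal frame `⟨H,R⟩` and, for each `x : H`,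
a vertical frame `G_x = ⟨D x, S x⟩` carved out of a common ambient type `V`. -/
structure TwoFrame : Type 1 where
  H : Type
  R : H → H → Prop
  Hne : Nonempty H
  V : Type
  D : H → Set V
  S : H → V → V → Prop
  Dne : ∀ x, (D x).Nonempty

namespace TwoFrame

/-- The horizontal frame. -/
def horiz (T : TwoFrame) : Frame := ⟨T.H, T.R, T.Hne⟩

/-- The vertical frame `G_x` at `x`. -/
def fiber (T : TwoFrame) (x : T.H) : Frame :=
  ⟨{a : T.V // a ∈ T.D x}, fun a b => T.S x a.1 b.1,
    Exists.elim (T.Dne x) (fun a ha => ⟨⟨a, ha⟩⟩)⟩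

/-- The worlds `{⟨u,v⟩ : u ∈ H, v ∈ D u}`. -/
def Worlds (T : TwoFrame) : Type := {p : T.H × T.V // p.2 ∈ T.D p.1}

/-- Horizontal relation of `H_{F,Ḡ}`. -/
def Rh (T : TwoFrame) : T.Worlds → T.Worlds → Prop :=
  fun p q => T.R p.1.1 q.1.1 ∧ p.1.2 = q.1.2

/-- Vertical relation of `H_{F,Ḡ}`. -/
def Rv (T : TwoFrame) : T.Worlds → T.Worlds → Prop :=
  fun p q => p.1.1 = q.1.1 ∧ T.S p.1.1 p.1.2 q.1.2

/-- `φ` is satisfied in some model based on `H_{F,Ḡ}`. -/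
def Sat (T : TwoFrame) (φ : BForm) : Prop :=
  ∃ (val : ℕ → T.Worlds → Prop) (w : T.Worlds), BSat T.Rh T.Rv val w φ

/-- Decreasing 2-frame: `G_y` is a subframe of `G_x` whenever `x R y`. -/
def Decreasing (T : TwoFrame) : Prop :=
  ∀ x y, T.R x y → T.D y ⊆ T.D x ∧ ∀ a ∈ T.D y, ∀ b ∈ T.D y, (T.S y a b ↔ T.S x a b)

/-- Expanding 2-frame: `G_x` is a subframe of `G_y` whenever `x R y`. -/
def Expanding (T : TwoFrame) : Prop :=
  ∀ x y, T.R x y → T.D x ⊆ T.D y ∧ ∀ a ∈ T.D x, ∀ b ∈ T.D x, (T.S x a b ↔ T.S y a b)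

/-- All vertical frames are difference frames. -/
def DiffFibers (T : TwoFrame) : Prop :=
  ∀ x, ∀ a ∈ T.D x, ∀ b ∈ T.D x, (T.S x a b ↔ a ≠ b)

end TwoFrame

/-- `φ` is satisfied in some model based on a product of a member of `C`
with a difference frame. -/
def ProdDiffSat (C : Frame → Prop) (φ : BForm) : Prop :=
  ∃ F : Frame, C F ∧ ∃ D : Type, Nonempty D ∧ ProdSat F.R (fun a b : D => a ≠ b) φ

/-- `φ` is satisfied in some model based on a decreasing 2-frame with horizontal
frame in `C` and all vertical frames difference frames. -/
def DecDiffSat (C : Frame → Prop) (φ : BForm) : Prop :=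
  ∃ T : TwoFrame, C T.horiz ∧ T.Decreasing ∧ T.DiffFibers ∧ T.Sat φ

/-- `φ` is satisfied in some model based on an expanding 2-frame with horizontal
frame in `C` and all vertical frames difference frames. -/
def ExpDiffSat (C : Frame → Prop) (φ : BForm) : Prop :=
  ∃ T : TwoFrame, C T.horiz ∧ T.Expanding ∧ T.DiffFibers ∧ T.Sat φ

/-- `φ` is satisfied in some model based on a product of a member of `C0` with a
member of `C1`. -/
def ProdClassSat (C0 C1 : Frame → Prop) (φ : BForm) : Prop :=
  ∃ F0, C0 F0 ∧ ∃ F1, C1 F1 ∧ ProdSat F0.R F1.R φ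

/-- `φ` is satisfied in some model based on a decreasing 2-frame with horizontal
frame in `C0` and all vertical frames in `C1`. -/
def DecClassSat (C0 C1 : Frame → Prop) (φ : BForm) : Prop :=
  ∃ T : TwoFrame, C0 T.horiz ∧ (∀ x, C1 (T.fiber x)) ∧ T.Decreasing ∧ T.Sat φ

/-- `φ` is satisfied in some model based on an expanding 2-frame with horizontal
frame in `C0` and all vertical frames in `C1`. -/
def ExpClassSat (C0 C1 : Frame → Prop) (φ : BForm) : Prop :=
  ∃ T : TwoFrame, C0 T.horiz ∧ (∀ x, C1 (T.fiber x)) ∧ T.Expanding ∧ T.Sat φ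

/-- Satisfiability over products of `⟨ω,<⟩` with difference frames. -/
def OmegaDiffSat (φ : BForm) : Prop :=
  ∃ D : Type, Nonempty D ∧ ProdSat (fun m n : ℕ => m < n) (fun a b : D => a ≠ b) φ

/-- Satisfiability over products of finite linear orders with difference frames. -/
def FinLinDiffSat (φ : BForm) : Prop :=
  ∃ (T : Type) (R : T → T → Prop), Finite T ∧ IsLin R ∧
    ∃ D : Type, Nonempty D ∧ ProdSat R (fun a b : D => a ≠ b) φ

/-! ## Bimodal logics -/

/-- Propositional tautology (diamond formulas treated as atoms). -/
def IsTaut (φ : BForm) : Prop :=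
  ∀ v : BForm → Prop, (∀ ψ, v (BForm.neg ψ) ↔ ¬ v ψ) →
    (∀ ψ χ, v (BForm.and ψ χ) ↔ v ψ ∧ v χ) → v φ

/-- Normal bimodal logic. -/
structure IsLogic (L : Set BForm) : Prop where
  taut : ∀ φ, IsTaut φ → φ ∈ L
  K0 : BForm.imp (BForm.box0 (BForm.imp (BForm.var 0) (BForm.var 1)))
        (BForm.imp (BForm.box0 (BForm.var 0)) (BForm.box0 (BForm.var 1))) ∈ L
  K1 : BForm.imp (BForm.box1 (BForm.imp (BForm.var 0) (BForm.var 1)))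
        (BForm.imp (BForm.box1 (BForm.var 0)) (BForm.box1 (BForm.var 1))) ∈ L
  mp : ∀ φ ψ, BForm.imp φ ψ ∈ L → φ ∈ L → ψ ∈ L
  subst : ∀ φ s, φ ∈ L → BForm.subst s φ ∈ L
  nec0 : ∀ φ, φ ∈ L → BForm.box0 φ ∈ L
  nec1 : ∀ φ, φ ∈ L → BForm.box1 φ ∈ L

/-- Validity of a (◇₀-)formula in a unimodal frame `⟨W,R⟩`. -/
def UValid0 {W : Type} (R : W → W → Prop) (φ : BForm) : Prop :=
  ∀ (val : ℕ → W → Prop) (w : W), BSat R (fun _ _ => False) val w φ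

/-- Validity of a (◇₁-)formula in a unimodal frame `⟨W,S⟩`. -/
def UValid1 {W : Type} (S : W → W → Prop) (φ : BForm) : Prop :=
  ∀ (val : ℕ → W → Prop) (w : W), BSat (fun _ _ => False) S val w φ

/-- `K4.3`: the unimodal logic (in `◇₀`) of all linear orders. -/
def K43 : Set BForm :=
  {φ | φ.OnlyDia0 ∧ ∀ (T : Type) (R : T → T → Prop), Nonempty T → IsLin R → UValid0 R φ}

/-- `Diff`: the unimodal logic (in `◇₁`) of all difference frames. -/
def DiffLogic : Set BForm :=
  {φ | φ.OnlyDia1 ∧ ∀ (D : Type), Nonempty D → UValid1 (fun a b : D => a ≠ b) φ}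

/-- `Log⟨ω,<⟩`: the unimodal logic (in `◇₀`) of the frame `⟨ω,<⟩`. -/
def LogOmega : Set BForm :=
  {φ | φ.OnlyDia0 ∧ UValid0 (fun m n : ℕ => m < n) φ}

/-- `GL.3`: the unimodal logic (in `◇₀`) of all Noetherian irreflexive linear orders. -/
def GL3 : Set BForm :=
  {φ | φ.OnlyDia0 ∧
    ∀ (T : Type) (R : T → T → Prop), Nonempty T → IsLin R → Noetherian R → UValid0 R φ}

/-- `DisK4.3`: the unimodal logic (in `◇₀`) of all modally discrete weak orders. -/
def DisK43 : Set BForm :=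
  {φ | φ.OnlyDia0 ∧
    ∀ (T : Type) (R : T → T → Prop), Nonempty T → WeakOrd R → ModallyDiscrete R → UValid0 R φ}

def commAx1 : BForm :=
  BForm.imp (BForm.box1 (BForm.box0 (BForm.var 0))) (BForm.box0 (BForm.box1 (BForm.var 0)))
def commAx2 : BForm :=
  BForm.imp (BForm.box0 (BForm.box1 (BForm.var 0))) (BForm.box1 (BForm.box0 (BForm.var 0)))
def commAx3 : BForm :=
  BForm.imp (BForm.dia0 (BForm.box1 (BForm.var 0))) (BForm.box1 (BForm.dia0 (BForm.var 0)))

/-- The commutator `[L0,L1]`: the smallest bimodal logic containing `L0`, `L1` (and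
hence their fusion) together with the commutativity/confluence axioms. -/
def Commutator (L0 L1 : Set BForm) : Set BForm :=
  ⋂₀ {L : Set BForm | IsLogic L ∧ L0 ⊆ L ∧ L1 ⊆ L ∧
      commAx1 ∈ L ∧ commAx2 ∈ L ∧ commAx3 ∈ L}

/-- The product logic `L0 × L1`: the logic of all products of a frame for `L0`
with a frame for `L1`. -/
def ProdLogic (L0 L1 : Set BForm) : Set BForm :=
  {φ | ∀ (A B : Type), Nonempty A → Nonempty B → ∀ (R : A → A → Prop) (S : B → B → Prop),
      (∀ ψ ∈ L0, UValid0 R ψ) → (∀ ψ ∈ L1, UValid1 S ψ) → ProdValid R S φ}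

/-- The logic of a class of 2-frames. -/
def LogOf (C : Frame2 → Prop) : Set BForm := {φ | ∀ F, C F → F.Valid φ}

/-- Kripke completeness of a bimodal logic. -/
def KripkeComplete (L : Set BForm) : Prop := ∃ C : Frame2 → Prop, L = LogOf C

/-- `L`-satisfiability: `φ` is satisfied in some model `M` with `M ⊨ L`. -/
def LSat (L : Set BForm) (φ : BForm) : Prop :=
  ∃ (W : Type) (_ : Nonempty W) (R0 R1 : W → W → Prop) (val : ℕ → W → Prop),
    (∀ ψ ∈ L, ∀ w, BSat R0 R1 val w ψ) ∧ ∃ w, BSat R0 R1 val w φ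

/-! ## One-variable first-order temporal logic with counting (FOLTL≠) -/

/-- FOLTL≠-formulas: `φ ::= P(x) | ¬φ | φ∧ψ | ◇_F φ | ∃≠x φ`. -/
inductive TForm : Type
  | atom : ℕ → TForm
  | neg : TForm → TForm
  | and : TForm → TForm → TForm
  | diaF : TForm → TForm
  | exNe : TForm → TForm

/-- Truth of an FOLTL≠-formula in a first-order temporal model based on the
timeline `⟨T,lt⟩` with domains `D` and interpretation `I`. -/
def TSat {T U : Type} (lt : T → T → Prop) (D : T → Set U) (I : ℕ → T → U → Prop) :
    T → U → TForm → Prop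
  | t, a, .atom n => I n t a
  | t, a, .neg φ => ¬ TSat lt D I t a φ
  | t, a, .and φ ψ => TSat lt D I t a φ ∧ TSat lt D I t a ψ
  | t, a, .diaF φ => ∃ t', lt t t' ∧ a ∈ D t' ∧ TSat lt D I t' a φ
  | t, a, .exNe φ => ∃ b, b ∈ D t ∧ b ≠ a ∧ TSat lt D I t b φ

/-- The standard translation `⋆` from FOLTL≠-formulas to bimodal formulas. -/
def TForm.star : TForm → BForm
  | .atom n => .var n
  | .neg φ => .neg (TForm.star φ)
  | .and φ ψ => .and (TForm.star φ) (TForm.star ψ)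
  | .diaF φ => .dia0 (TForm.star φ)
  | .exNe φ => .dia1 (TForm.star φ)

/-- Satisfiability in constant domain models over the timeline `⟨T,lt⟩`. -/
def FOLTLConstSat {T : Type} (lt : T → T → Prop) (φ : TForm) : Prop :=
  ∃ (U : Type) (I : ℕ → T → U → Prop) (t : T) (a : U),
    TSat lt (fun _ => (Set.univ : Set U)) I t a φ

/-- Satisfiability in decreasing domain models over the timeline `⟨T,lt⟩`. -/
def FOLTLDecSat {T : Type} (lt : T → T → Prop) (φ : TForm) : Prop :=
  ∃ (U : Type) (D : T → Set U), (∀ t, (D t).Nonempty) ∧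
    (∀ t t', lt t t' → D t' ⊆ D t) ∧
    ∃ (I : ℕ → T → U → Prop) (t : T) (a : U), a ∈ D t ∧ TSat lt D I t a φ

/-- Satisfiability in expanding domain models over the timeline `⟨T,lt⟩`. -/
def FOLTLExpSat {T : Type} (lt : T → T → Prop) (φ : TForm) : Prop :=
  ∃ (U : Type) (D : T → Set U), (∀ t, (D t).Nonempty) ∧
    (∀ t t', lt t t' → D t ⊆ D t') ∧
    ∃ (I : ℕ → T → U → Prop) (t : T) (a : U), a ∈ D t ∧ TSat lt D I t a φ

/-- Satisfiability in constant domain models over a class `C` of timelines. -/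
def FOLTLConstSatC (C : Frame → Prop) (φ : TForm) : Prop :=
  ∃ F, C F ∧ FOLTLConstSat F.R φ

/-- Satisfiability in decreasing domain models over a class `C` of timelines. -/
def FOLTLDecSatC (C : Frame → Prop) (φ : TForm) : Prop :=
  ∃ F, C F ∧ FOLTLDecSat F.R φ

/-- Satisfiability in expanding domain models over a class `C` of timelines. -/
def FOLTLExpSatC (C : Frame → Prop) (φ : TForm) : Prop :=
  ∃ F, C F ∧ FOLTLExpSat F.R φ

/-- The class of all linear orders. -/
def AllLin : Frame → Prop := fun F => IsLin F.R

/-- The class of all finite linear orders. -/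
def AllFinLin : Frame → Prop := IsFinLinFrame

/-! ## Gödel numbering -/

/-- A fixed effective Gödel numbering of bimodal formulas. -/
def encodeB : BForm → ℕ
  | .var n => Nat.pair 0 n
  | .neg φ => Nat.pair 1 (encodeB φ)
  | .and φ ψ => Nat.pair 2 (Nat.pair (encodeB φ) (encodeB ψ))
  | .dia0 φ => Nat.pair 3 (encodeB φ)
  | .dia1 φ => Nat.pair 4 (encodeB φ)

/-- A fixed effective Gödel numbering of FOLTL≠-formulas. -/
def encodeT : TForm → ℕ
  | .atom n => Nat.pair 0 n
  | .neg φ => Nat.pair 1 (encodeT φ)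
  | .and φ ψ => Nat.pair 2 (Nat.pair (encodeT φ) (encodeT ψ))
  | .diaF φ => Nat.pair 3 (encodeT φ)
  | .exNe φ => Nat.pair 4 (encodeT φ)

/-- The set of codes of bimodal formulas with property `P`. -/
def BCodes (P : BForm → Prop) : ℕ → Prop := fun n => ∃ φ, encodeB φ = n ∧ P φ

/-- The set of codes of FOLTL≠-formulas with property `P`. -/
def TCodes (P : TForm → Prop) : ℕ → Prop := fun n => ∃ φ, encodeT φ = n ∧ P φ

/-! ## The analytical hierarchy: Σ₁¹ -/

/-- `A ⊆ ℕ` is `Σ₁¹`: in normal form `n ∈ A ↔ ∃ f : ℕ → ℕ, ∀ m, R (n, f̄(m))`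
for a computable predicate `R` of the number `n` and finite initial segments of `f`. -/
def Sigma11 (A : ℕ → Prop) : Prop :=
  ∃ R : ℕ × List ℕ → Prop, ComputablePred R ∧
    ∀ n, A n ↔ ∃ f : ℕ → ℕ, ∀ m, R (n, (List.range m).map f)

/-- `Σ₁¹`-hardness with respect to computable many-one reducibility. -/
def Sigma11Hard (A : ℕ → Prop) : Prop := ∀ B : ℕ → Prop, Sigma11 B → ManyOneReducible B A

/-- `Σ₁¹`-completeness. -/
def Sigma11Complete (A : ℕ → Prop) : Prop := Sigma11 A ∧ Sigma11Hard A

/-! ## Counter (Minsky) machines -/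

/-- Counter machine operations: `inl i` increments counter `i`, `inr (inl i)`
decrements counter `i`, `inr (inr i)` zero-tests counter `i`. -/
abbrev CMOp : Type := ℕ ⊕ ℕ ⊕ ℕ

def CMOp.counter : CMOp → ℕ
  | Sum.inl i => i
  | Sum.inr (Sum.inl i) => i
  | Sum.inr (Sum.inr i) => i

/-- Description of a counter machine: number `N` of counters, number of states
(states are `0,…,states-1`), list of terminal states, and list of instructions
`(q, op, q')`. -/
abbrev CMDesc : Type := ℕ × ℕ × List ℕ × List (ℕ × CMOp × ℕ)

/-- Well-formedness of a counter machine description: `N > 1`, terminal states are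
states, instructions are attached to non-terminal states and mention genuine
counters, and every non-terminal state has at least one instruction. -/
def CMWF (M : CMDesc) : Prop :=
  1 < M.1 ∧ (∀ q ∈ M.2.2.1, q < M.2.1) ∧
  (∀ t ∈ M.2.2.2, t.1 < M.2.1 ∧ t.1 ∉ M.2.2.1 ∧ t.2.2 < M.2.1 ∧ CMOp.counter t.2.1 < M.1) ∧
  (∀ q, q < M.2.1 → q ∉ M.2.2.1 → ∃ t ∈ M.2.2.2, t.1 = q)

/-- A configuration: current state and contents of the counters. -/
abbrev CMConfig : Type := ℕ × (ℕ → ℕ)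

/-- Reliable step of a counter machine. -/
def CMStep (M : CMDesc) (σ σ' : CMConfig) : Prop :=
  ∃ op q', (σ.1, op, q') ∈ M.2.2.2 ∧ σ'.1 = q' ∧
    match op with
    | Sum.inl i => σ'.2 i = σ.2 i + 1 ∧ ∀ j, j ≠ i → σ'.2 j = σ.2 j
    | Sum.inr (Sum.inl i) => 0 < σ.2 i ∧ σ'.2 i + 1 = σ.2 i ∧ ∀ j, j ≠ i → σ'.2 j = σ.2 j
    | Sum.inr (Sum.inr i) => σ.2 i = 0 ∧ ∀ j, σ'.2 j = σ.2 j

/-- Lossy step of a counter machine. -/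
def CMStepLossy (M : CMDesc) (σ σ' : CMConfig) : Prop :=
  ∃ c1 c2 : ℕ → ℕ, CMStep M (σ.1, c1) (σ'.1, c2) ∧ (∀ i, c1 i ≤ σ.2 i) ∧ (∀ i, σ'.2 i ≤ c2 i)

/-- The configuration `⟨q, 𝟎⟩` with all-0 counters. -/
def zeroConfig (q : ℕ) : CMConfig := (q, fun _ => 0)

/-- CM non-termination: the machine has an infinite run starting with `⟨q₀,𝟎⟩`. -/
def CMNonTerm : CMDesc × ℕ → Prop := fun p =>
  CMWF p.1 ∧ ∃ ρ : ℕ → CMConfig, ρ 0 = zeroConfig p.2 ∧ ∀ n, CMStep p.1 (ρ n) (ρ (n+1))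

/-- CM reachability: the machine has a run starting with `⟨q₀,𝟎⟩` reaching `q_r`. -/
def CMReach : CMDesc × ℕ × ℕ → Prop := fun p =>
  CMWF p.1 ∧ ∃ (B : ℕ) (ρ : ℕ → CMConfig), ρ 0 = zeroConfig p.2.1 ∧
    (∀ n, n < B → CMStep p.1 (ρ n) (ρ (n+1))) ∧ (ρ B).1 = p.2.2

/-- CM recurrence: the machine has an infinite run starting with `⟨q₀,𝟎⟩`
visiting `q_r` infinitely often. -/
def CMRecur : CMDesc × ℕ × ℕ → Prop := fun p =>
  CMWF p.1 ∧ ∃ ρ : ℕ → CMConfig, ρ 0 = zeroConfig p.2.1 ∧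
    (∀ n, CMStep p.1 (ρ n) (ρ (n+1))) ∧ ∀ n, ∃ m, n ≤ m ∧ (ρ m).1 = p.2.2

/-- LCM reachability: the machine has a lossy run starting with `⟨q₀,𝟎⟩`
reaching `q_r`. -/
def LCMReach : CMDesc × ℕ × ℕ → Prop := fun p =>
  CMWF p.1 ∧ ∃ (B : ℕ) (ρ : ℕ → CMConfig), ρ 0 = zeroConfig p.2.1 ∧
    (∀ n, n < B → CMStepLossy p.1 (ρ n) (ρ (n+1))) ∧ (ρ B).1 = p.2.2

/-- LCM ω-reachability: for every `k`, the machine has a lossy run starting with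
`⟨q₀,𝟎⟩` visiting `q_r` at least `k` times. -/
def LCMOmegaReach : CMDesc × ℕ × ℕ → Prop := fun p =>
  CMWF p.1 ∧ ∀ k : ℕ, ∃ (B : ℕ) (ρ : ℕ → CMConfig), ρ 0 = zeroConfig p.2.1 ∧
    (∀ n, n < B → CMStepLossy p.1 (ρ n) (ρ (n+1))) ∧
    k ≤ ((Finset.range (B+1)).filter (fun n => (ρ n).1 = p.2.2)).card

/-! ## Particular formulas used in the statements -/

/-- `□₁⁺□₀⁺(◇₀⊤ → □₁◇₀⊤) ∧ φ` (Prop. 2.4 of the paper). -/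
def diffDecForm (φ : BForm) : BForm :=
  BForm.and
    (BForm.boxP1 (BForm.boxP0
      (BForm.imp (BForm.dia0 BForm.top) (BForm.box1 (BForm.dia0 BForm.top))))) φ

/-- `D ∧ □₀^{≤n}□₁^{≤n}(◇₀D → D) ∧ φ^D`. -/
def decRelForm (d n : ℕ) (φ : BForm) : BForm :=
  BForm.and (BForm.var d)
    (BForm.and
      (BForm.boxLe0 n (BForm.boxLe1 n
        (BForm.imp (BForm.dia0 (BForm.var d)) (BForm.var d))))
      (BForm.relativize d φ))

/-- `D ∧ □₀^{≤n}□₁^{≤n}(D → □₀D) ∧ φ^D`. -/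
def expRelForm (d n : ℕ) (φ : BForm) : BForm :=
  BForm.and (BForm.var d)
    (BForm.and
      (BForm.boxLe0 n (BForm.boxLe1 n
        (BForm.imp (BForm.var d) (BForm.box0 (BForm.var d)))))
      (BForm.relativize d φ))

section

/-! ### Programs over counters -/

/-- Effect of a counter operation on the counters. -/
def OpRel : CMOp → (ℕ → ℕ) → (ℕ → ℕ) → Prop
  | Sum.inl i, c, c' => c' i = c i + 1 ∧ ∀ j, j ≠ i → c' j = c j
  | Sum.inr (Sum.inl i), c, c' => 0 < c i ∧ c' i + 1 = c i ∧ ∀ j, j ≠ i → c' j = c j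
  | Sum.inr (Sum.inr i), c, c' => c i = 0 ∧ ∀ j, c' j = c j

theorem cmStep_iff (M : CMDesc) (σ σ' : CMConfig) :
    CMStep M σ σ' ↔ ∃ op, (σ.1, op, σ'.1) ∈ M.2.2.2 ∧ OpRel op σ.2 σ'.2 := by
  constructor
  · rintro ⟨op, q', hm, rfl, h⟩
    refine ⟨op, hm, ?_⟩
    rcases op with i | i | i <;> exact h
  · rintro ⟨op, hm, h⟩
    refine ⟨op, _, hm, rfl, ?_⟩
    rcases op with i | i | i <;> exact h

/-- Regular programs. -/
inductive Prog : Type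
  | op : CMOp → Prog
  | seq : Prog → Prog → Prog
  | star : Prog → Prog

/-- Input-output relation of a regular program. -/
def Prog.Rel : Prog → (ℕ → ℕ) → (ℕ → ℕ) → Prop
  | .op o => OpRel o
  | .seq p q => Relation.Comp p.Rel q.Rel
  | .star p => Relation.ReflTransGen p.Rel

/-- Under the precondition, the program computes the function `F`. -/
def Det (p : Prog) (Pre : (ℕ → ℕ) → Prop) (F : (ℕ → ℕ) → (ℕ → ℕ)) : Prop :=
  ∀ c, Pre c → ∀ c', p.Rel c c' ↔ c' = F c

theorem Det.mono {p Pre Pre' F F'} (h : Det p Pre F) (hp : ∀ c, Pre' c → Pre c)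
    (hF : ∀ c, Pre' c → F c = F' c) : Det p Pre' F' := by
  intro c hc c'
  rw [h c (hp c hc), hF c hc]

theorem Det.seq {p q Pre Pre' F G} (h : Det p Pre F) (h' : Det q Pre' G)
    (hp : ∀ c, Pre c → Pre' (F c)) : Det (.seq p q) Pre (fun c => G (F c)) := by
  intro c hc c'
  constructor
  · rintro ⟨d, h1, h2⟩
    rw [h c hc] at h1
    subst h1
    rwa [h' _ (hp c hc)] at h2
  · rintro rfl
    exact ⟨F c, (h c hc _).2 rfl, (h' _ (hp c hc) _).2 rfl⟩

def incP (i : ℕ) : Prog := .op (Sum.inl i)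
def decP (i : ℕ) : Prog := .op (Sum.inr (Sum.inl i))
def zeroP (i : ℕ) : Prog := .op (Sum.inr (Sum.inr i))

open Function in
theorem det_inc (i : ℕ) (Pre) : Det (incP i) Pre (fun c => update c i (c i + 1)) := by
  intro c _ c'
  constructor
  · rintro ⟨h1, h2⟩
    funext j
    by_cases hj : j = i
    · subst hj; simp [h1]
    · simp [hj, h2 j hj]
  · rintro rfl
    exact ⟨by simp, fun j hj => by simp [hj]⟩

open Function in
theorem dec_rel (i : ℕ) (c c') : (decP i).Rel c c' ↔ 0 < c i ∧ c' = update c i (c i - 1) := by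
  constructor
  · rintro ⟨h0, h1, h2⟩
    refine ⟨h0, ?_⟩
    funext j
    by_cases hj : j = i
    · subst hj; simp; omega
    · simp [hj, h2 j hj]
  · rintro ⟨h, rfl⟩
    refine ⟨h, by simp; omega, fun j hj => by simp [hj]⟩

theorem zero_rel (i : ℕ) (c c') : (zeroP i).Rel c c' ↔ c i = 0 ∧ c' = c := by
  constructor
  · rintro ⟨h0, h1⟩
    exact ⟨h0, funext h1⟩
  · rintro ⟨h, rfl⟩
    exact ⟨h, fun _ => rfl⟩

/-- Loop with body `b` until counter `i` is zero. -/
def loopB (i : ℕ) (b : Prog) : Prog := .seq (.star b) (zeroP i)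

theorem det_loopB {i b Pre} {G H : (ℕ → ℕ) → (ℕ → ℕ)}
    (hb : ∀ c, Pre c → ∀ c', b.Rel c c' ↔ 0 < c i ∧ c' = G c)
    (hG : ∀ c, Pre c → 0 < c i → Pre (G c) ∧ G c i + 1 = c i)
    (h0 : ∀ c, Pre c → c i = 0 → H c = c)
    (hS : ∀ c, Pre c → 0 < c i → H (G c) = H c) : Det (loopB i b) Pre H := by
  have key : ∀ k c, Pre c → c i = k → ∀ c', (loopB i b).Rel c c' ↔ c' = H c := by
    intro k
    induction k with
    | zero =>
      intro c hc hk c'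
      constructor
      · rintro ⟨d, h1, h2⟩
        rw [zero_rel] at h2
        obtain ⟨h2, rfl⟩ := h2
        rcases Relation.ReflTransGen.cases_head h1 with rfl | ⟨e, h3, -⟩
        · exact (h0 _ hc hk).symm
        · rw [hb c hc] at h3
          omega
      · rintro rfl
        rw [h0 c hc hk]
        exact ⟨c, Relation.ReflTransGen.refl, (zero_rel _ _ _).2 ⟨hk, rfl⟩⟩
    | succ k ih =>
      intro c hc hk c'
      have hpos : 0 < c i := by omega
      obtain ⟨hG1, hG2⟩ := hG c hc hpos
      have := ih (G c) hG1 (by omega) c'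
      rw [← hS c hc hpos, ← this]
      constructor
      · rintro ⟨d, h1, h2⟩
        refine ⟨d, ?_, h2⟩
        rcases Relation.ReflTransGen.cases_head h1 with rfl | ⟨e, h3, h4⟩
        · rw [zero_rel] at h2
          omega
        · rw [hb c hc] at h3
          rw [← h3.2]; exact h4
      · rintro ⟨d, h1, h2⟩
        exact ⟨d, Relation.ReflTransGen.head ((hb c hc _).2 ⟨hpos, rfl⟩) h1, h2⟩
  intro c hc
  exact key _ c hc rfl

/-- `while i > 0: i--; p`. -/
def loopP (i : ℕ) (p : Prog) : Prog := loopB i (.seq (decP i) p)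

open Function in
theorem det_loopP {i p Pre Pre'} {F H : (ℕ → ℕ) → (ℕ → ℕ)}
    (hp : Det p Pre' F)
    (hP : ∀ c, Pre c → 0 < c i → Pre' (update c i (c i - 1)))
    (hG : ∀ c, Pre c → 0 < c i → Pre (F (update c i (c i - 1))) ∧
      F (update c i (c i - 1)) i + 1 = c i)
    (h0 : ∀ c, Pre c → c i = 0 → H c = c)
    (hS : ∀ c, Pre c → 0 < c i → H (F (update c i (c i - 1))) = H c) :
    Det (loopP i p) Pre H := by
  refine det_loopB (G := fun c => F (update c i (c i - 1))) ?_ hG h0 hS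
  intro c hc c'
  constructor
  · rintro ⟨d, h1, h2⟩
    rw [dec_rel] at h1
    obtain ⟨h1, rfl⟩ := h1
    exact ⟨h1, (hp _ (hP c hc h1) _).1 h2⟩
  · rintro ⟨h1, rfl⟩
    exact ⟨_, (dec_rel _ _ _).2 ⟨h1, rfl⟩, (hp _ (hP c hc h1) _).2 rfl⟩

open Function

def clearP (i : ℕ) : Prog := loopB i (decP i)

theorem det_clear (i : ℕ) (Pre) : Det (clearP i) Pre (fun c => update c i 0) := by
  refine Det.mono (Pre := fun _ => True) ?_ (fun _ _ => trivial) (fun _ _ => rfl)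
  refine det_loopB (fun c _ c' => dec_rel i c c') ?_ ?_ ?_
  · intro c _ h
    refine ⟨trivial, ?_⟩
    simp; omega
  · intro c _ h
    rw [← h]; simp
  · intro c _ h
    simp

def nopP : Prog := .seq (incP 0) (decP 0)

theorem det_nop (Pre) : Det nopP Pre (fun c => c) := by
  intro c _ c'
  constructor
  · rintro ⟨d, h1, h2⟩
    rw [det_inc 0 (fun _ => True) c trivial] at h1
    rw [dec_rel] at h2
    subst h1
    simpa using h2
  · rintro rfl
    refine ⟨_, (det_inc 0 (fun _ => True) _ trivial _).2 rfl, (dec_rel _ _ _).2 ?_⟩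
    simp

def moveP (i j : ℕ) : Prog := loopP i (incP j)

theorem det_move {i j : ℕ} (hij : i ≠ j) (Pre) :
    Det (moveP i j) Pre (fun c => update (update c j (c j + c i)) i 0) := by
  refine Det.mono (Pre := fun _ => True) ?_ (fun _ _ => trivial) (fun _ _ => rfl)
  refine det_loopP (det_inc j (fun _ => True)) (fun _ _ _ => trivial) ?_ ?_ ?_
  · intro c _ h
    simp [hij]; omega
  · intro c _ h
    funext k
    by_cases h1 : k = i
    · subst h1; simp [h]
    · by_cases h2 : k = j
      · subst h2; simp [h1, h]
      · simp [h1, h2]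
  · intro c _ h
    funext k
    by_cases h1 : k = i
    · subst h1; simp
    · by_cases h2 : k = j
      · subst h2; simp [hij, h1]; omega
      · simp [h1, h2]

def copyP (i j t : ℕ) : Prog := .seq (loopP i (.seq (incP j) (incP t))) (moveP t i)

theorem det_copy {i j t : ℕ} (hij : i ≠ j) (hit : i ≠ t) (hjt : j ≠ t) :
    Det (copyP i j t) (fun c => c t = 0) (fun c => update c j (c j + c i)) := by
  have h1 : Det (loopP i (.seq (incP j) (incP t))) (fun _ => True)
      (fun c => update (update (update c j (c j + c i)) t (c t + c i)) i 0) := by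
    refine det_loopP (Pre' := fun _ => True)
      (Det.seq (det_inc j (fun _ => True)) (det_inc t (fun _ => True))
      (fun _ _ => trivial)) (fun _ _ _ => trivial) ?_ ?_ ?_
    · intro c _ h
      simp [hij, hit]; omega
    · intro c _ h
      funext k
      simp only [update_apply]
      grind
    · intro c _ h
      funext k
      simp only [update_apply]
      grind
  refine ((h1.seq (det_move (Ne.symm hit) (fun _ => True)) (fun _ _ => trivial)).mono
    (fun _ _ => trivial) ?_)
  intro c hc
  funext k
  simp only [update_apply]
  grind

/-- Clear counters `b, …, b+k-1`. -/
theorem exists_clearRange (b k : ℕ) : ∃ p, Det p (fun _ => True)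
    (fun c j => if b ≤ j ∧ j < b + k then 0 else c j) := by
  induction k with
  | zero =>
    refine ⟨nopP, (det_nop _).mono (fun _ h => h) ?_⟩
    intro c _
    funext j
    rw [if_neg (by omega)]
  | succ k ih =>
    obtain ⟨p, hp⟩ := ih
    refine ⟨_, (hp.seq (det_clear (b + k) (fun _ => True)) (fun _ h => h)).mono (fun _ h => h) ?_⟩
    intro c _
    funext j
    simp only [update_apply]
    grind

theorem compile {n : ℕ} {f : List.Vector ℕ n → ℕ} (hf : Nat.Primrec' f) :
    ∀ (ins : Fin n → ℕ) (out b : ℕ), (∀ k, ins k < b) → out < b → (∀ k, ins k ≠ out) →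
    ∃ p, Det p (fun c => c out = 0 ∧ ∀ j, b ≤ j → c j = 0)
      (fun c => update c out (f (List.Vector.ofFn fun k => c (ins k)))) := by
  induction hf with
  | zero =>
    intro ins out b _ _ _
    refine ⟨nopP, (det_nop _).mono (fun _ h => h) ?_⟩
    rintro c ⟨hc, -⟩
    have : update c out 0 = c := by rw [← hc]; simp
    exact this.symm
  | succ =>
    intro ins out b h1 h2 h3
    have hc := det_copy (h3 0) (ne_of_lt (h1 0)) (ne_of_lt h2)
    refine ⟨_, (hc.seq (det_inc out (fun _ => True)) (fun _ _ => trivial)).mono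
      (fun c h => h.2 b le_rfl) ?_⟩
    rintro c ⟨hc, -⟩
    simp [hc, List.Vector.ofFn]
  | get i =>
    intro ins out b h1 h2 h3
    refine ⟨_, (det_copy (h3 i) (ne_of_lt (h1 i)) (ne_of_lt h2)).mono
      (fun c h => h.2 b le_rfl) ?_⟩
    rintro c ⟨hc, -⟩
    simp [hc]
  | @comp m n f g hf hg ihf ihg =>
    intro ins out b h1 h2 h3
    have hgs : ∀ k, k ≤ n → ∃ p, Det p (fun c => ∀ j, b ≤ j → c j = 0)
        (fun c j => if h : b ≤ j ∧ j < b + n ∧ j < b + k then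
          g ⟨j - b, by omega⟩ (List.Vector.ofFn fun k => c (ins k)) else c j) := by
      intro k
      induction k with
      | zero =>
        intro _
        refine ⟨nopP, (det_nop _).mono (fun _ h => h) ?_⟩
        intro c _
        funext j
        rw [dif_neg (by omega)]
      | succ k ih =>
        intro hk
        obtain ⟨p, hp⟩ := ih (by omega)
        obtain ⟨q, hq⟩ := ihg ⟨k, hk⟩ ins (b + k) (b + n) (fun i => by have := h1 i; omega)
          (by omega) (fun i => by have := h1 i; omega)
        refine ⟨_, (hp.seq hq ?_).mono (fun _ h => h) ?_⟩
        · intro c hc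
          refine ⟨?_, ?_⟩
          · beta_reduce
            rw [dif_neg (by omega)]; exact hc _ (by omega)
          · intro j hj
            beta_reduce
            rw [dif_neg (by omega)]; exact hc _ (by omega)
        · intro c hc
          funext j
          have hv : ∀ i, (if h : b ≤ ins i ∧ ins i < b + n ∧ ins i < b + k then
              g ⟨ins i - b, by omega⟩ (List.Vector.ofFn fun k => c (ins k)) else c (ins i))
              = c (ins i) := by
            intro i
            have := h1 i
            rw [dif_neg (by omega)]
          simp only [hv, update_apply]
          by_cases hj : j = b + k
          · subst hj
            rw [if_pos rfl, dif_pos (by omega)]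
            simp
          · rw [if_neg hj]
            by_cases hj2 : b ≤ j ∧ j < b + n ∧ j < b + k
            · rw [dif_pos hj2, dif_pos (by omega)]
            · rw [dif_neg hj2, dif_neg (by omega)]
    obtain ⟨p, hp⟩ := hgs n le_rfl
    obtain ⟨q, hq⟩ := ihf (fun k => b + k) out (b + n) (fun i => by have := i.2; omega)
      (by omega) (fun i => by omega)
    obtain ⟨r, hr⟩ := exists_clearRange b n
    have hp' := hp.mono (Pre' := fun c => c out = 0 ∧ ∀ j, b ≤ j → c j = 0)
      (fun _ h => h.2) (fun _ _ => rfl)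
    refine ⟨_, ((hp'.seq hq ?_).seq hr (fun _ _ => trivial)).mono (fun _ h => h) ?_⟩
    · rintro c ⟨hc, hc2⟩
      refine ⟨?_, ?_⟩
      · beta_reduce
        rw [dif_neg (by omega)]; exact hc
      · intro j hj
        beta_reduce
        rw [dif_neg (by omega)]; exact hc2 _ (by omega)
    · rintro c ⟨hc, hc2⟩
      funext j
      have hv : (fun k : Fin n => if h : b ≤ b + (k : ℕ) ∧ b + (k : ℕ) < b + n ∧
          b + (k : ℕ) < b + n then
          g ⟨b + k - b, by omega⟩ (List.Vector.ofFn fun k => c (ins k)) else c (b + k))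
          = fun k => g k (List.Vector.ofFn fun k => c (ins k)) := by
        funext k
        have := k.2
        rw [dif_pos (by omega)]
        congr
        omega
      simp only [hv, update_apply]
      by_cases hj : b ≤ j ∧ j < b + n
      · rw [if_pos hj, if_neg (by omega)]
        exact (hc2 j hj.1).symm
      · rw [if_neg hj]
        by_cases hjo : j = out
        · rw [if_pos hjo, if_pos hjo]
        · rw [if_neg hjo, if_neg hjo, dif_neg (by omega)]
  | @prec n f g hf hg ihf ihg =>
    intro ins out b h1 h2 h3
    let rc : ℕ → List.Vector ℕ n → ℕ := fun y v => 
      Nat.rec (f v) (fun y IH => g (y ::ᵥ IH ::ᵥ v)) y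
    let tl : (ℕ → ℕ) → List.Vector ℕ n := fun c => List.Vector.ofFn fun k => c (ins k.succ)
    have tlc : ∀ c c' : ℕ → ℕ, (∀ j, j < b → c' j = c j) → tl c' = tl c := by
      intro c c' h
      simp only [tl]
      congr 1
      funext k
      exact h _ (h1 _)
    let Z : (ℕ → ℕ) → Prop := fun c => c (b + 2) = 0 ∧ ∀ j, b + 4 ≤ j → c j = 0
    have p1 := (det_copy (i := ins 0) (j := b + 3) (t := b + 4)
      (by have := h1 0; omega) (by have := h1 0; omega) (by omega))
    obtain ⟨p2, hp2⟩ := ihf (fun k => ins k.succ) (b + 1) (b + 4)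
      (fun k => by have := h1 k.succ; omega) (by omega) (fun k => by have := h1 k.succ; omega)
    obtain ⟨q1, hq1⟩ := ihg (Fin.cons b (Fin.cons (b + 1) (fun k => ins k.succ))) (b + 2) (b + 4)
      (by
        intro k
        refine Fin.cases ?_ (fun k => Fin.cases ?_ (fun k => ?_) k) k
        · simp
        · simp
        · have := h1 k.succ
          simp; omega)
      (by omega)
      (by
        intro k
        refine Fin.cases ?_ (fun k => Fin.cases ?_ (fun k => ?_) k) k
        · simp
        · simp
        · have := h1 k.succ
          simp; omega)
    have hq1' : Det q1 Z (fun c => update c (b + 2) (g (c b ::ᵥ c (b + 1) ::ᵥ tl c))) :=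
      hq1.mono (fun _ h => h) (fun c _ => rfl)
    have body := (((hq1'.seq (det_clear (b + 1) (fun _ => True)) (fun _ _ => trivial)).seq
      (det_move (i := b + 2) (j := b + 1) (by omega) (fun _ => True)) (fun _ _ => trivial)).seq
      (det_inc b (fun _ => True)) (fun _ _ => trivial)).mono
      (F' := fun c => update (update c (b + 1) (g (c b ::ᵥ c (b + 1) ::ᵥ tl c))) b (c b + 1))
      (fun _ h => h) (by
        rintro c ⟨hc, hc2⟩
        funext j
        simp only [update_apply]
        grind)
    have p3 := det_loopP (i := b + 3) (Pre := fun c => Z c ∧ c (b + 1) = rc (c b) (tl c))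
      (H := fun c => update (update (update c b (c b + c (b + 3))) (b + 1)
        (rc (c b + c (b + 3)) (tl c))) (b + 3) 0) body
      (by
        rintro c ⟨⟨hc, hc2⟩, -⟩ _
        refine ⟨by simp [hc], fun j hj => ?_⟩
        rw [update_of_ne (by omega)]
        exact hc2 j hj)
      (by
        rintro c ⟨⟨hc, hc2⟩, hc3⟩ h
        have e1 : tl (update c (b + 3) (c (b + 3) - 1)) = tl c :=
          tlc _ _ (fun j hj => update_of_ne (by omega) _ _)
        have e2 : ∀ x y, tl (update (update (update c (b + 3) (c (b + 3) - 1)) (b + 1) x) b y)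
            = tl c :=
          fun x y => tlc _ _ (fun j hj => by
            rw [update_of_ne (by omega), update_of_ne (by omega), update_of_ne (by omega)])
        refine ⟨⟨⟨?_, ?_⟩, ?_⟩, ?_⟩
        · simp [hc]
        · intro j hj
          rw [update_of_ne (by omega), update_of_ne (by omega), update_of_ne (by omega)]
          exact hc2 j hj
        · rw [e2, e1]
          simp [hc3, rc]
        · simp; omega)
      (by
        rintro c ⟨⟨hc, hc2⟩, hc3⟩ h
        funext j
        simp only [update_apply, h]
        grind)
      (by
        rintro c ⟨⟨hc, hc2⟩, hc3⟩ h
        have e2 : ∀ x y, tl (update (update (update c (b + 3) (c (b + 3) - 1)) (b + 1) x) b y)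
            = tl c :=
          fun x y => tlc _ _ (fun j hj => by
            rw [update_of_ne (by omega), update_of_ne (by omega), update_of_ne (by omega)])
        have e3 : c b + 1 + (c (b + 3) - 1) = c b + c (b + 3) := by omega
        funext j
        simp [e2, e3]
        simp only [update_apply]
        grind)
    have all := (((p1.mono (Pre' := fun c => ∀ j, b ≤ j → c j = 0)
      (fun c h => h _ (by omega)) (fun _ _ => rfl)).seq hp2 ?_).seq p3 ?_).seq
      (det_move (i := b + 1) (j := out) (by omega) (fun _ => True)) (fun _ _ => trivial)
    have all := all.seq
      (det_clear b (fun _ => True)) (fun _ _ => trivial)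
    refine ⟨_, all.mono (fun _ h => h.2) ?_⟩
    · rintro c ⟨hc, hc2⟩
      have e1 : tl (update c (b + 3) (c (b + 3) + c (ins 0))) = tl c :=
        tlc _ _ (fun j hj => update_of_ne (by omega) _ _)
      have e2 : ∀ x, tl (update (update c (b + 3) (c (b + 3) + c (ins 0))) (b + 1) x) = tl c :=
        fun x => tlc _ _ (fun j hj => by
            rw [update_of_ne (by omega), update_of_ne (by omega)])
      have e3 : (List.Vector.ofFn fun k => c (ins k)).tail = tl c := by
        simp [tl]
      have e4 : (List.Vector.ofFn fun k => c (ins k)).head = c (ins 0) := by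
        simp
      have e5 : c b = 0 := hc2 _ (by omega)
      have e6 : c (b + 3) = 0 := hc2 _ (by omega)
      have e7 : c (b + 1) = 0 := hc2 _ (by omega)
      funext j
      simp only [e2, e3, e4]
      simp only [update_apply]
      simp only [e5, e6, hc, Nat.zero_add, rc]
      grind
    · intro c h
      refine ⟨?_, ?_⟩
      · rw [update_of_ne (by omega)]; exact h _ (by omega)
      · intro j hj
        rw [update_of_ne (by omega)]; exact h _ (by omega)
    · intro c h
      have e1 : tl (update c (b + 3) (c (b + 3) + c (ins 0))) = tl c :=
        tlc _ _ (fun j hj => update_of_ne (by omega) _ _)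
      have e2 : ∀ x, tl (update (update c (b + 3) (c (b + 3) + c (ins 0))) (b + 1) x) = tl c :=
        fun x => tlc _ _ (fun j hj => by
            rw [update_of_ne (by omega), update_of_ne (by omega)])
      refine ⟨⟨?_, ?_⟩, ?_⟩
      · rw [update_of_ne (by omega), update_of_ne (by omega)]; exact h _ (by omega)
      · intro j hj
        rw [update_of_ne (by omega), update_of_ne (by omega)]; exact h _ (by omega)
      · have e5 : c b = 0 := h _ (by omega)
        rw [e2]
        have e8 : (List.Vector.ofFn fun k =>
          (update c (b + 3) (c (b + 3) + c (ins 0))) (ins (Fin.succ k))) = tl c := e1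
        rw [e8]
        simp [e5, rc]

end

section
open Function

/-! ### Compiling programs to counter machines -/

def shOp : CMOp → CMOp
  | Sum.inl i => Sum.inl (i + 1)
  | Sum.inr (Sum.inl i) => Sum.inr (Sum.inl (i + 1))
  | Sum.inr (Sum.inr i) => Sum.inr (Sum.inr (i + 1))

def epsOp : CMOp := Sum.inr (Sum.inr 0)

/-- Shift of a counter assignment; the new counter `0` is empty. -/
def shC (c : ℕ → ℕ) : ℕ → ℕ
  | 0 => 0
  | i + 1 => c i

theorem shC_inj {c c' : ℕ → ℕ} (h : shC c = shC c') : c = c' :=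
  funext fun i => congrFun h (i + 1)

theorem opRel_shOp (o : CMOp) (c d : ℕ → ℕ) :
    OpRel (shOp o) (shC c) d ↔ ∃ c', d = shC c' ∧ OpRel o c c' := by
  constructor
  · intro h
    refine ⟨fun i => d (i + 1), ?_, ?_⟩
    · funext i
      cases i with
      | succ i => rfl
      | zero =>
        rcases o with i | i | i
        · exact h.2 0 (by omega)
        · exact h.2.2 0 (by omega)
        · exact h.2 0
    · rcases o with i | i | i
      · exact ⟨h.1, fun j hj => h.2 (j + 1) (by omega)⟩
      · exact ⟨h.1, h.2.1, fun j hj => h.2.2 (j + 1) (by omega)⟩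
      · exact ⟨h.1, fun j => h.2 (j + 1)⟩
  · rintro ⟨c', rfl, h⟩
    rcases o with i | i | i
    · refine ⟨h.1, fun j hj => ?_⟩
      cases j with
      | zero => rfl
      | succ j => exact h.2 j (by omega)
    · refine ⟨h.1, h.2.1, fun j hj => ?_⟩
      cases j with
      | zero => rfl
      | succ j => exact h.2.2 j (by omega)
    · refine ⟨h.1, fun j => ?_⟩
      cases j with
      | zero => rfl
      | succ j => exact h.2 j

theorem opRel_eps (c d : ℕ → ℕ) : OpRel epsOp (shC c) d ↔ d = shC c :=
  ⟨fun h => funext h.2, fun h => ⟨rfl, fun j => by rw [h]⟩⟩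

/-- Transitions of the stack machine. -/
def trans : List Prog → List (CMOp × List Prog)
  | [] => []
  | .op o :: k => [(shOp o, k)]
  | .seq a b :: k => [(epsOp, a :: b :: k)]
  | .star a :: k => [(epsOp, a :: .star a :: k), (epsOp, k)]

def RelStack : List Prog → (ℕ → ℕ) → (ℕ → ℕ) → Prop
  | [], c, c' => c = c'
  | p :: k, c, c' => ∃ d, p.Rel c d ∧ RelStack k d c'

/-- Stacks occurring when running the first program over the given stack. -/
def clStk : Prog → List Prog → List (List Prog)
  | .op o, k => [.op o :: k]
  | .seq a b, k => (.seq a b :: k) :: (clStk a (b :: k) ++ clStk b k)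
  | .star a, k => (.star a :: k) :: clStk a (.star a :: k)

theorem mem_clStk_self (p k) : (p :: k) ∈ clStk p k := by
  cases p <;> simp [clStk]

theorem clStk_closed (p) : ∀ k st, st ∈ clStk p k → ∀ t ∈ trans st, t.2 ∈ clStk p k ∨ t.2 = k := by
  induction p with
  | op o =>
    intro k st h t ht
    simp only [clStk, List.mem_singleton] at h
    subst h
    simp only [trans, List.mem_singleton] at ht
    subst ht
    right; rfl
  | seq a b iha ihb =>
    intro k st h t ht
    simp only [clStk, List.mem_cons, List.mem_append] at h ⊢
    rcases h with rfl | h | h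
    · simp only [trans, List.mem_singleton] at ht
      subst ht
      left; right; left
      exact mem_clStk_self _ _
    · rcases iha _ _ h t ht with h | h
      · tauto
      · left; right; right
        rw [h]; exact mem_clStk_self _ _
    · rcases ihb _ _ h t ht with h | h
      · tauto
      · tauto
  | star a iha =>
    intro k st h t ht
    simp only [clStk, List.mem_cons] at h ⊢
    rcases h with rfl | h
    · simp only [trans, List.mem_cons, List.not_mem_nil, or_false] at ht
      rcases ht with rfl | rfl
      · left; right
        exact mem_clStk_self _ _
      · right; rfl
    · rcases iha _ _ h t ht with h | h
      · tauto
      · tauto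

theorem trans_ne (st) (h : st ≠ []) : ∃ t, t ∈ trans st := by
  rcases st with - | ⟨o | ⟨a, b⟩ | a, k⟩
  · exact absurd rfl h
  all_goals exact ⟨_, List.mem_cons_self⟩

/-- One-step soundness. -/
theorem trans_sound {st t c d c''} (ht : t ∈ trans st) (h : OpRel t.1 (shC c) d) :
    ∃ c', d = shC c' ∧ (RelStack t.2 c' c'' → RelStack st c c'') := by
  rcases st with - | ⟨o | ⟨a, b⟩ | a, k⟩
  · simp [trans] at ht
  · simp only [trans, List.mem_singleton] at ht
    subst ht
    obtain ⟨c', h1, h2⟩ := (opRel_shOp _ _ _).1 h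
    exact ⟨c', h1, fun h3 => ⟨c', h2, h3⟩⟩
  · simp only [trans, List.mem_singleton] at ht
    subst ht
    rw [opRel_eps] at h
    refine ⟨c, h, ?_⟩
    rintro ⟨d1, h1, d2, h2, h3⟩
    exact ⟨d2, ⟨d1, h1, h2⟩, h3⟩
  · simp only [trans, List.mem_cons, List.not_mem_nil, or_false] at ht
    rcases ht with rfl | rfl
    · rw [opRel_eps] at h
      refine ⟨c, h, ?_⟩
      rintro ⟨d1, h1, d2, h2, h3⟩
      exact ⟨d2, Relation.ReflTransGen.head h1 h2, h3⟩
    · rw [opRel_eps] at h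
      refine ⟨c, h, fun h3 => ⟨c, Relation.ReflTransGen.refl, h3⟩⟩

/-- Step relation of the stack machine. -/
def SStep (x y : List Prog × (ℕ → ℕ)) : Prop :=
  ∃ o, (o, y.1) ∈ trans x.1 ∧ OpRel o (shC x.2) (shC y.2)

theorem prog_complete (p) : ∀ k c d, p.Rel c d →
    Relation.ReflTransGen SStep (p :: k, c) (k, d) := by
  induction p with
  | op o =>
    intro k c d h
    exact Relation.ReflTransGen.single
      ⟨shOp o, by simp [trans], (opRel_shOp _ _ _).2 ⟨d, rfl, h⟩⟩
  | seq a b iha ihb =>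
    rintro k c d ⟨e, h1, h2⟩
    exact Relation.ReflTransGen.head (b := (a :: b :: k, c))
      ⟨epsOp, by simp [trans], (opRel_eps _ _).2 rfl⟩ ((iha _ _ _ h1).trans (ihb _ _ _ h2))
  | star a iha =>
    intro k c d h
    induction h using Relation.ReflTransGen.head_induction_on with
    | refl =>
      exact Relation.ReflTransGen.single
        ⟨epsOp, by simp [trans], (opRel_eps _ _).2 rfl⟩
    | head h1 _ ih =>
      exact Relation.ReflTransGen.head (b := (a :: .star a :: k, _))
        ⟨epsOp, by simp [trans], (opRel_eps _ _).2 rfl⟩ ((iha _ _ _ h1).trans ih)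

/-- Paths of length `l+1`. -/
def PathN {X : Type} (S : X → X → Prop) : ℕ → X → X → Prop
  | 0, x, y => S x y
  | l + 1, x, y => ∃ z, S x z ∧ PathN S l z y

theorem exists_pathN {X : Type} {S : X → X → Prop} {x y} (h : Relation.TransGen S x y) :
    ∃ l, PathN S l x y := by
  induction h using Relation.TransGen.head_induction_on with
  | single h => exact ⟨0, h⟩
  | head h _ ih =>
    obtain ⟨l, hl⟩ := ih
    exact ⟨l + 1, _, h, hl⟩

theorem exists_run {X : Type} {S : X → X → Prop} (a : ℕ → X)
    (h : ∀ k, Relation.TransGen S (a k) (a (k + 1))) :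
    ∃ ρ : ℕ → X, ρ 0 = a 0 ∧ (∀ n, S (ρ n) (ρ (n + 1))) ∧
      ∀ n, ∃ m, n ≤ m ∧ ∃ k, ρ m = a (k + 1) := by
  choose l hl using fun k => exists_pathN (h k)
  let Y := {y : X × ℕ × ℕ // PathN S y.2.2 y.1 (a (y.2.1 + 1))}
  have hn : ∀ y : Y, ∃ y' : Y, S y.1.1 y'.1.1 ∧
      (y.1.2.2 = 0 → y'.1.1 = a (y.1.2.1 + 1)) ∧ (∀ j, y.1.2.2 = j + 1 → y'.1.2.2 = j) := by
    rintro ⟨⟨x, k, j⟩, hy⟩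
    cases j with
    | zero => exact ⟨⟨(a (k + 1), k + 1, l (k + 1)), hl (k + 1)⟩, hy, fun _ => rfl, fun j hj => by simp at hj⟩
    | succ j =>
      obtain ⟨z, h1, h2⟩ := hy
      exact ⟨⟨(z, k, j), h2⟩, h1, fun h => by simp at h, fun i hi => by simpa using hi⟩
  choose nx hnx using hn
  let r : ℕ → Y := fun n => nx^[n] ⟨(a 0, 0, l 0), hl 0⟩
  have hr : ∀ n, r (n + 1) = nx (r n) := fun n => Function.iterate_succ_apply' _ _ _
  refine ⟨fun n => (r n).1.1, rfl, fun n => ?_, ?_⟩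
  · show S (r n).1.1 (r (n + 1)).1.1
    rw [hr]; exact (hnx _).1
  · have key : ∀ j n, (r n).1.2.2 = j → ∃ m, n ≤ m ∧ ∃ k, (r m).1.1 = a (k + 1) := by
      intro j
      induction j with
      | zero =>
        intro n hj
        exact ⟨n + 1, by omega, _, by rw [hr]; exact (hnx _).2.1 hj⟩
      | succ j ih =>
        intro n hj
        obtain ⟨m, hm, h⟩ := ih (n + 1) (by rw [hr]; exact (hnx _).2.2 j hj)
        exact ⟨m, by omega, h⟩
    intro n
    exact key _ n rfl

/-- The machine for a program body that first loads `n`. -/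
def mach (N base : ℕ) (instr : List (ℕ × CMOp × ℕ)) (n : ℕ) : CMDesc :=
  (N, base + n + 1, [],
    instr ++ (List.range n).map (fun j => (base + j + 1, Sum.inl 1, base + j)))

open Classical in
theorem exists_machine (body : Prog) : ∃ (N base : ℕ) (instr : List (ℕ × CMOp × ℕ)), ∀ n,
    CMRecur (mach N base instr n, base + n, base) ↔
      ∃ s : ℕ → ℕ → ℕ, s 0 = (fun i => if i = 0 then n else 0) ∧
        ∀ k, body.Rel (s k) (s (k + 1)) := by
  let Q : List (List Prog) := (clStk body [] ++ [[]]).dedup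
  have hQ0 : [] ∈ Q := by simp [Q]
  have hQb : [body] ∈ Q := by simp [Q, mem_clStk_self]
  have hQc : ∀ st ∈ Q, ∀ t ∈ trans st, t.2 ∈ Q := by
    intro st hst t ht
    simp only [Q, List.mem_dedup, List.mem_append, List.mem_singleton] at hst ⊢
    rcases hst with h | rfl
    · exact clStk_closed _ _ _ h t ht
    · simp [trans] at ht
  have hQn : Q.Nodup := List.nodup_dedup _
  clear_value Q
  let idx : List Prog → ℕ := fun st => Q.idxOf st
  have hidx : ∀ st ∈ Q, idx st < Q.length := fun st h => List.idxOf_lt_length_iff.2 h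
  have hinj : ∀ st ∈ Q, ∀ st', idx st = idx st' → st = st' := fun st h st' h' =>
    (List.idxOf_inj h).1 h'
  have hsurj : ∀ q, q < Q.length → ∃ st ∈ Q, idx st = q := fun q hq =>
    ⟨Q[q], List.getElem_mem hq, hQn.idxOf_getElem q hq⟩
  clear_value idx
  let base := Q.length
  let instr : List (ℕ × CMOp × ℕ) :=
    Q.flatMap (fun st => (trans st).map fun t => (idx st, t.1, idx t.2)) ++
      [(idx [], epsOp, base), (base, epsOp, idx [body])]
  let N := (instr.map (fun t => t.2.1.counter)).sum + 2
  have hN : ∀ t ∈ instr, t.2.1.counter < N := by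
    intro t ht
    have : t.2.1.counter ≤ (instr.map (fun t => t.2.1.counter)).sum :=
      List.le_sum_of_mem (List.mem_map.2 ⟨t, ht, rfl⟩)
    simp only [N]; omega
  have hN1 : 1 < N := by simp [N]
  clear_value N
  have hmem : ∀ t, t ∈ instr ↔ (∃ st ∈ Q, ∃ u ∈ trans st, t = (idx st, u.1, idx u.2)) ∨
      t = (idx [], epsOp, base) ∨ t = (base, epsOp, idx [body]) := by
    intro t
    simp only [instr, List.mem_append, List.mem_flatMap, List.mem_map, List.mem_cons,
      List.not_mem_nil, or_false]
    simp only [eq_comm]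
  clear_value instr
  refine ⟨N, base, instr, fun n => ?_⟩
  have hmemM : ∀ t, t ∈ (mach N base instr n).2.2.2 ↔ t ∈ instr ∨
      ∃ j < n, t = (base + j + 1, Sum.inl 1, base + j) := by
    intro t
    simp only [mach, List.mem_append, List.mem_map, List.mem_range]
    simp only [eq_comm]
  have hbl : ∀ st ∈ Q, idx st < base := hidx
  have hwf : CMWF (mach N base instr n) := by
    refine ⟨hN1, by simp [mach], ?_, ?_⟩
    · intro t ht
      rw [hmemM] at ht
      rcases ht with ht | ⟨j, hj, rfl⟩
      · have hc := hN t ht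
        rw [hmem] at ht
        rcases ht with ⟨st, hst, u, hu, rfl⟩ | rfl | rfl
        · have := hbl _ hst
          have := hbl _ (hQc _ hst u hu)
          refine ⟨?_, by simp [mach], ?_, hc⟩ <;> simp [mach] <;> omega
        · have := hbl _ hQ0
          refine ⟨?_, by simp [mach], ?_, hc⟩ <;> simp [mach]; omega
        · have := hbl _ hQb
          refine ⟨?_, by simp [mach], ?_, hc⟩ <;> simp [mach]; omega
      · refine ⟨?_, by simp [mach], ?_, hN1⟩ <;> simp [mach] <;> omega
    · intro q hq _
      simp only [mach] at hq
      rcases lt_trichotomy q base with h | h | h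
      · obtain ⟨st, hst, rfl⟩ := hsurj q h
        by_cases hst0 : st = []
        · subst hst0
          exact ⟨_, (hmemM _).2 (Or.inl ((hmem _).2 (Or.inr (Or.inl rfl)))), rfl⟩
        · obtain ⟨u, hu⟩ := trans_ne st hst0
          exact ⟨_, (hmemM _).2 (Or.inl ((hmem _).2 (Or.inl ⟨st, hst, u, hu, rfl⟩))), rfl⟩
      · exact ⟨_, (hmemM _).2 (Or.inl ((hmem _).2 (Or.inr (Or.inr rfl)))), h.symm⟩
      · exact ⟨_, (hmemM _).2 (Or.inr ⟨q - base - 1, by omega, rfl⟩), by simp; omega⟩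
  -- instruction lookup
  have look1 : ∀ st ∈ Q, ∀ op q', (idx st, op, q') ∈ (mach N base instr n).2.2.2 ↔
      (∃ u ∈ trans st, op = u.1 ∧ q' = idx u.2) ∨ (st = [] ∧ op = epsOp ∧ q' = base) := by
    intro st hst op q'
    have := hbl _ hst
    rw [hmemM, hmem]
    constructor
    · rintro ((⟨st', hst', u, hu, h⟩ | h | h) | ⟨j, hj, h⟩)
      · simp only [Prod.mk.injEq] at h
        obtain rfl := hinj _ hst _ h.1
        exact Or.inl ⟨u, hu, h.2⟩
      · simp only [Prod.mk.injEq] at h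
        exact Or.inr ⟨hinj _ hst _ h.1, h.2⟩
      · simp only [Prod.mk.injEq] at h
        omega
      · simp only [Prod.mk.injEq] at h
        omega
    · rintro (⟨u, hu, rfl, rfl⟩ | ⟨rfl, rfl, rfl⟩)
      · exact Or.inl (Or.inl ⟨st, hst, u, hu, rfl⟩)
      · exact Or.inl (Or.inr (Or.inl rfl))
  have look2 : ∀ op q', (base, op, q') ∈ (mach N base instr n).2.2.2 ↔
      op = epsOp ∧ q' = idx [body] := by
    intro op q'
    rw [hmemM, hmem]
    constructor
    · rintro ((⟨st', hst', u, hu, h⟩ | h | h) | ⟨j, hj, h⟩)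
      · simp only [Prod.mk.injEq] at h
        have := hbl _ hst'
        omega
      · simp only [Prod.mk.injEq] at h
        have := hbl _ hQ0
        omega
      · simp only [Prod.mk.injEq] at h
        exact h.2
      · simp only [Prod.mk.injEq] at h
        omega
    · rintro ⟨rfl, rfl⟩
      exact Or.inl (Or.inr (Or.inr rfl))
  have look3 : ∀ j op q', (base + j + 1, op, q') ∈ (mach N base instr n).2.2.2 ↔
      j < n ∧ op = Sum.inl 1 ∧ q' = base + j := by
    intro j op q'
    rw [hmemM, hmem]
    constructor
    · rintro ((⟨st', hst', u, hu, h⟩ | h | h) | ⟨j, hj, h⟩)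
      · simp only [Prod.mk.injEq] at h
        have := hbl _ hst'
        omega
      · simp only [Prod.mk.injEq] at h
        have := hbl _ hQ0
        omega
      · simp only [Prod.mk.injEq] at h
        omega
      · simp only [Prod.mk.injEq] at h
        obtain ⟨h1, h2, h3⟩ := h
        refine ⟨by omega, h2, by omega⟩
    · rintro ⟨h, rfl, rfl⟩
      exact Or.inr ⟨j, h, rfl⟩
  let ini : ℕ → ℕ → ℕ := fun m i => if i = 0 then m else 0
  have ini0 : shC (ini 0) = fun _ => 0 := by
    funext i
    cases i <;> simp [shC, ini]
  have iniS : ∀ m d, OpRel (Sum.inl 1) (shC (ini m)) d ↔ d = shC (ini (m + 1)) := by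
    intro m d
    constructor
    · rintro ⟨h1, h2⟩
      funext i
      by_cases hi : i = 1
      · subst hi; rw [h1]; simp [shC, ini]
      · rw [h2 i hi]
        rcases i with - | - | i
        · rfl
        · omega
        · simp [shC, ini]
    · rintro rfl
      refine ⟨by simp [shC, ini], ?_⟩
      intro i hi
      rcases i with - | - | i
      · rfl
      · omega
      · simp [shC, ini]
  clear_value base
  constructor
  · rintro ⟨-, ρ, h0, hs, hrec⟩
    dsimp only at h0 hs hrec
    simp only [cmStep_iff] at hs
    have hs' : ∀ t q, (ρ t).1 = q → ∃ op, (q, op, (ρ (t+1)).1) ∈ (mach N base instr n).2.2.2 ∧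
        OpRel op (ρ t).2 (ρ (t+1)).2 := by
      rintro t q rfl
      exact hs t
    -- from a stack state
    have fromStack : ∀ m t st c, st ∈ Q → (ρ t).1 = idx st → (ρ t).2 = shC c →
        (ρ (t + m)).1 = base → ∃ t' c', (ρ t').1 = base ∧ (ρ t').2 = shC c' ∧
          RelStack st c c' := by
      intro m
      induction m with
      | zero =>
        intro t st c hst h1 h2 h3
        have := hbl _ hst
        rw [Nat.add_zero] at h3
        omega
      | succ m ih =>
        intro t st c hst h1 h2 h3
        obtain ⟨op, h4, h5⟩ := hs' t _ h1
        rw [h2] at h5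
        rw [look1 st hst] at h4
        rcases h4 with ⟨u, hu, rfl, h6⟩ | ⟨rfl, rfl, h6⟩
        · obtain ⟨c1, h7, -⟩ := trans_sound (c'' := c) hu h5
          obtain ⟨t', c', h8, h9, h10⟩ := ih (t + 1) u.2 c1 (hQc _ hst u hu) h6 h7
            (by rw [← h3]; congr 2; omega)
          obtain ⟨c2, h11, h12⟩ := trans_sound (c'' := c') hu h5
          have : c1 = c2 := shC_inj (h7.symm.trans h11)
          subst this
          exact ⟨t', c', h8, h9, h12 h10⟩
        · rw [opRel_eps] at h5
          exact ⟨t + 1, c, h6, h5, rfl⟩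
    have fromBase : ∀ t c, (ρ t).1 = base → (ρ t).2 = shC c →
        ∃ t' c', (ρ t').1 = base ∧ (ρ t').2 = shC c' ∧ body.Rel c c' := by
      intro t c h1 h2
      obtain ⟨op, h4, h5⟩ := hs' t _ h1
      rw [look2] at h4
      obtain ⟨rfl, h4⟩ := h4
      rw [h2, opRel_eps] at h5
      obtain ⟨m, hm, h6⟩ := hrec (t + 1)
      obtain ⟨t', c', h7, h8, h9⟩ := fromStack (m - (t + 1)) (t + 1) [body] c hQb h4 h5
        (by rw [← h6]; congr 2; omega)
      obtain ⟨d, h10, h11⟩ := h9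
      exact ⟨t', c', h7, h8, h11 ▸ h10⟩
    have fromPre : ∀ j, j ≤ n → (ρ j).1 = base + (n - j) ∧ (ρ j).2 = shC (ini j) := by
      intro j
      induction j with
      | zero =>
        intro _
        rw [h0, ini0]
        simp [zeroConfig]
      | succ j ih =>
        intro hj
        obtain ⟨h1, h2⟩ := ih (by omega)
        obtain ⟨op, h4, h5⟩ := hs' j (base + (n - j - 1) + 1) (by omega)
        rw [look3] at h4
        obtain ⟨-, rfl, h4⟩ := h4
        rw [h2, iniS] at h5
        exact ⟨by omega, h5⟩
    obtain ⟨hb1, hb2⟩ := fromPre n le_rfl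
    let Y := {c : ℕ → ℕ // ∃ t, (ρ t).1 = base ∧ (ρ t).2 = shC c}
    have hY : ∀ y : Y, ∃ y' : Y, body.Rel y.1 y'.1 := by
      rintro ⟨c, t, h1, h2⟩
      obtain ⟨t', c', h3, h4, h5⟩ := fromBase t c h1 h2
      exact ⟨⟨c', t', h3, h4⟩, h5⟩
    choose nx hnx using hY
    refine ⟨fun k => (nx^[k] ⟨ini n, n, by omega, hb2⟩).1, rfl, fun k => ?_⟩
    beta_reduce
    rw [Function.iterate_succ_apply']
    exact hnx _
  · rintro ⟨s, hs0, hs⟩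
    let S : CMConfig → CMConfig → Prop := CMStep (mach N base instr n)
    have step1 : ∀ x y : List Prog × (ℕ → ℕ), x.1 ∈ Q → SStep x y →
        y.1 ∈ Q ∧ S (idx x.1, shC x.2) (idx y.1, shC y.2) := by
      rintro x y hx ⟨o, h1, h2⟩
      refine ⟨hQc _ hx _ h1, ?_⟩
      change CMStep _ _ _
      rw [cmStep_iff]
      exact ⟨o, (look1 _ hx _ _).2 (Or.inl ⟨_, h1, rfl, rfl⟩), h2⟩
    have steps : ∀ x y : List Prog × (ℕ → ℕ), x.1 ∈ Q → Relation.ReflTransGen SStep x y →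
        y.1 ∈ Q ∧ Relation.ReflTransGen S (idx x.1, shC x.2) (idx y.1, shC y.2) := by
      intro x y hx h
      induction h with
      | refl => exact ⟨hx, Relation.ReflTransGen.refl⟩
      | tail _ h2 ih =>
        obtain ⟨h3, h4⟩ := step1 _ _ ih.1 h2
        exact ⟨h3, ih.2.tail h4⟩
    have round : ∀ c c', body.Rel c c' → Relation.TransGen S (base, shC c) (base, shC c') := by
      intro c c' h
      have h1 := (steps _ _ hQb (prog_complete body [] c c' h)).2
      refine Relation.TransGen.head' (b := (idx [body], shC c)) ?_ (h1.tail ?_)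
      · change CMStep _ _ _
        rw [cmStep_iff]
        exact ⟨epsOp, (look2 _ _).2 ⟨rfl, rfl⟩, (opRel_eps _ _).2 rfl⟩
      · change CMStep _ _ _
        rw [cmStep_iff]
        exact ⟨epsOp, (look1 _ hQ0 _ _).2 (Or.inr ⟨rfl, rfl, rfl⟩), (opRel_eps _ _).2 rfl⟩
    have pre : ∀ j, j ≤ n → Relation.ReflTransGen S (base + n, shC (ini 0))
        (base + (n - j), shC (ini j)) := by
      intro j
      induction j with
      | zero => intro _; exact Relation.ReflTransGen.refl
      | succ j ih =>
        intro hj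
        refine (ih (by omega)).tail ?_
        change CMStep _ _ _
        rw [cmStep_iff]
        refine ⟨Sum.inl 1, ?_, (iniS _ _).2 rfl⟩
        have : base + (n - j) = base + (n - j - 1) + 1 := by omega
        change (base + (n - j), _, base + (n - (j + 1))) ∈ _
        rw [this, look3]
        exact ⟨by omega, rfl, by omega⟩
    have hpre := pre n le_rfl
    rw [Nat.sub_self, Nat.add_zero] at hpre
    have hs0' : s 0 = ini n := hs0
    obtain ⟨ρ, hρ0, hρ1, hρ2⟩ := exists_run (S := S)
      (fun k => if k = 0 then (base + n, shC (ini 0)) else (base, shC (s k))) (by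
        intro k
        cases k with
        | zero =>
          simp only [if_true]
          rw [if_neg (by omega)]
          refine Relation.TransGen.trans_right hpre ?_
          rw [← hs0']
          exact round _ _ (hs 0)
        | succ k =>
          rw [if_neg (by omega), if_neg (by omega)]
          exact round _ _ (hs _))
    refine ⟨hwf, ρ, ?_, hρ1, ?_⟩
    · rw [hρ0, if_pos rfl, ini0]; rfl
    · intro n'
      obtain ⟨m, hm, k, hk⟩ := hρ2 n'
      refine ⟨m, hm, ?_⟩
      rw [hk, if_neg (by omega)]

end

section
open Function

def cfg2 (n s : ℕ) : ℕ → ℕ := fun i => if i = 0 then n else if i = 1 then s else 0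

theorem star_inc_rel (i : ℕ) (c c' : ℕ → ℕ) :
    (Prog.star (incP i)).Rel c c' ↔ ∃ g, c' = update c i (c i + g) := by
  constructor
  · intro h
    replace h : Relation.ReflTransGen (incP i).Rel c c' := h
    induction h with
    | refl => exact ⟨0, by simp⟩
    | tail _ h2 ih =>
      obtain ⟨g, rfl⟩ := ih
      rw [det_inc i (fun _ => True) _ trivial] at h2
      exact ⟨g + 1, by rw [h2]; simp [Nat.add_assoc]⟩
  · rintro ⟨g, rfl⟩
    change Relation.ReflTransGen (incP i).Rel c _
    induction g with
    | zero => simp only [Nat.add_zero, update_eq_self]; exact Relation.ReflTransGen.refl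
    | succ g ih =>
      refine ih.tail ?_
      rw [det_inc i (fun _ => True) _ trivial]
      simp [Nat.add_assoc]

theorem exists_body (F : ℕ → ℕ → ℕ → ℕ)
    (hF : Primrec fun v : List.Vector ℕ 3 => F (v.get 0) (v.get 1) (v.get 2)) :
    ∃ body : Prog, ∀ n s c', body.Rel (cfg2 n s) c' ↔
      ∃ g s', F n s g = s' + 1 ∧ c' = cfg2 n s' := by
  obtain ⟨p, hp⟩ := compile (Nat.Primrec'.of_prim hF) (fun k : Fin 3 => k.1) 3 4
    (fun k => by omega) (by omega) (fun k => by omega)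
  refine ⟨.seq (.star (incP 2)) (.seq p (.seq (decP 3) (.seq (clearP 1) (.seq (moveP 3 1)
    (clearP 2))))), fun n s c' => ?_⟩
  have h1 : ∀ c c', (Prog.seq (clearP 1) (.seq (moveP 3 1) (clearP 2))).Rel c c' ↔ c' =
      update (update (update (update c 1 0) 1 (c 3)) 3 0) 2 0 := by
    intro c c'
    have := ((det_clear 1 (fun _ => True)).seq ((det_move (i := 3) (j := 1) (by omega)
      (fun _ => True)).seq (det_clear 2 (fun _ => True)) (fun _ _ => trivial))
      (fun _ _ => trivial)) c trivial c'
    rw [this]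
    simp
  have h2 : ∀ g c', p.Rel (update (cfg2 n s) 2 (cfg2 n s 2 + g)) c' ↔
      c' = update (update (cfg2 n s) 2 g) 3 (F n s g) := by
    intro g c'
    rw [hp]
    · simp [cfg2, List.Vector.get_ofFn, update_apply]
    · refine ⟨by simp [cfg2], fun j hj => ?_⟩
      rw [update_of_ne (by omega)]
      simp only [cfg2]
      rw [if_neg (by omega), if_neg (by omega)]
  constructor
  · rintro ⟨c1, r1, c2, r2, c3, r3, r4⟩
    rw [star_inc_rel] at r1
    obtain ⟨g, rfl⟩ := r1
    rw [h2] at r2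
    subst r2
    rw [dec_rel] at r3
    obtain ⟨r3, rfl⟩ := r3
    rw [h1] at r4
    subst r4
    simp only [update_self] at r3
    refine ⟨g, F n s g - 1, by omega, ?_⟩
    funext i
    simp only [cfg2, update_apply]
    grind
  · rintro ⟨g, s', h, rfl⟩
    refine ⟨_, (star_inc_rel _ _ _).2 ⟨g, rfl⟩, _, (h2 _ _).2 rfl, _,
      (dec_rel _ _ _).2 ⟨by simp [h], rfl⟩, (h1 _ _).2 ?_⟩
    funext i
    simp only [cfg2, update_apply]
    grind

theorem mach_computable (N base : ℕ) (instr : List (ℕ × CMOp × ℕ)) :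
    Computable (fun n : ℕ => ((mach N base instr n, base + n, base) : CMDesc × ℕ × ℕ)) := by
  apply Primrec.to_comp
  have h1 : Primrec (fun n : ℕ => base + n) := Primrec.nat_add.comp (Primrec.const _) Primrec.id
  have h2 : Primrec (fun n : ℕ => base + n + 1) := Primrec.succ.comp h1
  have hinl : Primrec (fun _ : ℕ × ℕ => (Sum.inl 1 : CMOp)) := Primrec.const _
  have h3 : Primrec (fun n : ℕ =>
      (List.range n).map (fun j => ((base + j + 1, Sum.inl 1, base + j) : ℕ × CMOp × ℕ))) := by
    apply Primrec.list_map Primrec.list_range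
    exact ((h2.comp Primrec.snd).pair (hinl.pair (h1.comp Primrec.snd)))
  exact ((Primrec.const N).pair (h2.pair ((Primrec.const []).pair
    (Primrec.list_append.comp (Primrec.const instr) h3)))).pair (h1.pair (Primrec.const base))

theorem cmRecur_hard (B : ℕ → Prop) (hB : Sigma11 B) : ManyOneReducible B CMRecur := by
  classical
  obtain ⟨R, ⟨_, hR⟩, hBR⟩ := hB
  have hRn : Nat.Partrec _ := hR
  obtain ⟨cR, hcR⟩ := Nat.Partrec.Code.exists_code.1 hRn
  have hev : ∀ x : ℕ × List ℕ, Encodable.encode true ∈ cR.eval (Encodable.encode x) ↔ R x := by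
    intro x
    rw [hcR]
    simp only [Encodable.encodek, Part.coe_some, Part.bind_some, PFun.coe_val, Part.map_some,
      Part.mem_some_iff]
    rw [Encodable.encode_inj]
    simp
  let F : ℕ → ℕ → ℕ → ℕ := fun n s g =>
    if Nat.Partrec.Code.evaln g.unpair.2 cR
        (Encodable.encode (n, Denumerable.ofNat (List ℕ) s)) = some (Encodable.encode true) then
      Encodable.encode (Denumerable.ofNat (List ℕ) s ++ [g.unpair.1]) + 1 else 0
  have hF : Primrec fun v : List.Vector ℕ 3 => F (v.get 0) (v.get 1) (v.get 2) := by
    have g0 : ∀ i, Primrec fun v : List.Vector ℕ 3 => v.get i := fun i =>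
      Primrec.vector_get.comp Primrec.id (Primrec.const i)
    have gl : Primrec fun v : List.Vector ℕ 3 => Denumerable.ofNat (List ℕ) (v.get 1) :=
      (Primrec.ofNat _).comp (g0 1)
    have gu : Primrec fun v : List.Vector ℕ 3 => (v.get 2).unpair := Primrec.unpair.comp (g0 2)
    refine Primrec.ite (PrimrecRel.comp Primrec.eq
      (Nat.Partrec.Code.primrec_evaln.comp (((Primrec.snd.comp gu).pair (Primrec.const cR)).pair
        (Primrec.encode.comp ((g0 0).pair gl)))) (Primrec.const _)) ?_ (Primrec.const 0)
    exact Primrec.succ.comp (Primrec.encode.comp (Primrec.list_append.comp gl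
      (Primrec.list_cons.comp (Primrec.fst.comp gu) (Primrec.const []))))
  have hF' : ∀ n l s', (∃ g, F n (Encodable.encode l) g = s' + 1) ↔
      R (n, l) ∧ ∃ a, s' = Encodable.encode (l ++ [a]) := by
    intro n l s'
    simp only [F, Denumerable.ofNat_encode]
    constructor
    · rintro ⟨g, hg⟩
      split_ifs at hg with h
      exact ⟨(hev _).1 (Nat.Partrec.Code.evaln_complete.2 ⟨_, h⟩), g.unpair.1, by omega⟩
    · rintro ⟨h, a, rfl⟩
      obtain ⟨k, hk⟩ := Nat.Partrec.Code.evaln_complete.1 ((hev _).2 h)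
      refine ⟨Nat.pair a k, ?_⟩
      simp only [Nat.unpair_pair]
      exact if_pos hk
  obtain ⟨body, hbody⟩ := exists_body F hF
  obtain ⟨N, base, instr, hm⟩ := exists_machine body
  refine ⟨_, mach_computable N base instr, fun n => ?_⟩
  rw [hm, hBR]
  have e0 : (fun i => if i = 0 then n else 0 : ℕ → ℕ) =
      cfg2 n (Encodable.encode ([] : List ℕ)) := by
    funext i; simp [cfg2]
  rw [e0]
  constructor
  · rintro ⟨f, hf⟩
    refine ⟨fun k => cfg2 n (Encodable.encode ((List.range k).map f)), by simp, fun k => ?_⟩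
    rw [hbody]
    obtain ⟨g, hg⟩ := (hF' n ((List.range k).map f)
      (Encodable.encode ((List.range (k + 1)).map f))).2 ⟨hf k, f k, by simp [List.range_succ]⟩
    exact ⟨g, _, hg, rfl⟩
  · rintro ⟨s, hs0, hs⟩
    have key : ∀ k, ∃ l : List ℕ, s k = cfg2 n (Encodable.encode l) ∧ l.length = k := by
      intro k
      induction k with
      | zero => exact ⟨[], hs0, rfl⟩
      | succ k ih =>
        obtain ⟨l, hl, hk⟩ := ih
        have := hs k
        rw [hl, hbody] at this
        obtain ⟨g, s', h1, h2⟩ := this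
        obtain ⟨-, a, rfl⟩ := (hF' n l s').1 ⟨g, h1⟩
        exact ⟨_, h2, by simp [hk]⟩
    choose l hl hlen using key
    have cinj : ∀ x y, cfg2 n x = cfg2 n y → x = y := by
      intro x y h
      simpa [cfg2] using congrFun h 1
    have hstep : ∀ k, R (n, l k) ∧ ∃ a, l (k + 1) = l k ++ [a] := by
      intro k
      have := hs k
      rw [hl, hl, hbody] at this
      obtain ⟨g, s', h1, h2⟩ := this
      obtain ⟨h3, a, rfl⟩ := (hF' n (l k) s').1 ⟨g, h1⟩
      exact ⟨h3, a, Encodable.encode_injective (cinj _ _ h2)⟩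
    choose hR' a ha using hstep
    refine ⟨a, fun m => ?_⟩
    have : ∀ m, l m = (List.range m).map a := by
      intro m
      induction m with
      | zero => simpa using hlen 0
      | succ m ih => rw [ha, ih]; simp [List.range_succ]
    rw [← this]
    exact hR' m

end

section
open Function

/-! ### The formula -/

namespace BForm
def or' (φ ψ : BForm) : BForm := neg (and (neg φ) (neg ψ))
def ex1 (φ : BForm) : BForm := or' φ (dia1 φ)
def un1 (φ : BForm) : BForm := ex1 (and φ (neg (dia1 φ)))
def new0 (φ : BForm) : BForm := and φ (neg (dia0 φ))
def bigAnd (l : List BForm) : BForm := l.foldr and top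
def bigOr (l : List BForm) : BForm := l.foldr or' bot
end BForm

open BForm in
section
def vN : BForm := var 0
def vK : BForm := var 1
def vS (q : ℕ) : BForm := var (3 * q + 2)
def vI (q : ℕ) : BForm := var (3 * q + 3)
def vD (q : ℕ) : BForm := var (3 * q + 4)

/-- No `N` in the past. -/
def startF : BForm := boxP1 (neg (dia0 vN))

def ctrF (op : CMOp) (j : ℕ) : BForm :=
  and (if op = Sum.inl j then un1 (new0 (vI j)) else boxP1 (neg (new0 (vI j))))
    (and (if op = Sum.inr (Sum.inl j) then un1 (new0 (vD j)) else boxP1 (neg (new0 (vD j))))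
      (if op = Sum.inr (Sum.inr j) then boxP1 (imp (vI j) (vD j)) else top))

def instrF (n : ℕ) (t : ℕ × CMOp × ℕ) : BForm :=
  and (vS t.2.2) (and
    (ex1 (and (neg (dia0 (dia0 vN)))
      (or' (and vK (dia0 (and vN (and (vS t.1) (neg vK)))))
        (and (neg vK) (dia0 (and vN (and (vS t.1) vK)))))))
    (bigAnd ((List.range n).map (ctrF t.2.1))))

def regF (j : ℕ) : BForm :=
  and (imp (dia0 (vI j)) (vI j)) (and (imp (dia0 (vD j)) (vD j))
    (and (imp (vD j) (vI j)) (imp (vI j) (ex1 vN))))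

def exclF (a b : ℕ) : BForm := if a = b then top else neg (and (vS a) (vS b))

def locF (p : CMDesc × ℕ × ℕ) : BForm :=
  and (imp vN (neg (dia1 vN))) (and (imp vN (neg (dia0 vN))) (and (imp vK (box1 vK))
  (and (bigAnd ((List.range (p.1.2.1 + p.2.1 + p.2.2 + 1)).map fun a =>
      bigAnd ((List.range (p.1.2.1 + p.2.1 + p.2.2 + 1)).map fun b => exclF a b)))
  (and (bigAnd ((List.range p.1.1).map regF))
  (and (imp (and vN startF) (and (vS p.2.1)
      (bigAnd ((List.range p.1.1).map fun j => boxP1 (neg (vI j))))))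
    (imp vN (or' startF (bigOr (p.1.2.2.2.map (instrF p.1.1))))))))))

def phiF (p : CMDesc × ℕ × ℕ) : BForm :=
  and (dia0 (ex1 (and vN startF)))
    (and (boxP1 (imp (dia0 vN) (dia0 (and (ex1 (and vN (vS p.2.2))) (dia0 vN)))))
      (box0 (boxP1 (locF p))))
end

/-! ### Semantics -/

section
variable {W : Type} (R0 R1 : W → W → Prop) (val : ℕ → W → Prop)

/-- Reflexive closure of the vertical relation. -/
def Q1 (R1 : W → W → Prop) (x y : W) : Prop := x = y ∨ R1 x y

theorem sat_imp (w φ ψ) : BSat R0 R1 val w (BForm.imp φ ψ) ↔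
    (BSat R0 R1 val w φ → BSat R0 R1 val w ψ) := by
  simp only [BForm.imp, BSat]; tauto
theorem sat_or (w φ ψ) : BSat R0 R1 val w (BForm.or' φ ψ) ↔
    (BSat R0 R1 val w φ ∨ BSat R0 R1 val w ψ) := by
  simp only [BForm.or', BSat]; tauto
theorem sat_bot (w) : BSat R0 R1 val w BForm.bot ↔ False := by
  simp only [BForm.bot, BSat]; tauto
theorem sat_top (w) : BSat R0 R1 val w BForm.top ↔ True := by
  simp only [BForm.top, BForm.bot, BSat]; tauto
theorem sat_box0 (w φ) : BSat R0 R1 val w (BForm.box0 φ) ↔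
    ∀ v, R0 w v → BSat R0 R1 val v φ := by
  simp only [BForm.box0, BSat]; push Not; rfl
theorem sat_box1 (w φ) : BSat R0 R1 val w (BForm.box1 φ) ↔
    ∀ v, R1 w v → BSat R0 R1 val v φ := by
  simp only [BForm.box1, BSat]; push Not; rfl
theorem sat_boxP0 (w φ) : BSat R0 R1 val w (BForm.boxP0 φ) ↔
    ∀ v, (w = v ∨ R0 w v) → BSat R0 R1 val v φ := by
  simp only [BForm.boxP0, BSat, sat_box0]
  constructor
  · rintro ⟨h1, h2⟩ v (rfl | h)
    · exact h1
    · exact h2 v h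
  · intro h
    exact ⟨h w (Or.inl rfl), fun v hv => h v (Or.inr hv)⟩
theorem sat_boxP1 (w φ) : BSat R0 R1 val w (BForm.boxP1 φ) ↔
    ∀ v, Q1 R1 w v → BSat R0 R1 val v φ := by
  simp only [BForm.boxP1, BSat, sat_box1]
  constructor
  · rintro ⟨h1, h2⟩ v (rfl | h)
    · exact h1
    · exact h2 v h
  · intro h
    exact ⟨h w (Or.inl rfl), fun v hv => h v (Or.inr hv)⟩
theorem sat_ex1 (w φ) : BSat R0 R1 val w (BForm.ex1 φ) ↔
    ∃ v, Q1 R1 w v ∧ BSat R0 R1 val v φ := by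
  simp only [BForm.ex1, sat_or, BSat]
  constructor
  · rintro (h | ⟨v, h, h'⟩)
    · exact ⟨w, Or.inl rfl, h⟩
    · exact ⟨v, Or.inr h, h'⟩
  · rintro ⟨v, rfl | h, h'⟩
    · exact Or.inl h'
    · exact Or.inr ⟨v, h, h'⟩
theorem sat_un1 (w φ) : BSat R0 R1 val w (BForm.un1 φ) ↔
    ∃ v, Q1 R1 w v ∧ BSat R0 R1 val v φ ∧ ∀ u, R1 v u → ¬ BSat R0 R1 val u φ := by
  simp only [BForm.un1, sat_ex1, BSat]; push Not; rfl
theorem sat_bigAnd (w) (l : List BForm) : BSat R0 R1 val w (BForm.bigAnd l) ↔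
    ∀ φ ∈ l, BSat R0 R1 val w φ := by
  induction l with
  | nil => simp [BForm.bigAnd, sat_top]
  | cons a l ih =>
    have : BForm.bigAnd (a :: l) = BForm.and a (BForm.bigAnd l) := rfl
    rw [this]; simp [BSat, ih]
theorem sat_bigOr (w) (l : List BForm) : BSat R0 R1 val w (BForm.bigOr l) ↔
    ∃ φ ∈ l, BSat R0 R1 val w φ := by
  induction l with
  | nil => simp [BForm.bigOr, sat_bot]
  | cons a l ih =>
    have : BForm.bigOr (a :: l) = BForm.or' a (BForm.bigOr l) := rfl
    rw [this]; simp [sat_or, ih]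

/-- `X` is new at `w`. -/
def New (X : W → Prop) (w : W) : Prop := X w ∧ ¬ ∃ u, R0 w u ∧ X u

def IsStart (N : W → Prop) (w : W) : Prop := ∀ u, Q1 R1 w u → ¬ ∃ y, R0 u y ∧ N y

/-- Some point of the column is the unique new one, resp. there are no new ones. -/
def UnNew (X : W → Prop) (w : W) : Prop :=
  ∃ v, Q1 R1 w v ∧ New R0 X v ∧ ∀ u, R1 v u → ¬ New R0 X u
def NoNew (X : W → Prop) (w : W) : Prop := ∀ v, Q1 R1 w v → ¬ New R0 X v

structure CtrS (I D : ℕ → W → Prop) (w : W) (op : CMOp) (j : ℕ) : Prop where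
  inc : op = Sum.inl j → UnNew R0 R1 (I j) w
  ninc : op ≠ Sum.inl j → NoNew R0 R1 (I j) w
  dec : op = Sum.inr (Sum.inl j) → UnNew R0 R1 (D j) w
  ndec : op ≠ Sum.inr (Sum.inl j) → NoNew R0 R1 (D j) w
  zero : op = Sum.inr (Sum.inr j) → ∀ v, Q1 R1 w v → I j v → D j v

structure LocS (N K : W → Prop) (S I D : ℕ → W → Prop) (p : CMDesc × ℕ × ℕ) (w : W) :
    Prop where
  n1 : N w → ¬ ∃ v, R1 w v ∧ N v
  n0 : N w → ¬ ∃ v, R0 w v ∧ N v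
  k1 : K w → ∀ v, R1 w v → K v
  ex : ∀ a < p.1.2.1 + p.2.1 + p.2.2 + 1, ∀ b < p.1.2.1 + p.2.1 + p.2.2 + 1, a ≠ b →
    ¬ (S a w ∧ S b w)
  iI : ∀ j < p.1.1, ∀ u, R0 w u → I j u → I j w
  dD : ∀ j < p.1.1, ∀ u, R0 w u → D j u → D j w
  dI : ∀ j < p.1.1, D j w → I j w
  iN : ∀ j < p.1.1, I j w → ∃ v, Q1 R1 w v ∧ N v
  start : N w → IsStart R0 R1 N w → S p.2.1 w ∧ ∀ j < p.1.1, ∀ v, Q1 R1 w v → ¬ I j v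
  step : N w → IsStart R0 R1 N w ∨ ∃ t ∈ p.1.2.2.2, S t.2.2 w ∧
    (∃ e, Q1 R1 w e ∧ (¬ ∃ u, R0 e u ∧ ∃ y, R0 u y ∧ N y) ∧
      ((K e ∧ ∃ y, R0 e y ∧ N y ∧ S t.1 y ∧ ¬ K y) ∨
       (¬ K e ∧ ∃ y, R0 e y ∧ N y ∧ S t.1 y ∧ K y))) ∧
    ∀ j < p.1.1, CtrS R0 R1 I D w t.2.1 j

structure GoodS (N K : W → Prop) (S I D : ℕ → W → Prop) (p : CMDesc × ℕ × ℕ) (r : W) :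
    Prop where
  root1 : ∃ v, R0 r v ∧ ∃ x, Q1 R1 v x ∧ N x ∧ IsStart R0 R1 N x
  root2 : ∀ w, Q1 R1 r w → (∃ y, R0 w y ∧ N y) →
    ∃ v, R0 w v ∧ (∃ x, Q1 R1 v x ∧ N x ∧ S p.2.2 x) ∧ ∃ y, R0 v y ∧ N y
  loc : ∀ v, R0 r v → ∀ w, Q1 R1 v w → LocS R0 R1 N K S I D p w

theorem sat_start (w) : BSat R0 R1 val w startF ↔ IsStart R0 R1 (val 0) w := by
  simp only [startF, sat_boxP1, BSat, vN, IsStart]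

theorem sat_new (w n) : BSat R0 R1 val w (BForm.new0 (.var n)) ↔ New R0 (val n) w := by
  simp only [BForm.new0, BSat, New]

theorem sat_ctr (w op j) : BSat R0 R1 val w (ctrF op j) ↔
    CtrS R0 R1 (fun j => val (3 * j + 3)) (fun j => val (3 * j + 4)) w op j := by
  have h1 : ∀ n, BSat R0 R1 val w (BForm.un1 (BForm.new0 (.var n))) ↔ UnNew R0 R1 (val n) w := by
    intro n; simp only [sat_un1, sat_new, UnNew]
  have h2 : ∀ n, BSat R0 R1 val w (BForm.boxP1 (BForm.neg (BForm.new0 (.var n)))) ↔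
      NoNew R0 R1 (val n) w := by
    intro n; simp only [sat_boxP1, BSat, sat_new, NoNew]
  rw [ctrF]
  constructor
  · rintro ⟨ha, hb, hc⟩
    constructor
    · intro h; rw [if_pos h] at ha; exact (h1 _).1 ha
    · intro h; rw [if_neg h] at ha; exact (h2 _).1 ha
    · intro h; rw [if_pos h] at hb; exact (h1 _).1 hb
    · intro h; rw [if_neg h] at hb; exact (h2 _).1 hb
    · intro h; rw [if_pos h] at hc
      simpa only [sat_boxP1, sat_imp, BSat, vI, vD] using hc
  · intro h
    refine ⟨?_, ?_, ?_⟩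
    · split_ifs with h'
      · exact (h1 _).2 (h.inc h')
      · exact (h2 _).2 (h.ninc h')
    · split_ifs with h'
      · exact (h1 _).2 (h.dec h')
      · exact (h2 _).2 (h.ndec h')
    · split_ifs with h'
      · simpa only [sat_boxP1, sat_imp, BSat, vI, vD] using h.zero h'
      · exact (sat_top _ _ _ _).2 trivial

theorem sat_loc (w p) : BSat R0 R1 val w (locF p) ↔
    LocS R0 R1 (val 0) (val 1) (fun j => val (3 * j + 2)) (fun j => val (3 * j + 3))
      (fun j => val (3 * j + 4)) p w := by
  have hex : ∀ a b, BSat R0 R1 val w (exclF a b) ↔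
      (a ≠ b → ¬ (val (3 * a + 2) w ∧ val (3 * b + 2) w)) := by
    intro a b
    rw [exclF]
    split_ifs with h
    · simp [sat_top, h]
    · simp [BSat, vS, h]
  simp only [locF, BSat, sat_imp, sat_bigAnd, sat_bigOr, List.mem_map, List.mem_range,
    forall_exists_index, and_imp, forall_apply_eq_imp_iff₂, sat_or, sat_start, sat_boxP1,
    sat_box1, sat_ex1, regF, instrF, sat_ctr, hex, vN, vK, vS, vI, vD, exists_exists_and_eq_and]
  constructor
  · rintro ⟨h1, h2, h3, h4, h5, h6, h7⟩
    exact ⟨h1, h2, h3, h4, fun j hj => (h5 j hj).1, fun j hj => (h5 j hj).2.1,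
      fun j hj => (h5 j hj).2.2.1, fun j hj => (h5 j hj).2.2.2, h6, h7⟩
  · rintro ⟨h1, h2, h3, h4, h5, h6, h7, h8, h9, h10⟩
    exact ⟨h1, h2, h3, h4, fun j hj => ⟨h5 j hj, h6 j hj, h7 j hj, h8 j hj⟩, h9, h10⟩

theorem sat_phi (r p) : BSat R0 R1 val r (phiF p) ↔
    GoodS R0 R1 (val 0) (val 1) (fun j => val (3 * j + 2)) (fun j => val (3 * j + 3))
      (fun j => val (3 * j + 4)) p r := by
  simp only [phiF, BSat, sat_imp, sat_start, sat_boxP1, sat_box0, sat_ex1, sat_loc, vN, vS]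
  constructor
  · rintro ⟨h1, h2, h3⟩
    exact ⟨h1, h2, h3⟩
  · rintro ⟨h1, h2, h3⟩
    exact ⟨h1, h2, h3⟩
end

end

section
open Function

/-! ### Computability of the formula -/

section
variable {α β : Type} [Primcodable α] [Primcodable β]

def PrF (f : α → BForm) : Prop := Primrec fun a => encodeB (f a)

theorem PrF.const (φ : BForm) : PrF (fun _ : α => φ) := Primrec.const _
theorem PrF.var {f : α → ℕ} (h : Primrec f) : PrF (fun a => BForm.var (f a)) :=
  Primrec₂.natPair.comp (Primrec.const 0) h
theorem PrF.neg {f : α → BForm} (h : PrF f) : PrF (fun a => BForm.neg (f a)) :=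
  Primrec₂.natPair.comp (Primrec.const 1) h
theorem PrF.and {f g : α → BForm} (h : PrF f) (h' : PrF g) : PrF (fun a => BForm.and (f a) (g a)) :=
  Primrec₂.natPair.comp (Primrec.const 2) (Primrec₂.natPair.comp h h')
theorem PrF.dia0 {f : α → BForm} (h : PrF f) : PrF (fun a => BForm.dia0 (f a)) :=
  Primrec₂.natPair.comp (Primrec.const 3) h
theorem PrF.dia1 {f : α → BForm} (h : PrF f) : PrF (fun a => BForm.dia1 (f a)) :=
  Primrec₂.natPair.comp (Primrec.const 4) h
theorem PrF.or {f g : α → BForm} (h : PrF f) (h' : PrF g) : PrF (fun a => BForm.or' (f a) (g a)) :=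
  (h.neg.and h'.neg).neg
theorem PrF.imp {f g : α → BForm} (h : PrF f) (h' : PrF g) : PrF (fun a => BForm.imp (f a) (g a)) :=
  (h.and h'.neg).neg
theorem PrF.ex1 {f : α → BForm} (h : PrF f) : PrF (fun a => BForm.ex1 (f a)) :=
  h.or h.dia1
theorem PrF.box0 {f : α → BForm} (h : PrF f) : PrF (fun a => BForm.box0 (f a)) := h.neg.dia0.neg
theorem PrF.box1 {f : α → BForm} (h : PrF f) : PrF (fun a => BForm.box1 (f a)) := h.neg.dia1.neg
theorem PrF.boxP1 {f : α → BForm} (h : PrF f) : PrF (fun a => BForm.boxP1 (f a)) := h.and h.box1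
theorem PrF.un1 {f : α → BForm} (h : PrF f) : PrF (fun a => BForm.un1 (f a)) :=
  (h.and h.dia1.neg).ex1
theorem PrF.new0 {f : α → BForm} (h : PrF f) : PrF (fun a => BForm.new0 (f a)) :=
  h.and h.dia0.neg
theorem PrF.ite {c : α → Prop} [DecidablePred c] {f g : α → BForm} (hc : PrimrecPred c)
    (h : PrF f) (h' : PrF g) : PrF (fun a => if c a then f a else g a) :=
  (Primrec.ite hc h h').of_eq fun a => by
    show (if c a then _ else _) = encodeB (if c a then f a else g a)
    split_ifs <;> rfl
theorem PrF.comp {f : β → BForm} (h : PrF f) {g : α → β} (hg : Primrec g) :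
    PrF (fun a => f (g a)) := by
  have h' : Primrec (fun b => encodeB (f b)) := h
  exact h'.comp hg
theorem PrF.bigAnd {l : α → List β} {f : α → β → BForm} (hl : Primrec l)
    (hf : PrF fun x : α × β => f x.1 x.2) : PrF (fun a => BForm.bigAnd ((l a).map (f a))) := by
  have : Primrec fun a => (l a).foldr
      (fun b s => Nat.pair 2 (Nat.pair (encodeB (f a b)) s)) (encodeB BForm.top) := by
    refine Primrec.list_foldr (h := fun a (x : β × ℕ) =>
      Nat.pair 2 (Nat.pair (encodeB (f a x.1)) x.2)) hl (Primrec.const _) ?_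
    refine Primrec₂.natPair.comp (Primrec.const 2) (Primrec₂.natPair.comp ?_ ?_)
    · have hf' : Primrec (fun x : α × β => encodeB (f x.1 x.2)) := hf
      exact hf'.comp (Primrec.fst.pair (Primrec.fst.comp Primrec.snd))
    · exact Primrec.snd.comp Primrec.snd
  refine this.of_eq fun a => ?_
  show List.foldr _ _ (l a) = encodeB (BForm.bigAnd ((l a).map (f a)))
  generalize l a = L
  induction L with
  | nil => rfl
  | cons b l ih => simp only [List.foldr_cons, ih]; rfl
theorem PrF.bigOr {l : α → List β} {f : α → β → BForm} (hl : Primrec l)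
    (hf : PrF fun x : α × β => f x.1 x.2) : PrF (fun a => BForm.bigOr ((l a).map (f a))) := by
  have : Primrec fun a => (l a).foldr
      (fun b s => Nat.pair 1 (Nat.pair 2 (Nat.pair (Nat.pair 1 (encodeB (f a b)))
        (Nat.pair 1 s)))) (encodeB BForm.bot) := by
    refine Primrec.list_foldr (h := fun a (x : β × ℕ) =>
      Nat.pair 1 (Nat.pair 2 (Nat.pair (Nat.pair 1 (encodeB (f a x.1)))
        (Nat.pair 1 x.2)))) hl (Primrec.const _) ?_
    refine Primrec₂.natPair.comp (Primrec.const 1) (Primrec₂.natPair.comp (Primrec.const 2)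
      (Primrec₂.natPair.comp (Primrec₂.natPair.comp (Primrec.const 1) ?_)
        (Primrec₂.natPair.comp (Primrec.const 1) ?_)))
    · have hf' : Primrec (fun x : α × β => encodeB (f x.1 x.2)) := hf
      exact hf'.comp (Primrec.fst.pair (Primrec.fst.comp Primrec.snd))
    · exact Primrec.snd.comp Primrec.snd
  refine this.of_eq fun a => ?_
  show List.foldr _ _ (l a) = encodeB (BForm.bigOr ((l a).map (f a)))
  generalize l a = L
  induction L with
  | nil => rfl
  | cons b l ih => simp only [List.foldr_cons, ih]; rfl
end

theorem prim_lin (k : ℕ) : Primrec fun q : ℕ => 3 * q + k :=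
  Primrec.nat_add.comp (Primrec.nat_mul.comp (Primrec.const 3) Primrec.id) (Primrec.const k)

theorem prF_S : PrF vS := PrF.var (prim_lin 2)
theorem prF_I : PrF vI := PrF.var (prim_lin 3)
theorem prF_D : PrF vD := PrF.var (prim_lin 4)

theorem prF_ctr : PrF fun x : CMOp × ℕ => ctrF x.1 x.2 := by
  have hI : PrF fun x : CMOp × ℕ => vI x.2 := prF_I.comp Primrec.snd
  have hD : PrF fun x : CMOp × ℕ => vD x.2 := prF_D.comp Primrec.snd
  refine PrF.and (PrF.ite ?_ hI.new0.un1 hI.new0.neg.boxP1)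
    (PrF.and (PrF.ite ?_ hD.new0.un1 hD.new0.neg.boxP1)
      (PrF.ite ?_ (hI.imp hD).boxP1 (PrF.const _)))
  · exact Primrec.eq.comp Primrec.fst (Primrec.sumInl.comp Primrec.snd)
  · exact Primrec.eq.comp Primrec.fst (Primrec.sumInr.comp (Primrec.sumInl.comp Primrec.snd))
  · exact Primrec.eq.comp Primrec.fst (Primrec.sumInr.comp (Primrec.sumInr.comp Primrec.snd))

theorem prF_instr : PrF fun x : ℕ × (ℕ × CMOp × ℕ) => instrF x.1 x.2 := by
  have p0 : Primrec fun x : ℕ × (ℕ × CMOp × ℕ) => x.1 := Primrec.fst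
  have p4 : Primrec fun x : ℕ × (ℕ × CMOp × ℕ) => x.2 := Primrec.snd
  have p1 : Primrec fun x : ℕ × (ℕ × CMOp × ℕ) => x.2.1 := Primrec.fst.comp p4
  have p5 : Primrec fun x : ℕ × (ℕ × CMOp × ℕ) => x.2.2 := Primrec.snd.comp p4
  have p2 : Primrec fun x : ℕ × (ℕ × CMOp × ℕ) => x.2.2.1 := Primrec.fst.comp p5
  have p3 : Primrec fun x : ℕ × (ℕ × CMOp × ℕ) => x.2.2.2 := Primrec.snd.comp p5
  have hS : PrF fun x : ℕ × (ℕ × CMOp × ℕ) => vS x.2.1 := PrF.comp prF_S p1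
  have hS' : PrF fun x : ℕ × (ℕ × CMOp × ℕ) => vS x.2.2.2 := PrF.comp prF_S p3
  have hN : PrF fun _ : ℕ × (ℕ × CMOp × ℕ) => vN := PrF.const _
  have hK : PrF fun _ : ℕ × (ℕ × CMOp × ℕ) => vK := PrF.const _
  have hL : Primrec fun x : ℕ × (ℕ × CMOp × ℕ) => List.range x.1 := Primrec.list_range.comp p0
  have hc : PrF fun y : (ℕ × (ℕ × CMOp × ℕ)) × ℕ => ctrF y.1.2.2.1 y.2 := by
    have e1 : Primrec fun y : (ℕ × (ℕ × CMOp × ℕ)) × ℕ => y.1 := Primrec.fst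
    have e2 : Primrec fun y : (ℕ × (ℕ × CMOp × ℕ)) × ℕ => y.2 := Primrec.snd
    have e3 : Primrec fun y : (ℕ × (ℕ × CMOp × ℕ)) × ℕ => y.1.2.2.1 := p2.comp e1
    have := PrF.comp (g := fun y : (ℕ × (ℕ × CMOp × ℕ)) × ℕ => (y.1.2.2.1, y.2)) prF_ctr
      (e3.pair e2)
    exact this
  have hA : PrF fun x : ℕ × (ℕ × CMOp × ℕ) =>
      BForm.bigAnd ((List.range x.1).map (ctrF x.2.2.1)) :=
    PrF.bigAnd (f := fun (x : ℕ × (ℕ × CMOp × ℕ)) j => ctrF x.2.2.1 j) hL hc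
  have hB := PrF.ex1 ((hN.dia0.dia0.neg).and
    ((hK.and (hN.and (hS.and hK.neg)).dia0).or (hK.neg.and (hN.and (hS.and hK)).dia0)))
  exact hS'.and (hB.and hA)

theorem prF_reg : PrF regF :=
  (prF_I.dia0.imp prF_I).and ((prF_D.dia0.imp prF_D).and
    ((prF_D.imp prF_I).and (prF_I.imp (PrF.const _))))

theorem prF_excl : PrF fun x : ℕ × ℕ => exclF x.1 x.2 :=
  PrF.ite (Primrec.eq.comp Primrec.fst Primrec.snd) (PrF.const _)
    ((prF_S.comp Primrec.fst).and (prF_S.comp Primrec.snd)).neg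

theorem prF_phi : PrF phiF := by
  have pM : Primrec fun p : CMDesc × ℕ × ℕ => p.1 := Primrec.fst
  have pq : Primrec fun p : CMDesc × ℕ × ℕ => p.2 := Primrec.snd
  have q0 : Primrec fun p : CMDesc × ℕ × ℕ => p.2.1 := Primrec.fst.comp pq
  have qr : Primrec fun p : CMDesc × ℕ × ℕ => p.2.2 := Primrec.snd.comp pq
  have nn : Primrec fun p : CMDesc × ℕ × ℕ => p.1.1 := Primrec.fst.comp pM
  have pM2 : Primrec fun p : CMDesc × ℕ × ℕ => p.1.2 := Primrec.snd.comp pM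
  have st : Primrec fun p : CMDesc × ℕ × ℕ => p.1.2.1 := Primrec.fst.comp pM2
  have pM3 : Primrec fun p : CMDesc × ℕ × ℕ => p.1.2.2 := Primrec.snd.comp pM2
  have ins : Primrec fun p : CMDesc × ℕ × ℕ => p.1.2.2.2 := Primrec.snd.comp pM3
  have bd0 : Primrec fun p : CMDesc × ℕ × ℕ => p.1.2.1 + p.2.1 :=
    Primrec.nat_add.comp st q0
  have bd1 : Primrec fun p : CMDesc × ℕ × ℕ => p.1.2.1 + p.2.1 + p.2.2 :=
    Primrec.nat_add.comp bd0 qr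
  have bd2 : Primrec fun p : CMDesc × ℕ × ℕ => p.1.2.1 + p.2.1 + p.2.2 + 1 :=
    Primrec.succ.comp bd1
  have bd : Primrec fun p : CMDesc × ℕ × ℕ => List.range (p.1.2.1 + p.2.1 + p.2.2 + 1) :=
    Primrec.list_range.comp bd2
  have rg : Primrec fun p : CMDesc × ℕ × ℕ => List.range p.1.1 := Primrec.list_range.comp nn
  have hN : PrF fun _ : CMDesc × ℕ × ℕ => vN := PrF.const _
  have hst : PrF fun _ : CMDesc × ℕ × ℕ => startF := PrF.const _
  have e2 : Primrec fun y : (CMDesc × ℕ × ℕ) × ℕ => y.2 := Primrec.snd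
  have e1 : Primrec fun y : (CMDesc × ℕ × ℕ) × ℕ => y.1 := Primrec.fst
  have h4 : PrF fun p : CMDesc × ℕ × ℕ =>
      BForm.bigAnd ((List.range (p.1.2.1 + p.2.1 + p.2.2 + 1)).map fun a =>
        BForm.bigAnd ((List.range (p.1.2.1 + p.2.1 + p.2.2 + 1)).map fun b => exclF a b)) := by
    have d1 : Primrec fun z : ((CMDesc × ℕ × ℕ) × ℕ) × ℕ => z.1.2 := e2.comp Primrec.fst
    have d2 : Primrec fun z : ((CMDesc × ℕ × ℕ) × ℕ) × ℕ => z.2 := Primrec.snd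
    have h0 : PrF fun z : ((CMDesc × ℕ × ℕ) × ℕ) × ℕ => exclF z.1.2 z.2 := by
      have := PrF.comp (g := fun z : ((CMDesc × ℕ × ℕ) × ℕ) × ℕ => (z.1.2, z.2)) prF_excl
        (d1.pair d2)
      exact this
    have h1 : PrF fun y : (CMDesc × ℕ × ℕ) × ℕ =>
        BForm.bigAnd ((List.range (y.1.1.2.1 + y.1.2.1 + y.1.2.2 + 1)).map
          fun b => exclF y.2 b) :=
      PrF.bigAnd (f := fun (y : (CMDesc × ℕ × ℕ) × ℕ) b => exclF y.2 b) (bd.comp e1) h0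
    exact PrF.bigAnd (f := fun (p : CMDesc × ℕ × ℕ) a =>
      BForm.bigAnd ((List.range (p.1.2.1 + p.2.1 + p.2.2 + 1)).map fun b => exclF a b)) bd h1
  have h5 : PrF fun p : CMDesc × ℕ × ℕ => BForm.bigAnd ((List.range p.1.1).map regF) :=
    PrF.bigAnd (f := fun (_ : CMDesc × ℕ × ℕ) j => regF j) rg (PrF.comp prF_reg e2)
  have h6 : PrF fun p : CMDesc × ℕ × ℕ =>
      BForm.bigAnd ((List.range p.1.1).map fun j => BForm.boxP1 (BForm.neg (vI j))) :=
    PrF.bigAnd (f := fun (_ : CMDesc × ℕ × ℕ) j => BForm.boxP1 (BForm.neg (vI j))) rg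
      (PrF.comp prF_I e2).neg.boxP1
  have h7 : PrF fun p : CMDesc × ℕ × ℕ =>
      BForm.bigOr (p.1.2.2.2.map (instrF p.1.1)) := by
    have d1 : Primrec fun z : (CMDesc × ℕ × ℕ) × (ℕ × CMOp × ℕ) => z.1.1.1 :=
      nn.comp Primrec.fst
    have d2 : Primrec fun z : (CMDesc × ℕ × ℕ) × (ℕ × CMOp × ℕ) => z.2 := Primrec.snd
    have h0 : PrF fun z : (CMDesc × ℕ × ℕ) × (ℕ × CMOp × ℕ) => instrF z.1.1.1 z.2 := by
      have := PrF.comp (g := fun z : (CMDesc × ℕ × ℕ) × (ℕ × CMOp × ℕ) => (z.1.1.1, z.2))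
        prF_instr (d1.pair d2)
      exact this
    exact PrF.bigOr (f := fun (p : CMDesc × ℕ × ℕ) t => instrF p.1.1 t) ins h0
  have hS0 : PrF fun p : CMDesc × ℕ × ℕ => vS p.2.1 := PrF.comp prF_S q0
  have hSr : PrF fun p : CMDesc × ℕ × ℕ => vS p.2.2 := PrF.comp prF_S qr
  have hK : PrF fun _ : CMDesc × ℕ × ℕ => vK := PrF.const _
  have loc : PrF locF :=
    (hN.imp hN.dia1.neg).and ((hN.imp hN.dia0.neg).and ((hK.imp hK.box1).and (h4.and (h5.and
      (((hN.and hst).imp (hS0.and h6)).and (hN.imp (hst.or h7)))))))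
  have hr : PrF fun _ : CMDesc × ℕ × ℕ =>
    BForm.dia0 (BForm.ex1 (BForm.and vN startF)) := PrF.const _
  exact hr.and ((hN.dia0.imp ((hN.and hSr).ex1.and hN.dia0).dia0).boxP1.and
    loc.boxP1.box0)

/-! ### Decidability of well-formedness -/

theorem primrecPred_forall {α β : Type} [Primcodable α] [Primcodable β] {l : α → List β}
    {R : β → α → Prop} (hl : Primrec l) (hR : PrimrecPred fun x : β × α => R x.1 x.2) :
    PrimrecPred fun a => ∀ b ∈ l a, R b a :=
  (PrimrecRel.forall_mem_list (R := R) hR).comp hl Primrec.id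

theorem primrecPred_exists {α β : Type} [Primcodable α] [Primcodable β] {l : α → List β}
    {R : β → α → Prop} (hl : Primrec l) (hR : PrimrecPred fun x : β × α => R x.1 x.2) :
    PrimrecPred fun a => ∃ b ∈ l a, R b a :=
  (PrimrecRel.exists_mem_list (R := R) hR).comp hl Primrec.id

theorem primrecPred_mem {α : Type} [Primcodable α] {l : α → List ℕ}
    {f : α → ℕ} (hl : Primrec l) (hf : Primrec f) :
    PrimrecPred fun a => f a ∈ l a := by
  refine (primrecPred_exists (R := fun b a => b = f a) hl
    (Primrec.eq.comp Primrec.fst (hf.comp Primrec.snd))).of_eq fun a => ?_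
  simp

theorem primrec_counter : Primrec CMOp.counter := by
  have : Primrec fun o : CMOp => Sum.casesOn (motive := fun _ => ℕ) o (fun i => i)
      (fun o' => Sum.casesOn (motive := fun _ => ℕ) o' (fun i => i) (fun i => i)) := by
    refine Primrec.sumCasesOn (f := fun o : CMOp => o) (g := fun _ i => i)
      (h := fun _ o' => Sum.casesOn (motive := fun _ => ℕ) o' (fun i => i) (fun i => i))
      Primrec.id Primrec₂.right ?_
    exact Primrec.sumCasesOn (f := fun x : CMOp × (ℕ ⊕ ℕ) => x.2) (g := fun _ i => i)
      (h := fun _ i => i) Primrec.snd Primrec₂.right Primrec₂.right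
  exact this.of_eq fun o => by rcases o with i | i | i <;> rfl

theorem primrec_wf : PrimrecPred CMWF := by
  have nn : Primrec fun p : CMDesc => p.1 := Primrec.fst
  have st0 : Primrec fun p : CMDesc => p.2 := Primrec.snd
  have st : Primrec fun p : CMDesc => p.2.1 := Primrec.fst.comp st0
  have te0 : Primrec fun p : CMDesc => p.2.2 := Primrec.snd.comp st0
  have te : Primrec fun p : CMDesc => p.2.2.1 := Primrec.fst.comp te0
  have ins : Primrec fun p : CMDesc => p.2.2.2 := Primrec.snd.comp te0
  have h1 : PrimrecPred fun M : CMDesc => 1 < M.1 :=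
    PrimrecRel.comp Primrec.nat_lt (Primrec.const 1) nn
  have h2 : PrimrecPred fun M : CMDesc => ∀ q ∈ M.2.2.1, q < M.2.1 := by
    have e1 : Primrec fun x : ℕ × CMDesc => x.1 := Primrec.fst
    have e2 : Primrec fun x : ℕ × CMDesc => x.2.2.1 := st.comp Primrec.snd
    have h : PrimrecPred fun x : ℕ × CMDesc => x.1 < x.2.2.1 :=
      PrimrecRel.comp Primrec.nat_lt e1 e2
    exact primrecPred_forall (R := fun q (M : CMDesc) => q < M.2.1) te h
  have h3 : PrimrecPred fun M : CMDesc => ∀ t ∈ M.2.2.2, t.1 < M.2.1 ∧ t.1 ∉ M.2.2.1 ∧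
      t.2.2 < M.2.1 ∧ CMOp.counter t.2.1 < M.1 := by
    have e1 : Primrec fun x : (ℕ × CMOp × ℕ) × CMDesc => x.1 := Primrec.fst
    have e2 : Primrec fun x : (ℕ × CMOp × ℕ) × CMDesc => x.2 := Primrec.snd
    have p1 : Primrec fun x : (ℕ × CMOp × ℕ) × CMDesc => x.1.1 := Primrec.fst.comp e1
    have p4 : Primrec fun x : (ℕ × CMOp × ℕ) × CMDesc => x.1.2 := Primrec.snd.comp e1
    have p2 : Primrec fun x : (ℕ × CMOp × ℕ) × CMDesc => x.1.2.1 := Primrec.fst.comp p4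
    have p3 : Primrec fun x : (ℕ × CMOp × ℕ) × CMDesc => x.1.2.2 := Primrec.snd.comp p4
    have p5 : Primrec fun x : (ℕ × CMOp × ℕ) × CMDesc => CMOp.counter x.1.2.1 :=
      primrec_counter.comp p2
    have c1 : PrimrecPred fun x : (ℕ × CMOp × ℕ) × CMDesc => x.1.1 < x.2.2.1 :=
      PrimrecRel.comp Primrec.nat_lt p1 (st.comp e2)
    have c2 : PrimrecPred fun x : (ℕ × CMOp × ℕ) × CMDesc => x.1.1 ∈ x.2.2.2.1 :=
      primrecPred_mem (te.comp e2) p1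
    have c3 : PrimrecPred fun x : (ℕ × CMOp × ℕ) × CMDesc => x.1.2.2 < x.2.2.1 :=
      PrimrecRel.comp Primrec.nat_lt p3 (st.comp e2)
    have c4 : PrimrecPred fun x : (ℕ × CMOp × ℕ) × CMDesc => CMOp.counter x.1.2.1 < x.2.1 :=
      PrimrecRel.comp Primrec.nat_lt p5 (nn.comp e2)
    exact primrecPred_forall (R := fun t (M : CMDesc) => t.1 < M.2.1 ∧ t.1 ∉ M.2.2.1 ∧
      t.2.2 < M.2.1 ∧ CMOp.counter t.2.1 < M.1) ins (c1.and (c2.not.and (c3.and c4)))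
  have h4 : PrimrecPred fun M : CMDesc => ∀ q, q < M.2.1 → q ∉ M.2.2.1 →
      ∃ t ∈ M.2.2.2, t.1 = q := by
    have : PrimrecPred fun M : CMDesc => ∀ q ∈ List.range M.2.1,
        (q ∈ M.2.2.1 ∨ ∃ t ∈ M.2.2.2, t.1 = q) := by
      have e1 : Primrec fun x : ℕ × CMDesc => x.1 := Primrec.fst
      have e2 : Primrec fun x : ℕ × CMDesc => x.2 := Primrec.snd
      have c1 : PrimrecPred fun x : ℕ × CMDesc => x.1 ∈ x.2.2.2.1 :=
        primrecPred_mem (te.comp e2) e1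
      have d1 : Primrec fun y : (ℕ × CMOp × ℕ) × (ℕ × CMDesc) => y.1.1 :=
        Primrec.fst.comp Primrec.fst
      have d2 : Primrec fun y : (ℕ × CMOp × ℕ) × (ℕ × CMDesc) => y.2.1 :=
        e1.comp Primrec.snd
      have c0 : PrimrecPred fun y : (ℕ × CMOp × ℕ) × (ℕ × CMDesc) => y.1.1 = y.2.1 :=
        PrimrecRel.comp Primrec.eq d1 d2
      have c2 : PrimrecPred fun x : ℕ × CMDesc => ∃ t ∈ x.2.2.2.2, t.1 = x.1 :=
        primrecPred_exists (R := fun (t : ℕ × CMOp × ℕ) (x : ℕ × CMDesc) => t.1 = x.1)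
          (ins.comp e2) c0
      exact primrecPred_forall
        (R := fun q (M : CMDesc) => q ∈ M.2.2.1 ∨ ∃ t ∈ M.2.2.2, t.1 = q)
        (Primrec.list_range.comp st) (c1.or c2)
    refine this.of_eq fun M => ?_
    simp only [List.mem_range]
    exact forall₂_congr fun q _ => Classical.or_iff_not_imp_left
  exact h1.and (h2.and (h3.and h4))

open Classical in
/-- The reduction. -/
noncomputable def redF (p : CMDesc × ℕ × ℕ) : BForm := if CMWF p.1 then phiF p else BForm.bot

open Classical in
theorem prF_red : PrF redF :=
  PrF.ite (primrec_wf.comp Primrec.fst) prF_phi (PrF.const _)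

end

section
open Function

/-! ### First-order consequences of the commutator -/

structure FF {W : Type} (R0 R1 : W → W → Prop) : Prop where
  tr : ∀ {x y z}, R0 x y → R0 y z → R0 x z
  wc : ∀ {x y z}, R0 x y → R0 x z → y = z ∨ R0 y z ∨ R0 z y
  disc : ∀ (Y P : W → Prop) (w z : W), Y w → (∀ v, Y v → P v → ∃ u, R0 v u ∧ Y u ∧ ¬ P u) →
    (∀ v, Y v → ¬ P v → ∃ u, R0 v u ∧ Y u ∧ P u) → R0 w z → (∀ u, R0 z u → ¬ Y u) → False
  sym : ∀ {x y}, R1 x y → R1 y x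
  ptr : ∀ {x y z}, R1 x y → R1 y z → x = z ∨ R1 x z
  c1 : ∀ {x y z}, R0 x y → R1 y z → ∃ u, R1 x u ∧ R0 u z
  c2 : ∀ {x y z}, R1 x y → R0 y z → ∃ u, R0 x u ∧ R1 u z

theorem disK43_mem {φ} (h : φ ∈ DisK43) : φ ∈ Commutator DisK43 DiffLogic :=
  fun _ hL => hL.2.1 h
theorem diff_mem {φ} (h : φ ∈ DiffLogic) : φ ∈ Commutator DisK43 DiffLogic :=
  fun _ hL => hL.2.2.1 h

def ax4 : BForm := .imp (.dia0 (.dia0 (.var 0))) (.dia0 (.var 0))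
def axWc : BForm := .imp (.and (.dia0 (.var 0)) (.dia0 (.var 1)))
  (.or' (.dia0 (.and (.var 0) (.var 1))) (.or' (.dia0 (.and (.var 0) (.dia0 (.var 1))))
    (.dia0 (.and (.var 1) (.dia0 (.var 0))))))
/-- Variable 0 is the set `Y`, variable 1 is the set `P`. -/
def axDisc : BForm := .neg (.and (.var 0) (.and
  (.boxP0 (.imp (.and (.var 0) (.var 1)) (.dia0 (.and (.var 0) (.neg (.var 1)))))) (.and
  (.boxP0 (.imp (.and (.var 0) (.neg (.var 1))) (.dia0 (.and (.var 0) (.var 1)))))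
  (.dia0 (.box0 (.neg (.var 0)))))))
def axSym : BForm := .imp (.var 0) (.box1 (.dia1 (.var 0)))
def axPtr : BForm := .imp (.dia1 (.dia1 (.var 0))) (.or' (.var 0) (.dia1 (.var 0)))

theorem sat_disc {W : Type} (R0 R1 : W → W → Prop) (val : ℕ → W → Prop) (w : W) :
    BSat R0 R1 val w axDisc ↔ ¬ (val 0 w ∧
      (∀ v, (w = v ∨ R0 w v) → val 0 v → val 1 v → ∃ u, R0 v u ∧ val 0 u ∧ ¬ val 1 u) ∧
      (∀ v, (w = v ∨ R0 w v) → val 0 v → ¬ val 1 v → ∃ u, R0 v u ∧ val 0 u ∧ val 1 u) ∧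
      ∃ z, R0 w z ∧ ∀ u, R0 z u → ¬ val 0 u) := by
  simp only [axDisc, BSat, sat_boxP0, sat_imp, sat_box0, and_imp]

theorem disc_valid {T : Type} (R : T → T → Prop) (hw : WeakOrd R) (hd : ModallyDiscrete R)
    (Y P : T → Prop) (w z : T) (hY : Y w)
    (h1 : ∀ v, (w = v ∨ R w v) → Y v → P v → ∃ u, R v u ∧ Y u ∧ ¬ P u)
    (h2 : ∀ v, (w = v ∨ R w v) → Y v → ¬ P v → ∃ u, R v u ∧ Y u ∧ P u)
    (hz : R w z) (hz' : ∀ u, R z u → ¬ Y u) : False := by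
  obtain ⟨tr, wc⟩ := hw
  have nx : ∀ v : {v // Y v ∧ (w = v ∨ R w v)}, ∃ u : {v // Y v ∧ (w = v ∨ R w v)},
      R v.1 u.1 ∧ v.1 ≠ u.1 := by
    rintro ⟨v, hv, hwv⟩
    have key : ∃ u, R v u ∧ Y u ∧ v ≠ u := by
      by_cases hP : P v
      · obtain ⟨u, a, b, c⟩ := h1 v hwv hv hP
        exact ⟨u, a, b, fun e => c (e ▸ hP)⟩
      · obtain ⟨u, a, b, c⟩ := h2 v hwv hv hP
        exact ⟨u, a, b, fun e => hP (e ▸ c)⟩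
    obtain ⟨u, a, b, c⟩ := key
    refine ⟨⟨u, b, Or.inr ?_⟩, a, c⟩
    rcases hwv with rfl | h
    · exact a
    · exact tr _ _ _ h a
  choose f hf using nx
  let x : ℕ → {v // Y v ∧ (w = v ∨ R w v)} := fun n => f^[n] ⟨w, hY, Or.inl rfl⟩
  have xs : ∀ n, x (n + 1) = f (x n) := fun n => Function.iterate_succ_apply' f n _
  have hx : ∀ n, R (x n).1 (x (n+1)).1 := fun n => by rw [xs]; exact (hf _).1
  refine hd ⟨fun n => (x n).1, z, hx, fun n => by beta_reduce; rw [xs]; exact (hf _).2, fun n => ?_,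
    fun n h => hz' _ h (x n).2.1⟩
  rcases (x n).2.2 with h | h
  · beta_reduce; rw [← h]; exact hz
  · rcases wc _ _ _ h hz with e | h' | h'
    · exact absurd (x (n+1)).2.1 (hz' _ (e ▸ hx n))
    · exact h'
    · exact absurd (x n).2.1 (hz' _ h')

theorem ax4_mem : ax4 ∈ DisK43 := by
  refine ⟨by simp [ax4, BForm.imp, BForm.OnlyDia0], fun T R _ hw _ val w => ?_⟩
  simp only [ax4, sat_imp, BSat]
  rintro ⟨y, h, z, h', hz⟩
  exact ⟨z, hw.1 _ _ _ h h', hz⟩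

theorem axWc_mem : axWc ∈ DisK43 := by
  refine ⟨by simp [axWc, BForm.imp, BForm.or', BForm.OnlyDia0], fun T R _ hw _ val w => ?_⟩
  simp only [axWc, sat_imp, sat_or, BSat]
  rintro ⟨⟨y, h, hy⟩, z, h', hz⟩
  rcases hw.2 _ _ _ h h' with rfl | a | a
  · exact Or.inl ⟨y, h, hy, hz⟩
  · exact Or.inr (Or.inl ⟨y, h, hy, z, a, hz⟩)
  · exact Or.inr (Or.inr ⟨z, h', hz, y, a, hy⟩)

theorem axDisc_mem : axDisc ∈ DisK43 := by
  refine ⟨by simp [axDisc, BForm.imp, BForm.boxP0, BForm.box0, BForm.OnlyDia0],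
    fun T R _ hw hd val w => ?_⟩
  rw [sat_disc]
  rintro ⟨h0, h1, h2, z, hz, hz'⟩
  exact disc_valid R hw hd (val 0) (val 1) w z h0 h1 h2 hz hz'

theorem axSym_mem : axSym ∈ DiffLogic := by
  refine ⟨by simp [axSym, BForm.imp, BForm.box1, BForm.OnlyDia1], fun D _ val w => ?_⟩
  simp only [axSym, sat_imp, sat_box1, BSat]
  intro h v hv
  exact ⟨w, hv.symm, h⟩

theorem axPtr_mem : axPtr ∈ DiffLogic := by
  refine ⟨by simp [axPtr, BForm.imp, BForm.or', BForm.OnlyDia1], fun D _ val w => ?_⟩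
  simp only [axPtr, sat_imp, sat_or, BSat]
  rintro ⟨y, h, z, h', hz⟩
  by_cases e : w = z
  · exact Or.inl (e ▸ hz)
  · exact Or.inr ⟨z, e, hz⟩

theorem frame_facts (F : Frame2) (h : ∀ φ ∈ Commutator DisK43 DiffLogic, F.Valid φ) :
    FF F.R0 F.R1 := by
  constructor
  · intro x y z hxy hyz
    have := h _ (disK43_mem ax4_mem) (fun _ u => u = z) x
    simp only [ax4, sat_imp, BSat] at this
    obtain ⟨u, hu, rfl⟩ := this ⟨y, hxy, z, hyz, rfl⟩
    exact hu
  · intro x y z hxy hxz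
    have := h _ (disK43_mem axWc_mem) (fun n u => if n = 0 then u = y else u = z) x
    simp only [axWc, sat_imp, sat_or, BSat, if_true, one_ne_zero, if_false] at this
    rcases this ⟨⟨y, hxy, rfl⟩, z, hxz, rfl⟩ with ⟨u, _, rfl, hz⟩ | ⟨u, _, rfl, v, hv, rfl⟩ |
      ⟨u, _, rfl, v, hv, rfl⟩
    · exact Or.inl hz
    · exact Or.inr (Or.inl hv)
    · exact Or.inr (Or.inr hv)
  · intro Y P w z hY h1 h2 hz hz'
    have := h _ (disK43_mem axDisc_mem) (fun n u => if n = 0 then Y u else P u) w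
    rw [sat_disc] at this
    simp only [if_true, one_ne_zero, if_false] at this
    exact this ⟨hY, fun v _ => h1 v, fun v _ => h2 v, z, hz, hz'⟩
  · intro x y hxy
    have := h _ (diff_mem axSym_mem) (fun _ u => u = x) x
    simp only [axSym, sat_imp, sat_box1, BSat] at this
    obtain ⟨u, hu, rfl⟩ := this trivial y hxy
    exact hu
  · intro x y z hxy hyz
    have := h _ (diff_mem axPtr_mem) (fun _ u => u = z) x
    simp only [axPtr, sat_imp, sat_or, BSat] at this
    rcases this ⟨y, hxy, z, hyz, rfl⟩ with h | ⟨u, hu, rfl⟩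
    · exact Or.inl h
    · exact Or.inr hu
  · intro x y z hxy hyz
    have := h commAx1 (fun _ hL => hL.2.2.2.1) (fun _ u => ∃ v, F.R1 x v ∧ F.R0 v u) x
    simp only [commAx1, sat_imp, sat_box0, sat_box1, BSat] at this
    exact this (fun v hv u hu => ⟨v, hv, hu⟩) y hxy z hyz
  · intro x y z hxy hyz
    have := h commAx2 (fun _ hL => hL.2.2.2.2.1) (fun _ u => ∃ v, F.R0 x v ∧ F.R1 v u) x
    simp only [commAx2, sat_imp, sat_box0, sat_box1, BSat] at this
    exact this (fun v hv u hu => ⟨v, hv, hu⟩) y hxy z hyz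

namespace FF
variable {W : Type} {R0 R1 : W → W → Prop}

theorem q_symm (F : FF R0 R1) {x y} (h : Q1 R1 x y) : Q1 R1 y x := by
  rcases h with rfl | h
  · exact Or.inl rfl
  · exact Or.inr (F.sym h)
theorem q_trans (F : FF R0 R1) {x y z} (h : Q1 R1 x y) (h' : Q1 R1 y z) : Q1 R1 x z := by
  rcases h with rfl | h
  · exact h'
  · rcases h' with rfl | h'
    · exact Or.inr h
    · exact F.ptr h h'
theorem q1 (F : FF R0 R1) {x y z} (h : R0 x y) (h' : Q1 R1 y z) : ∃ u, Q1 R1 x u ∧ R0 u z := by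
  rcases h' with rfl | h'
  · exact ⟨x, Or.inl rfl, h⟩
  · obtain ⟨u, a, b⟩ := F.c1 h h'
    exact ⟨u, Or.inr a, b⟩
theorem q2 (F : FF R0 R1) {x y z} (h : Q1 R1 x y) (h' : R0 y z) : ∃ u, R0 x u ∧ Q1 R1 u z := by
  rcases h with rfl | h
  · exact ⟨z, h', Or.inl rfl⟩
  · obtain ⟨u, a, b⟩ := F.c2 h h'
    exact ⟨u, a, Or.inr b⟩

/-- Chain version of discreteness. -/
theorem chain (F : FF R0 R1) (y : ℕ → W) (P : W → Prop) (z : W) (hP : ∀ i, P (y i) ↔ Even i)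
    (hy : ∀ i, R0 (y i) (y (i + 1))) (hz : R0 (y 0) z) (hz' : ∀ i, ¬ R0 z (y i)) : False := by
  refine F.disc (fun u => ∃ i, u = y i) P (y 0) z ⟨0, rfl⟩ ?_ ?_ hz ?_
  · rintro _ ⟨i, rfl⟩ h
    refine ⟨_, hy i, ⟨_, rfl⟩, ?_⟩
    rw [hP] at h ⊢
    rw [Nat.even_add_one]; exact fun h' => h' h
  · rintro _ ⟨i, rfl⟩ h
    refine ⟨_, hy i, ⟨_, rfl⟩, ?_⟩
    rw [hP] at h ⊢
    rwa [Nat.even_add_one]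
  · rintro _ hu ⟨i, rfl⟩
    exact hz' i hu
end FF

end

section
open Function

/-! ### Soundness: the run described by a model -/

section
variable {W : Type} {R0 R1 : W → W → Prop}

/-- Column precedence. -/
def Ab (R0 R1 : W → W → Prop) (x y : W) : Prop := ∃ e, Q1 R1 x e ∧ R0 e y

/-- Points seen from the root. -/
def Gn (R0 R1 : W → W → Prop) (r w : W) : Prop := ∃ v, R0 r v ∧ Q1 R1 v w

theorem q_refl (x : W) : Q1 R1 x x := Or.inl rfl

namespace FF
theorem ab_q (F : FF R0 R1) {x x' y y'} (hx : Q1 R1 x' x) (h : Ab R0 R1 x y) (hy : Q1 R1 y y') :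
    Ab R0 R1 x' y' := by
  obtain ⟨e, he, h⟩ := h
  obtain ⟨u, hu, h'⟩ := F.q1 h hy
  exact ⟨u, F.q_trans hx (F.q_trans he hu), h'⟩
theorem ab_trans (F : FF R0 R1) {x y z} (h : Ab R0 R1 x y) (h' : Ab R0 R1 y z) :
    Ab R0 R1 x z := by
  obtain ⟨f, hf, h'⟩ := h'
  obtain ⟨u, hu, h⟩ := F.ab_q (q_refl x) h hf
  exact ⟨u, hu, F.tr h h'⟩
theorem ab_fwd (F : FF R0 R1) {x y} (h : Ab R0 R1 x y) : ∃ u, R0 x u ∧ Q1 R1 u y := by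
  obtain ⟨e, he, h⟩ := h
  exact F.q2 he h
theorem g_q (F : FF R0 R1) {r w u} (h : Gn R0 R1 r w) (h' : Q1 R1 w u) : Gn R0 R1 r u := by
  obtain ⟨v, hv, h⟩ := h
  exact ⟨v, hv, F.q_trans h h'⟩
theorem g_r (F : FF R0 R1) {r w u} (h : Gn R0 R1 r w) (h' : R0 w u) : Gn R0 R1 r u := by
  obtain ⟨v, hv, h⟩ := h
  obtain ⟨t, ht, h''⟩ := F.q2 h h'
  exact ⟨t, F.tr hv ht, h''⟩
theorem tri (F : FF R0 R1) {r x y} (hx : Gn R0 R1 r x) (hy : Gn R0 R1 r y) :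
    Q1 R1 x y ∨ Ab R0 R1 x y ∨ Ab R0 R1 y x := by
  obtain ⟨v, hv, hx⟩ := hx
  obtain ⟨v', hv', hy⟩ := hy
  rcases F.wc hv hv' with rfl | h | h
  · exact Or.inl (F.q_trans (F.q_symm hx) hy)
  · exact Or.inr (Or.inl (F.ab_q (F.q_symm hx) ⟨v, q_refl _, h⟩ hy))
  · exact Or.inr (Or.inr (F.ab_q (F.q_symm hy) ⟨v', q_refl _, h⟩ hx))
end FF

/-- Basic situation: start column, uniqueness of `N`, step data, recurrence. -/
structure Sit (R0 R1 : W → W → Prop) (G N : W → Prop) (s : W) : Prop where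
  F : FF R0 R1
  gq : ∀ {w u}, G w → Q1 R1 w u → G u
  gr : ∀ {w u}, G w → R0 w u → G u
  tri : ∀ {x y}, G x → G y → Q1 R1 x y ∨ Ab R0 R1 x y ∨ Ab R0 R1 y x
  nu : ∀ {x y}, N x → N y → G x → Q1 R1 x y → x = y
  ns : N s
  gs : G s
  st : ∀ {y}, N y → ¬ Ab R0 R1 s y

/-- `y` is the immediate predecessor of `x` (witnessed by modal means). -/
def Prd (R0 R1 : W → W → Prop) (G N : W → Prop) (x y : W) : Prop :=
  N y ∧ G y ∧ ¬ Q1 R1 x y ∧ ∃ e, Q1 R1 x e ∧ R0 e y ∧ ¬ ∃ u, R0 e u ∧ ∃ y, R0 u y ∧ N y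

namespace Sit
variable {G N : W → Prop} {s : W}

theorem abs (H : Sit R0 R1 G N s) {x} (hn : N x) (hg : G x) (hx : x ≠ s) : Ab R0 R1 x s := by
  rcases H.tri hg H.gs with h | h | h
  · exact absurd (H.nu hn H.ns hg h) hx
  · exact h
  · exact absurd h (H.st hn)

theorem chainT (H : Sit R0 R1 G N s) (x : ℕ → W) (hN : ∀ i, N (x i)) (hG : ∀ i, G (x i))
    (hA : ∀ i, Ab R0 R1 (x i) (x (i + 1))) (P : W → Prop) (hP : ∀ i, P (x i) ↔ Even i)
    (hPQ : ∀ u v, Q1 R1 u v → P u → P v) : False := by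
  have F := H.F
  have step : ∀ i (u : {u // Q1 R1 (x i) u}), ∃ v : {v // Q1 R1 (x (i+1)) v}, R0 u.1 v.1 := by
    rintro i ⟨u, hu⟩
    obtain ⟨v, hv, hv'⟩ := F.ab_fwd (F.ab_q (F.q_symm hu) (hA i) (q_refl _))
    exact ⟨⟨v, F.q_symm hv'⟩, hv⟩
  choose g hg using step
  let y : (i : ℕ) → {u // Q1 R1 (x i) u} := fun i => Nat.rec ⟨x 0, q_refl _⟩ g i
  have hy : ∀ i, R0 (y i).1 (y (i+1)).1 := fun i => hg i (y i)
  have h0 : Ab R0 R1 (x 0) s := by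
    refine H.abs (hN 0) (hG 0) ?_
    intro e
    exact H.st (hN 1) (e ▸ hA 0)
  obtain ⟨z, hz, hz'⟩ := F.ab_fwd h0
  refine F.chain (fun i => (y i).1) P z ?_ hy hz ?_
  · intro i
    rw [← hP]
    exact ⟨hPQ _ _ (F.q_symm (y i).2), hPQ _ _ (y i).2⟩
  · intro i h
    exact H.st (hN i) (F.ab_q (F.q_symm hz') ⟨z, q_refl _, h⟩ (F.q_symm (y i).2))

theorem prd_ab {x y} (h : Prd R0 R1 G N x y) : Ab R0 R1 x y := by
  obtain ⟨_, _, _, e, h1, h2, _⟩ := h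
  exact ⟨e, h1, h2⟩

theorem prd_min (H : Sit R0 R1 G N s) {x y w} (h : Prd R0 R1 G N x y) (hn : N w)
    (hA : Ab R0 R1 x w) : w = y ∨ Ab R0 R1 y w := by
  have F := H.F
  obtain ⟨h1, h2, h3, e, h4, h5, h6⟩ := h
  obtain ⟨w', hw, hw'⟩ := F.ab_fwd (F.ab_q (F.q_symm h4) hA (q_refl _))
  rcases F.wc hw h5 with rfl | h | h
  · exact Or.inl (H.nu h1 hn h2 hw').symm
  · exact absurd ⟨w', hw, y, h, h1⟩ h6
  · exact Or.inr (F.ab_q (q_refl _) ⟨y, q_refl _, h⟩ hw')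

theorem irr (H : Sit R0 R1 G N s) (hprd : ∀ x, N x → G x → x ≠ s → ∃ y, Prd R0 R1 G N x y)
    {x} (hn : N x) (hg : G x) : ¬ Ab R0 R1 x x := by
  intro hA
  have F := H.F
  have hxs : x ≠ s := by
    rintro rfl
    exact H.st hn hA
  obtain ⟨y, hy⟩ := hprd x hn hg hxs
  have h1 := prd_ab hy
  have h2 : Ab R0 R1 y x := by
    rcases H.prd_min hy hn hA with h | h
    · exact absurd (h ▸ q_refl _) hy.2.2.1
    · exact h
  refine H.chainT (fun i => if Even i then x else y) ?_ ?_ ?_ (Q1 R1 x) ?_ ?_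
  · intro i; split_ifs
    · exact hn
    · exact hy.1
  · intro i; split_ifs
    · exact hg
    · exact hy.2.1
  · intro i
    by_cases h : Even i
    · have h' : ¬ Even (i + 1) := by rw [Nat.even_add_one]; exact fun a => a h
      simp only [h, h', if_true, if_false]; exact h1
    · have h' : Even (i + 1) := by rw [Nat.even_add_one]; exact h
      simp only [h, h', if_true, if_false]; exact h2
  · intro i
    by_cases h : Even i
    · simp only [h, if_true, iff_true]; exact q_refl _
    · simp only [h, if_false, iff_false]; exact hy.2.2.1
  · intro u v huv hu
    exact F.q_trans hu huv

theorem wf (H : Sit R0 R1 G N s) (hirr : ∀ x, N x → G x → ¬ Ab R0 R1 x x) :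
    WellFounded (fun a b : {x // N x ∧ G x} => Ab R0 R1 b.1 a.1) := by
  have F := H.F
  rw [wellFounded_iff_isEmpty_descending_chain]
  constructor
  rintro ⟨f, hf⟩
  have hf' : ∀ i, Ab R0 R1 (f i).1 (f (i+1)).1 := fun i => hf i
  have lt : ∀ i j, i < j → Ab R0 R1 (f i).1 (f j).1 := by
    intro i j h
    induction j, h using Nat.le_induction with
    | base => exact hf' i
    | succ j _ ih => exact F.ab_trans ih (hf' j)
  refine H.chainT (fun i => (f i).1) (fun i => (f i).2.1) (fun i => (f i).2.2) hf'
    (fun u => ∃ i, Even i ∧ Q1 R1 (f i).1 u) ?_ ?_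
  · intro i
    constructor
    · rintro ⟨j, hj, h⟩
      have e := H.nu (f j).2.1 (f i).2.1 (f j).2.2 h
      rcases lt_trichotomy i j with hij | rfl | hij
      · exact absurd (e ▸ lt i j hij) (hirr _ (f j).2.1 (f j).2.2)
      · exact hj
      · exact absurd (e ▸ lt j i hij) (hirr _ (f i).2.1 (f i).2.2)
    · intro h
      exact ⟨i, h, q_refl _⟩
  · rintro u v huv ⟨i, hi, h⟩
    exact ⟨i, hi, F.q_trans h huv⟩

/-- Enumeration of the `N`-columns. -/
theorem enum (H : Sit R0 R1 G N s) (hprd : ∀ x, N x → G x → x ≠ s → ∃ y, Prd R0 R1 G N x y)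
    (hup : ∀ y, N y → G y → ∃ x, N x ∧ G x ∧ Ab R0 R1 x y) :
    ∃ ρ : ℕ → W, ρ 0 = s ∧ (∀ n, N (ρ n)) ∧ (∀ n, G (ρ n)) ∧
      (∀ n y, Prd R0 R1 G N (ρ (n+1)) y → y = ρ n) ∧ (∀ n, ρ (n+1) ≠ s) ∧
      ∀ n x, N x → G x → Ab R0 R1 x (ρ n) → ∃ m, n ≤ m ∧ ρ m = x := by
  have F := H.F
  have hirr : ∀ x, N x → G x → ¬ Ab R0 R1 x x := fun x hn hg => H.irr hprd hn hg
  have W := H.wf hirr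
  have nx : ∀ y : {x // N x ∧ G x}, ∃ x : {x // N x ∧ G x}, Ab R0 R1 x.1 y.1 ∧
      ∀ z : {x // N x ∧ G x}, Ab R0 R1 z.1 y.1 → ¬ Ab R0 R1 x.1 z.1 := by
    rintro ⟨y, hn, hg⟩
    obtain ⟨x, hx1, hx2, hx3⟩ := hup y hn hg
    have hne : {x : {x // N x ∧ G x} | Ab R0 R1 x.1 y}.Nonempty := ⟨⟨x, hx1, hx2⟩, hx3⟩
    exact ⟨W.min _ hne, W.min_mem _ hne, fun z hz hz' => W.not_lt_min _ hz hz'⟩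
  choose f hf1 hf2 using nx
  let ρ : ℕ → {x // N x ∧ G x} := fun n => f^[n] ⟨s, H.ns, H.gs⟩
  have ρs : ∀ n, ρ (n + 1) = f (ρ n) := fun n => Function.iterate_succ_apply' f n _
  have h1 : ∀ n, Ab R0 R1 (ρ (n+1)).1 (ρ n).1 := fun n => by rw [ρs]; exact hf1 _
  have h2 : ∀ n (z : {x // N x ∧ G x}), Ab R0 R1 z.1 (ρ n).1 → ¬ Ab R0 R1 (ρ (n+1)).1 z.1 :=
    fun n => by rw [ρs]; exact hf2 _
  have hpr : ∀ n y, Prd R0 R1 G N (ρ (n+1)).1 y → y = (ρ n).1 := by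
    intro n y hy
    rcases H.prd_min hy (ρ n).2.1 (h1 n) with h | h
    · exact h.symm
    · exact absurd (prd_ab hy) (h2 n ⟨y, hy.1, hy.2.1⟩ h)
  have hsur : ∀ x : {x // N x ∧ G x}, ∃ m, ρ m = x := by
    intro x
    induction x using W.induction with
    | _ x ih =>
    by_cases hx : x.1 = s
    · exact ⟨0, Subtype.ext hx.symm⟩
    · obtain ⟨y, hy⟩ := hprd x.1 x.2.1 x.2.2 hx
      obtain ⟨n, hn⟩ := ih ⟨y, hy.1, hy.2.1⟩ (prd_ab hy)
      have hn' : (ρ n).1 = y := congrArg Subtype.val hn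
      refine ⟨n + 1, Subtype.ext ?_⟩
      rcases H.tri (ρ (n+1)).2.2 x.2.2 with h | h | h
      · exact H.nu (ρ (n+1)).2.1 x.2.1 (ρ (n+1)).2.2 h
      · exact absurd h (h2 n x (hn' ▸ prd_ab hy))
      · rcases H.prd_min hy (ρ (n+1)).2.1 h with h' | h'
        · have := h1 n
          rw [h', hn'] at this
          exact absurd this (hirr _ hy.1 hy.2.1)
        · rw [← hn'] at h'
          exact absurd (F.ab_trans h' (h1 n)) (hirr _ (ρ n).2.1 (ρ n).2.2)
  have lt : ∀ i j, i < j → Ab R0 R1 (ρ j).1 (ρ i).1 := by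
    intro i j h
    induction j, h using Nat.le_induction with
    | base => exact h1 i
    | succ j _ ih => exact F.ab_trans (h1 j) ih
  refine ⟨fun n => (ρ n).1, rfl, fun n => (ρ n).2.1, fun n => (ρ n).2.2, hpr, ?_, ?_⟩
  · intro n e
    exact H.st (ρ n).2.1 (e ▸ h1 n)
  · intro n x hn hg hA
    obtain ⟨m, hm⟩ := hsur ⟨x, hn, hg⟩
    have hm' : (ρ m).1 = x := congrArg Subtype.val hm
    refine ⟨m, ?_, hm'⟩
    by_contra hlt
    rw [← hm'] at hA
    exact hirr _ (ρ m).2.1 (ρ m).2.2 (F.ab_trans hA (lt m n (by omega)))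

/-- The set of `X`-points of a column. -/
def _root_.HK.Col (R1 : W → W → Prop) (X : W → Prop) (x : W) : Set W := {w | Q1 R1 x w ∧ X w}

/-- Finite set of vertically irreflexive points. -/
def _root_.HK.FinIrr (R1 : W → W → Prop) (s : Set W) : Prop := s.Finite ∧ ∀ v ∈ s, ¬ R1 v v

theorem count (H : Sit R0 R1 G N s) (hirr : ∀ x, N x → G x → ¬ Ab R0 R1 x x) {x y : W}
    (hx : G x) (hp : Prd R0 R1 G N x y) (X : W → Prop)
    (mono : ∀ w u, G w → R0 w u → X u → X w) (xN : ∀ w, G w → X w → ∃ v, Q1 R1 w v ∧ N v)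
    (hf : FinIrr R1 (Col R1 X y)) :
    (NoNew R0 R1 X x → FinIrr R1 (Col R1 X x) ∧
      (Col R1 X x).ncard = (Col R1 X y).ncard) ∧
    (UnNew R0 R1 X x → FinIrr R1 (Col R1 X x) ∧
      (Col R1 X x).ncard = (Col R1 X y).ncard + 1) := by
  have F := H.F
  have hA := prd_ab hp
  have hyy := hirr y hp.1 hp.2.1
  -- old points
  have old : ∀ w, Q1 R1 x w → ∀ u, R0 w u → X u → ∃ v, Q1 R1 y v ∧ R0 w v ∧ X v := by
    intro w hw u hu hX
    have gw := H.gq hx hw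
    have gu := H.gr gw hu
    obtain ⟨v, huv, hv⟩ := xN u gu hX
    have hxv : Ab R0 R1 x v := F.ab_q (q_refl _) ⟨w, hw, hu⟩ huv
    rcases H.prd_min hp hv hxv with rfl | h
    · exact ⟨u, F.q_symm huv, hu, hX⟩
    · have hyu : Ab R0 R1 y u := F.ab_q (q_refl _) h (F.q_symm huv)
      obtain ⟨y', hy, hy'⟩ := F.ab_fwd (F.ab_q (F.q_symm hw) hA (q_refl _))
      rcases F.wc hy hu with rfl | h' | h'
      · exact absurd (F.ab_q (q_refl _) hyu hy') hyy
      · exact ⟨y', F.q_symm hy', hy, mono _ _ (H.gr gw hy) h' hX⟩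
      · exact absurd (F.ab_trans hyu (F.ab_q (q_refl _) ⟨u, q_refl _, h'⟩ hy')) hyy
  have func : ∀ w v v', Q1 R1 y v → Q1 R1 y v' → R0 w v → R0 w v' → v = v' := by
    intro w v v' hv hv' h h'
    rcases F.wc h h' with e | a | a
    · exact e
    · exact absurd (F.ab_q hv ⟨v, q_refl _, a⟩ (F.q_symm hv')) hyy
    · exact absurd (F.ab_q hv' ⟨v', q_refl _, a⟩ (F.q_symm hv)) hyy
  -- vertical pairs above a vertically irreflexive point
  have inj : ∀ w w' v, v ∈ Col R1 X y → R0 w v → R0 w' v → ¬ R1 w w' := by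
    intro w w' v hv h h' hw
    obtain ⟨u, hu, huv⟩ := F.c2 hw h'
    have : u = v := func w u v (F.q_trans hv.1 (F.q_symm (Or.inr huv))) hv.1 hu h
    subst this
    exact hf.2 u hv huv
  let O : Set W := {w | Q1 R1 x w ∧ ∃ v, v ∈ Col R1 X y ∧ R0 w v}
  have hO : ∀ w : W, ∃ v, w ∈ O → (v ∈ Col R1 X y ∧ R0 w v) := by
    intro w
    by_cases h : w ∈ O
    · obtain ⟨v, hv⟩ := h.2
      exact ⟨v, fun _ => hv⟩
    · exact ⟨w, fun h' => absurd h' h⟩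
  choose π hπ using hO
  have injO : Set.InjOn π O := by
    intro a ha b hb e
    have h1 := hπ a ha
    have h2 := hπ b hb
    rw [← e] at h2
    rcases F.q_trans (F.q_symm ha.1) hb.1 with h | h
    · exact h
    · exact absurd h (inj a b _ h1.1 h1.2 h2.2)
  have imO : π '' O = Col R1 X y := by
    ext v
    constructor
    · rintro ⟨w, hw, rfl⟩
      exact (hπ w hw).1
    · intro hv
      obtain ⟨e, he, he'⟩ := F.ab_q (q_refl _) hA hv.1
      have heO : e ∈ O := ⟨he, v, hv, he'⟩
      exact ⟨e, heO, func e _ _ (hπ e heO).1.1 hv.1 (hπ e heO).2 he'⟩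
  have finO : O.Finite := Set.Finite.of_finite_image (imO ▸ hf.1) injO
  have cardO : O.ncard = (Col R1 X y).ncard := by rw [← imO, injO.ncard_image]
  have irrO : ∀ w ∈ O, ¬ R1 w w := by
    rintro w ⟨_, v, hv, h⟩
    exact inj w w v hv h h
  have subO : O ⊆ Col R1 X x := by
    rintro w ⟨hw, v, hv, h⟩
    exact ⟨hw, mono w v (H.gq hx hw) h hv.2⟩
  have newO : ∀ w ∈ Col R1 X x, w ∉ O → New R0 X w := by
    rintro w ⟨hw, hX⟩ hn
    refine ⟨hX, ?_⟩
    rintro ⟨u, hu, hXu⟩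
    obtain ⟨v, h1, h2, h3⟩ := old w hw u hu hXu
    exact hn ⟨hw, v, ⟨h1, h3⟩, h2⟩
  constructor
  · intro hno
    have : Col R1 X x = O := by
      refine Set.Subset.antisymm ?_ subO
      intro w hw
      by_contra h
      exact hno w hw.1 (newO w hw h)
    rw [this]
    exact ⟨⟨finO, irrO⟩, cardO⟩
  · rintro ⟨v, hv, hnew, hun⟩
    have hvO : v ∉ O := by
      rintro ⟨_, u, hu, h⟩
      exact hnew.2 ⟨u, h, hu.2⟩
    have : Col R1 X x = insert v O := by
      refine Set.Subset.antisymm ?_ (Set.insert_subset ⟨hv, hnew.1⟩ subO)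
      intro w hw
      by_cases h : w ∈ O
      · exact Or.inr h
      · left
        rcases F.q_trans (F.q_symm hv) hw.1 with e | e
        · exact e.symm
        · exact absurd (newO w hw h) (hun w e)
    rw [this]
    refine ⟨⟨finO.insert v, ?_⟩, ?_⟩
    · rintro w (rfl | hw)
      · intro h
        exact hun w h hnew
      · exact irrO w hw
    · rw [Set.ncard_insert_of_notMem hvO finO, cardO]
end Sit
end
end

section
open Function

section
variable {W : Type} {R0 R1 : W → W → Prop}

theorem sound (F : FF R0 R1) {N K : W → Prop} {S I D : ℕ → W → Prop} {p : CMDesc × ℕ × ℕ} {r : W}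
    (H : GoodS R0 R1 N K S I D p r) (hwf : CMWF p.1) : CMRecur p := by
  obtain ⟨v, hrv, s, hvs, hNs, hst⟩ := H.root1
  let G : W → Prop := Gn R0 R1 r
  have loc : ∀ w, G w → LocS R0 R1 N K S I D p w := by
    rintro w ⟨v, hv, hw⟩
    exact H.loc v hv w hw
  have Z : Sit R0 R1 G N s := by
    refine ⟨F, F.g_q, F.g_r, F.tri, ?_, hNs, ⟨v, hrv, hvs⟩, ?_⟩
    · intro x y hx hy hg h
      rcases h with h | h
      · exact h
      · exact absurd ⟨y, h, hy⟩ ((loc x hg).n1 hx)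
    · rintro y hy ⟨e, he, h⟩
      exact hst e he ⟨y, h, hy⟩
  have kq : ∀ w u, G w → Q1 R1 w u → K w → K u := by
    rintro w u hg (rfl | h) hk
    · exact hk
    · exact (loc w hg).k1 hk u h
  have step : ∀ x, N x → G x → x ≠ s → ∃ t ∈ p.1.2.2.2, S t.2.2 x ∧
      (∃ y, Prd R0 R1 G N x y ∧ S t.1 y) ∧ ∀ j < p.1.1, CtrS R0 R1 I D x t.2.1 j := by
    intro x hx hg hne
    rcases (loc x hg).step hx with h | ⟨t, ht, h1, ⟨e, he, hdd, h2⟩, h3⟩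
    · obtain ⟨e, he, h'⟩ := Z.abs hx hg hne
      exact absurd ⟨s, h', hNs⟩ (h e he)
    · refine ⟨t, ht, h1, ?_, h3⟩
      have ge := Z.gq hg he
      rcases h2 with ⟨hk, y, hy, hn, hs, hk'⟩ | ⟨hk, y, hy, hn, hs, hk'⟩
      · refine ⟨y, ⟨hn, Z.gr ge hy, ?_, e, he, hy, hdd⟩, hs⟩
        intro hq
        exact hk' (kq e y ge (F.q_trans (F.q_symm he) hq) hk)
      · refine ⟨y, ⟨hn, Z.gr ge hy, ?_, e, he, hy, hdd⟩, hs⟩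
        intro hq
        exact hk (kq y e (Z.gr ge hy) (F.q_trans (F.q_symm hq) he) hk')
  have hprd : ∀ x, N x → G x → x ≠ s → ∃ y, Prd R0 R1 G N x y := by
    intro x hx hg hne
    obtain ⟨t, _, _, ⟨y, hy, _⟩, _⟩ := step x hx hg hne
    exact ⟨y, hy⟩
  have hup : ∀ y, N y → G y → ∃ x, N x ∧ G x ∧ Ab R0 R1 x y ∧ S p.2.2 x := by
    rintro y hy hg
    obtain ⟨v, hv, hvy⟩ := id hg
    obtain ⟨w, hw, hwy⟩ := F.q1 hv hvy
    obtain ⟨v', hv', ⟨x, hx, hNx, hSx⟩, y', hvy', hNy'⟩ := H.root2 w hw ⟨y, hwy, hy⟩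
    have gg : ∀ u, R0 w u → G u := by
      intro u hu
      obtain ⟨u', h, h'⟩ := F.q2 hw hu
      exact ⟨u', h, h'⟩
    refine ⟨x, hNx, Z.gq (gg _ hv') hx, ?_, hSx⟩
    have hwy' := F.tr hv' hvy'
    have : y = y' := by
      rcases F.wc hwy hwy' with e | h | h
      · exact e
      · exact absurd ⟨y', h, hNy'⟩ ((loc y hg).n0 hy)
      · exact absurd ⟨y, h, hy⟩ ((loc y' (gg _ hwy')).n0 hNy')
    subst this
    exact ⟨v', F.q_symm hx, hvy'⟩
  obtain ⟨ρ, ρ0, ρN, ρG, ρp, ρne, ρc⟩ := Z.enum hprd fun y h1 h2 => by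
    obtain ⟨x, a, b, c, _⟩ := hup y h1 h2
    exact ⟨x, a, b, c⟩
  have hirr : ∀ x, N x → G x → ¬ Ab R0 R1 x x := fun x hn hg => Z.irr hprd hn hg
  have hstep : ∀ n, ∃ t ∈ p.1.2.2.2, S t.2.2 (ρ (n+1)) ∧ S t.1 (ρ n) ∧
      Prd R0 R1 G N (ρ (n+1)) (ρ n) ∧ ∀ j < p.1.1, CtrS R0 R1 I D (ρ (n+1)) t.2.1 j := by
    intro n
    obtain ⟨t, ht, h1, ⟨y, hy, hs⟩, h2⟩ := step _ (ρN (n+1)) (ρG (n+1)) (ρne n)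
    have := ρp n y hy
    subst this
    exact ⟨t, ht, h1, hs, hy, h2⟩
  choose t ht hS1 hS2 hP hC using hstep
  have hstart := (loc (ρ 0) (ρG 0)).start (ρN 0) (ρ0 ▸ hst)
  -- states
  let st : ℕ → ℕ := fun n => Nat.casesOn n p.2.1 (fun m => (t m).2.2)
  have stS : ∀ n, S (st n) (ρ n) := by
    rintro (_ | n)
    · exact hstart.1
    · exact hS1 n
  have stb : ∀ n, st n < p.1.2.1 + p.2.1 + p.2.2 + 1 := by
    rintro (_ | n)
    · show p.2.1 < _
      omega
    · show (t n).2.2 < _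
      have := (hwf.2.2.1 _ (ht n)).2.2.1
      omega
  have stu : ∀ n q, q < p.1.2.1 + p.2.1 + p.2.2 + 1 → S q (ρ n) → st n = q := by
    intro n q hq hS
    by_contra hne
    exact (loc _ (ρG n)).ex _ (stb n) _ hq hne ⟨stS n, hS⟩
  -- counters
  have monoI : ∀ j < p.1.1, ∀ w u, G w → R0 w u → I j u → I j w :=
    fun j hj w u hg h hX => (loc w hg).iI j hj u h hX
  have monoD : ∀ j < p.1.1, ∀ w u, G w → R0 w u → D j u → D j w :=
    fun j hj w u hg h hX => (loc w hg).dD j hj u h hX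
  have nI : ∀ j < p.1.1, ∀ w, G w → I j w → ∃ v, Q1 R1 w v ∧ N v :=
    fun j hj w hg hX => (loc w hg).iN j hj hX
  have nD : ∀ j < p.1.1, ∀ w, G w → D j w → ∃ v, Q1 R1 w v ∧ N v :=
    fun j hj w hg hX => nI j hj w hg ((loc w hg).dI j hj hX)
  have sub : ∀ j < p.1.1, ∀ n, Col R1 (D j) (ρ n) ⊆ Col R1 (I j) (ρ n) := by
    rintro j hj n w ⟨h1, h2⟩
    exact ⟨h1, (loc w (Z.gq (ρG n) h1)).dI j hj h2⟩
  have e0 : ∀ j < p.1.1, Col R1 (I j) (ρ 0) = ∅ := by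
    intro j hj
    ext w
    simp only [Set.mem_empty_iff_false, iff_false]
    rintro ⟨h1, h2⟩
    exact hstart.2 j hj w h1 h2
  have e0' : ∀ j < p.1.1, Col R1 (D j) (ρ 0) = ∅ := by
    intro j hj
    have := sub j hj 0
    rw [e0 j hj] at this
    exact Set.subset_empty_iff.1 this
  have fi0 : FinIrr R1 (∅ : Set W) := ⟨Set.finite_empty, fun v hv => absurd hv (by simp)⟩
  have cI := fun j (hj : j < p.1.1) n => Z.count hirr (ρG (n+1)) (hP n) (I j) (monoI j hj) (nI j hj)
  have cD := fun j (hj : j < p.1.1) n => Z.count hirr (ρG (n+1)) (hP n) (D j) (monoD j hj) (nD j hj)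
  have fI : ∀ j < p.1.1, ∀ n, FinIrr R1 (Col R1 (I j) (ρ n)) := by
    intro j hj n
    induction n with
    | zero => rw [e0 j hj]; exact fi0
    | succ n ih =>
      by_cases h : (t n).2.1 = Sum.inl j
      · exact ((cI j hj n ih).2 ((hC n j hj).inc h)).1
      · exact ((cI j hj n ih).1 ((hC n j hj).ninc h)).1
  have fD : ∀ j < p.1.1, ∀ n, FinIrr R1 (Col R1 (D j) (ρ n)) := by
    intro j hj n
    induction n with
    | zero => rw [e0' j hj]; exact fi0
    | succ n ih =>
      by_cases h : (t n).2.1 = Sum.inr (Sum.inl j)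
      · exact ((cD j hj n ih).2 ((hC n j hj).dec h)).1
      · exact ((cD j hj n ih).1 ((hC n j hj).ndec h)).1
  let a : ℕ → ℕ → ℕ := fun n j => (Col R1 (I j) (ρ n)).ncard
  let b : ℕ → ℕ → ℕ := fun n j => (Col R1 (D j) (ρ n)).ncard
  have ba : ∀ j < p.1.1, ∀ n, b n j ≤ a n j := fun j hj n =>
    Set.ncard_le_ncard (sub j hj n) (fI j hj n).1
  have a1 : ∀ j < p.1.1, ∀ n, (t n).2.1 = Sum.inl j → a (n+1) j = a n j + 1 :=
    fun j hj n h => ((cI j hj n (fI j hj n)).2 ((hC n j hj).inc h)).2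
  have a2 : ∀ j < p.1.1, ∀ n, (t n).2.1 ≠ Sum.inl j → a (n+1) j = a n j :=
    fun j hj n h => ((cI j hj n (fI j hj n)).1 ((hC n j hj).ninc h)).2
  have b1 : ∀ j < p.1.1, ∀ n, (t n).2.1 = Sum.inr (Sum.inl j) → b (n+1) j = b n j + 1 :=
    fun j hj n h => ((cD j hj n (fD j hj n)).2 ((hC n j hj).dec h)).2
  have b2 : ∀ j < p.1.1, ∀ n, (t n).2.1 ≠ Sum.inr (Sum.inl j) → b (n+1) j = b n j :=
    fun j hj n h => ((cD j hj n (fD j hj n)).1 ((hC n j hj).ndec h)).2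
  have z1 : ∀ j < p.1.1, ∀ n, (t n).2.1 = Sum.inr (Sum.inr j) → a (n+1) j = b (n+1) j := by
    intro j hj n h
    refine le_antisymm ?_ (ba j hj (n+1))
    refine Set.ncard_le_ncard ?_ (fD j hj (n+1)).1
    rintro w ⟨h1, h2⟩
    exact ⟨h1, (hC n j hj).zero h w h1 h2⟩
  let c : ℕ → ℕ → ℕ := fun n j => if j < p.1.1 then a n j - b n j else 0
  have cn : ∀ n j, ¬ j < p.1.1 → c n j = 0 := fun n j h => if_neg h
  have cp : ∀ n j, j < p.1.1 → c n j = a n j - b n j := fun n j h => if_pos h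
  have csame : ∀ n j, (t n).2.1 ≠ Sum.inl j → (t n).2.1 ≠ Sum.inr (Sum.inl j) →
      c (n+1) j = c n j := by
    intro n j h h'
    by_cases hj : j < p.1.1
    · rw [cp _ _ hj, cp _ _ hj, a2 j hj n h, b2 j hj n h']
    · rw [cn _ _ hj, cn _ _ hj]
  refine ⟨hwf, fun n => (st n, c n), ?_, ?_, ?_⟩
  · refine Prod.ext rfl (funext fun j => ?_)
    show c 0 j = 0
    by_cases hj : j < p.1.1
    · rw [cp _ _ hj]
      show (Col R1 (I j) (ρ 0)).ncard - _ = 0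
      rw [e0 j hj]; simp
    · exact cn _ _ hj
  · intro n
    rw [cmStep_iff]
    have hq : st n = (t n).1 := stu n _ (by
      have := (hwf.2.2.1 _ (ht n)).1
      omega) (hS2 n)
    refine ⟨(t n).2.1, ?_, ?_⟩
    · show (st n, (t n).2.1, (t n).2.2) ∈ _
      rw [hq]; exact ht n
    · show OpRel (t n).2.1 (c n) (c (n+1))
      have hcnt := (hwf.2.2.1 _ (ht n)).2.2.2
      have cs := csame n
      rcases hop : (t n).2.1 with i | i | i
      · rw [hop] at hcnt cs
        have hi : i < p.1.1 := hcnt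
        refine ⟨?_, fun j hj => cs j (fun e => hj (Sum.inl_injective e).symm) (by simp)⟩
        have := a1 i hi n hop
        have := b2 i hi n (by rw [hop]; simp)
        have := ba i hi n
        rw [cp _ _ hi, cp _ _ hi]; omega
      · rw [hop] at hcnt cs
        have hi : i < p.1.1 := hcnt
        have := b1 i hi n hop
        have := a2 i hi n (by rw [hop]; simp)
        have := ba i hi (n+1)
        have := cp n i hi
        have := cp (n+1) i hi
        exact ⟨by omega, by omega, fun j hj => cs j (by simp) (fun e => hj (by simpa using e.symm))⟩
      · rw [hop] at hcnt cs
        have hi : i < p.1.1 := hcnt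
        have h1 := z1 i hi n hop
        have h2 := cs i (by simp) (by simp)
        have := cp (n+1) i hi
        exact ⟨by omega, fun j => cs j (by simp) (by simp)⟩
  · intro n
    obtain ⟨x, hx1, hx2, hx3, hx4⟩ := hup _ (ρN n) (ρG n)
    obtain ⟨m, hm, rfl⟩ := ρc n x hx1 hx2 hx3
    exact ⟨m, hm, stu m _ (by omega) hx4⟩
end
end

section
open Function

/-! ### Completeness: the model described by a run -/

theorem exists_count {P : ℕ → Prop} [DecidablePred P] {k t : ℕ} (h : k < Nat.count P t) :
    ∃ m < t, P m ∧ Nat.count P m = k := by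
  induction t with
  | zero => simp at h
  | succ t ih =>
    by_cases hk : k < Nat.count P t
    · obtain ⟨m, a, b, c⟩ := ih hk
      exact ⟨m, by omega, b, c⟩
    · by_cases hP : P t
      · rw [Nat.count_succ, if_pos hP] at h
        exact ⟨t, by omega, hP, by omega⟩
      · rw [Nat.count_succ, if_neg hP] at h
        omega

/-- Assemble a valuation. -/
def valOf {W : Type} (N K : W → Prop) (S I D : ℕ → W → Prop) (k : ℕ) : W → Prop :=
  if k = 0 then N else if k = 1 then K else if (k - 2) % 3 = 0 then S ((k - 2) / 3)
  else if (k - 2) % 3 = 1 then I ((k - 2) / 3) else D ((k - 2) / 3)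

theorem valOf_good {W : Type} {R0 R1 : W → W → Prop} {N K : W → Prop} {S I D : ℕ → W → Prop}
    {p : CMDesc × ℕ × ℕ} {r : W} (h : GoodS R0 R1 N K S I D p r) :
    BSat R0 R1 (valOf N K S I D) r (phiF p) := by
  rw [sat_phi]
  have h1 : valOf N K S I D 0 = N := by simp [valOf]
  have h2 : valOf N K S I D 1 = K := by simp [valOf]
  have h3 : (fun j => valOf N K S I D (3 * j + 2)) = S := by
    funext j
    have : (3 * j + 2 - 2) % 3 = 0 := by omega
    have e : (3 * j + 2 - 2) / 3 = j := by omega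
    rw [valOf, if_neg (by omega), if_neg (by omega), if_pos this, e]
  have h4 : (fun j => valOf N K S I D (3 * j + 3)) = I := by
    funext j
    have : (3 * j + 3 - 2) % 3 = 1 := by omega
    have e : (3 * j + 3 - 2) / 3 = j := by omega
    rw [valOf, if_neg (by omega), if_neg (by omega), if_neg (by omega), if_pos this, e]
  have h5 : (fun j => valOf N K S I D (3 * j + 4)) = D := by
    funext j
    have e : (3 * j + 4 - 2) / 3 = j := by omega
    rw [valOf, if_neg (by omega), if_neg (by omega), if_neg (by omega), if_neg (by omega), e]
  rw [h1, h2, h3, h4, h5]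
  exact h

section
variable {A : Type} [LinearOrder A]

theorem pq1 {a a' : A} {e e' : ℕ} :
    Q1 (prodR1 (A := A) (fun m n : ℕ => m ≠ n)) (a, e) (a', e') ↔ a = a' := by
  constructor
  · rintro (h | h)
    · exact congrArg Prod.fst h
    · exact h.1
  · rintro rfl
    by_cases h : e = e'
    · exact Or.inl (by rw [h])
    · exact Or.inr ⟨rfl, h⟩

theorem pr0 {a a' : A} {e e' : ℕ} :
    prodR0 (B := ℕ) (fun a b : A => b < a) (a, e) (a', e') ↔ a' < a ∧ e = e' := Iff.rfl
theorem pr1 {a a' : A} {e e' : ℕ} :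
    prodR1 (A := A) (fun m n : ℕ => m ≠ n) (a, e) (a', e') ↔ a = a' ∧ e ≠ e' := Iff.rfl

open Classical in
theorem complete {p : CMDesc × ℕ × ℕ} (hrec : CMRecur p) (r : A) (ι : ℕ → A)
    (hι : StrictMono ι) (hr : ∀ n, ι n < r) (hA : ∀ a, a < r → (∃ n, a = ι n) ∨ a < ι 0) :
    ∃ N K S I D, GoodS (prodR0 (B := ℕ) (fun a b : A => b < a))
      (prodR1 (A := A) (fun m n : ℕ => m ≠ n)) N K S I D p (r, 0) := by
  obtain ⟨hwf, ρ, hρ0, hρ, hvis⟩ := hrec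
  have hρ' := fun n => (cmStep_iff p.1 (ρ n) (ρ (n+1))).1 (hρ n)
  choose op hop hrel using hρ'
  let nI : ℕ → ℕ → ℕ := fun i t => Nat.count (fun m => op m = Sum.inl i) t
  let nD : ℕ → ℕ → ℕ := fun i t => Nat.count (fun m => op m = Sum.inr (Sum.inl i)) t
  have nIm : ∀ i, Monotone (nI i) := fun i => Nat.count_monotone _
  have nDm : ∀ i, Monotone (nD i) := fun i => Nat.count_monotone _
  have nI1 : ∀ i n, op n = Sum.inl i → nI i (n+1) = nI i n + 1 := fun i n h => by
    show Nat.count _ _ = _; rw [Nat.count_succ, if_pos h]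
  have nI2 : ∀ i n, op n ≠ Sum.inl i → nI i (n+1) = nI i n := fun i n h => by
    show Nat.count _ _ = _; rw [Nat.count_succ, if_neg h]; rfl
  have nD1 : ∀ i n, op n = Sum.inr (Sum.inl i) → nD i (n+1) = nD i n + 1 := fun i n h => by
    show Nat.count _ _ = _; rw [Nat.count_succ, if_pos h]
  have nD2 : ∀ i n, op n ≠ Sum.inr (Sum.inl i) → nD i (n+1) = nD i n := fun i n h => by
    show Nat.count _ _ = _; rw [Nat.count_succ, if_neg h]; rfl
  have cnt : ∀ i n, (ρ n).2 i + nD i n = nI i n := by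
    intro i n
    induction n with
    | zero =>
      rw [hρ0]
      simp [zeroConfig, nD, nI]
    | succ n ih =>
      have hR := hrel n
      rcases h : op n with k | k | k
      · rw [h] at hR
        have hd := nD2 i n (by rw [h]; simp)
        by_cases hk : i = k
        · subst hk
          have := hR.1
          have := nI1 i n h
          omega
        · have := hR.2 i hk
          have := nI2 i n (by rw [h]; simpa using fun e => hk e.symm)
          omega
      · rw [h] at hR
        have hd := nI2 i n (by rw [h]; simp)
        by_cases hk : i = k
        · subst hk
          have := hR.1
          have := hR.2.1
          have := nD1 i n h
          omega
        · have := hR.2.2 i hk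
          have := nD2 i n (by rw [h]; simpa using fun e => hk e.symm)
          omega
      · rw [h] at hR
        have := nD2 i n (by rw [h]; simp)
        have := nI2 i n (by rw [h]; simp)
        have := hR.2 i
        omega
  have le : ∀ i n, nD i n ≤ nI i n := fun i n => by have := cnt i n; omega
  have ιlt : ∀ {m n}, ι m < ι n ↔ m < n := hι.lt_iff_lt
  have ιinj : ∀ {m n}, ι m = ι n ↔ m = n := hι.injective.eq_iff
  have up : ∀ a t, a < r → ι t < a → ∃ t', a = ι t' ∧ t < t' := by
    intro a t ha h
    rcases hA a ha with ⟨n, rfl⟩ | h'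
    · exact ⟨n, rfl, ιlt.1 h⟩
    · exact absurd (ιlt.1 (h.trans h')) (by omega)
  let Inc : ℕ → ℕ → Prop := fun i e => ∃ m, e = m + 1 ∧ op m = Sum.inl i
  let N : A × ℕ → Prop := fun w => w.1 = ι w.2
  let K : A × ℕ → Prop := fun w => ∃ t, Even t ∧ w.1 = ι t
  let S : ℕ → A × ℕ → Prop := fun q w => ∃ t, w.1 = ι t ∧ (ρ t).1 = q
  let I : ℕ → A × ℕ → Prop := fun i w => ∃ t, w.1 = ι t ∧ w.2 ≤ t ∧ Inc i w.2
  let D : ℕ → A × ℕ → Prop := fun i w => ∃ t, w.1 = ι t ∧ w.2 ≤ t ∧ Inc i w.2 ∧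
    nI i w.2 ≤ nD i t
  have hN : ∀ a e, N (a, e) ↔ a = ι e := fun _ _ => Iff.rfl
  have hK : ∀ t e, K (ι t, e) ↔ Even t := by
    intro t e
    constructor
    · rintro ⟨t', h, h'⟩
      rw [ιinj.1 h']; exact h
    · exact fun h => ⟨t, h, rfl⟩
  have hS : ∀ t e q, S q (ι t, e) ↔ (ρ t).1 = q := by
    intro t e q
    constructor
    · rintro ⟨t', h, h'⟩
      rw [ιinj.1 h]; exact h'
    · exact fun h => ⟨t, rfl, h⟩
  have hI : ∀ t e i, I i (ι t, e) ↔ e ≤ t ∧ Inc i e := by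
    intro t e q
    constructor
    · rintro ⟨t', h, h'⟩
      rw [ιinj.1 h]; exact h'
    · exact fun h => ⟨t, rfl, h⟩
  have hD : ∀ t e i, D i (ι t, e) ↔ e ≤ t ∧ Inc i e ∧ nI i e ≤ nD i t := by
    intro t e q
    constructor
    · rintro ⟨t', h, h'⟩
      rw [ιinj.1 h]; exact h'
    · exact fun h => ⟨t, rfl, h⟩
  have start0 : ∀ e, IsStart (prodR0 (B := ℕ) (fun a b : A => b < a))
      (prodR1 (A := A) (fun m n : ℕ => m ≠ n)) N (ι 0, e) := by
    rintro e ⟨a, f⟩ hu ⟨⟨b, g⟩, hy, hn⟩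
    rw [pq1] at hu
    subst hu
    rw [pr0] at hy
    rw [hN] at hn
    rw [hn] at hy
    exact absurd (ιlt.1 hy.1) (by omega)
  refine ⟨N, K, S, I, D, ?_, ?_, ?_⟩
  · exact ⟨(ι 0, 0), ⟨hr 0, rfl⟩, (ι 0, 0), q_refl _, rfl, start0 0⟩
  · rintro ⟨a, e⟩ hw ⟨⟨b, f⟩, hy, hn⟩
    rw [pq1] at hw
    subst hw
    rw [pr0] at hy
    obtain ⟨hb, rfl⟩ := hy
    rw [hN] at hn
    subst hn
    obtain ⟨m, hm, hq⟩ := hvis (e + 1)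
    refine ⟨(ι m, e), ⟨hr m, rfl⟩, ⟨(ι m, m), pq1.2 rfl, rfl, (hS _ _ _).2 hq⟩, (ι e, e),
      ⟨ιlt.2 (by omega), rfl⟩, rfl⟩
  · rintro ⟨a', e'⟩ hv ⟨a, e⟩ hw
    rw [pq1] at hw
    subst hw
    have ha : a' < r := hv.1
    clear hv
    constructor
    · rintro hn ⟨⟨b, f⟩, h, hn'⟩
      rw [hN] at hn hn'
      rw [pr1] at h
      exact h.2 (ιinj.1 (by rw [← hn, ← hn', h.1]))
    · rintro hn ⟨⟨b, f⟩, h, hn'⟩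
      rw [hN] at hn hn'
      rw [pr0] at h
      rw [hn, hn', h.2] at h
      exact lt_irrefl _ h.1
    · rintro hk ⟨b, f⟩ h
      obtain ⟨rfl, _⟩ := pr1.1 h
      exact hk
    · rintro q _ q' _ hne ⟨⟨t, h1, h2⟩, t', h3, h4⟩
      have : t = t' := ιinj.1 (h1.symm.trans h3)
      subst this
      exact hne (h2.symm.trans h4)
    · rintro j _ ⟨b, f⟩ h ⟨t, h1, h2, h3⟩
      obtain ⟨hb, rfl⟩ := pr0.1 h
      have h1 : b = ι t := h1
      subst h1
      obtain ⟨t', rfl, ht⟩ := up a' t ha hb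
      exact (hI _ _ _).2 ⟨le_trans h2 ht.le, h3⟩
    · rintro j _ ⟨b, f⟩ h ⟨t, h1, h2, h3, h4⟩
      obtain ⟨hb, rfl⟩ := pr0.1 h
      have h1 : b = ι t := h1
      subst h1
      obtain ⟨t', rfl, ht⟩ := up a' t ha hb
      exact (hD _ _ _).2 ⟨le_trans h2 ht.le, h3, h4.trans (nDm j ht.le)⟩
    · rintro j _ ⟨t, h1, h2, h3, h4⟩
      exact ⟨t, h1, h2, h3⟩
    · rintro j _ ⟨t, h1, h2, h3⟩
      have h1 : a' = ι t := h1
      subst h1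
      exact ⟨(ι t, t), pq1.2 rfl, rfl⟩
    · intro hn hst
      rw [hN] at hn
      subst hn
      have he : e = 0 := by
        by_contra h0
        exact hst (ι e, 0) (pq1.2 rfl) ⟨(ι 0, 0), ⟨ιlt.2 (by omega), rfl⟩, rfl⟩
      subst he
      refine ⟨(hS _ _ _).2 (by rw [hρ0]; rfl), ?_⟩
      rintro j _ ⟨b, f⟩ hv hIv
      rw [pq1] at hv
      subst hv
      rw [hI] at hIv
      obtain ⟨h1, m, h2, _⟩ := hIv
      omega
    · intro hn
      rw [hN] at hn
      subst hn
      rcases e with _ | n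
      · exact Or.inl (start0 _)
      · right
        refine ⟨((ρ n).1, op n, (ρ (n+1)).1), hop n, (hS _ _ _).2 rfl,
          ⟨(ι (n+1), n), pq1.2 rfl, ?_, ?_⟩, ?_⟩
        · rintro ⟨⟨b, f⟩, h, ⟨c, g⟩, h', hn⟩
          obtain ⟨hb, rfl⟩ := pr0.1 h
          obtain ⟨hc, rfl⟩ := pr0.1 h'
          rw [hN] at hn
          subst hn
          obtain ⟨t, rfl, ht⟩ := up b n (hb.trans (hr _)) hc
          have := ιlt.1 hb
          omega
        · rw [hK]
          have hR : prodR0 (B := ℕ) (fun a b : A => b < a) (ι (n+1), n) (ι n, n) :=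
            ⟨ιlt.2 (by omega), rfl⟩
          by_cases hev : Even (n + 1)
          · exact Or.inl ⟨hev, (ι n, n), hR, rfl, (hS _ _ _).2 rfl,
              by rw [hK]; exact Nat.even_add_one.1 hev⟩
          · exact Or.inr ⟨hev, (ι n, n), hR, rfl, (hS _ _ _).2 rfl,
              by rw [hK]; rw [Nat.even_add_one] at hev; exact not_not.1 hev⟩
        · intro j hj
          show CtrS _ _ I D _ (op n) j
          have hR : ∀ f, prodR0 (B := ℕ) (fun a b : A => b < a) (ι (n+1), f) (ι n, f) :=
            fun f => ⟨ιlt.2 (by omega), rfl⟩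
          have incS : ∀ m, Inc j (m+1) → op m = Sum.inl j := by
            rintro m ⟨m', h, h'⟩
            have : m = m' := by omega
            rw [this]; exact h'
          have oldI : ∀ f, f ≤ n → ¬ New (prodR0 (B := ℕ) (fun a b : A => b < a)) (I j)
              (ι (n+1), f) := by
            rintro f hf ⟨h1, h2⟩
            rw [hI] at h1
            exact h2 ⟨(ι n, f), hR f, (hI _ _ _).2 ⟨hf, h1.2⟩⟩
          have oldD : ∀ f, f ≤ n → nI j f ≤ nD j n →
              ¬ New (prodR0 (B := ℕ) (fun a b : A => b < a)) (D j) (ι (n+1), f) := by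
            rintro f hf hle ⟨h1, h2⟩
            rw [hD] at h1
            exact h2 ⟨(ι n, f), hR f, (hD _ _ _).2 ⟨hf, h1.2.1, hle⟩⟩
          constructor
          · intro h
            refine ⟨(ι (n+1), n+1), pq1.2 rfl, ⟨(hI _ _ _).2 ⟨le_rfl, n, rfl, h⟩, ?_⟩, ?_⟩
            · rintro ⟨⟨b, f⟩, hb, t, h1, h2, _⟩
              obtain ⟨hb2, rfl⟩ := pr0.1 hb
              have h1 : b = ι t := h1
              subst h1
              have := ιlt.1 hb2
              have h2 : n + 1 ≤ t := h2
              omega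
            · rintro ⟨b, f⟩ hb hnew
              obtain ⟨rfl, hf⟩ := pr1.1 hb
              have h1 := ((hI _ _ _).1 hnew.1).1
              exact oldI f (by omega) hnew
          · rintro h ⟨b, f⟩ hb hnew
            rw [pq1] at hb
            subst hb
            have h1 := (hI _ _ _).1 hnew.1
            by_cases hf : f ≤ n
            · exact oldI f hf hnew
            · have : f = n + 1 := by omega
              subst this
              exact h (incS _ h1.2)
          · intro h
            have e1 := nD1 j n h
            have e2 := nI2 j n (by rw [h]; simp)
            have e3 := le j (n+1)
            obtain ⟨m, hm1, hm2, hm3⟩ := exists_count (P := fun m => op m = Sum.inl j)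
              (k := nD j n) (t := n) (show nD j n < nI j n by omega)
            have e4 : nI j (m+1) = nD j n + 1 := by
              rw [nI1 j m hm2, show nI j m = nD j n from hm3]
            refine ⟨(ι (n+1), m+1), pq1.2 rfl, ⟨(hD _ _ _).2 ⟨by omega, ⟨m, rfl, hm2⟩,
              by omega⟩, ?_⟩, ?_⟩
            · rintro ⟨⟨b, f⟩, hb, t, h1, h2, h3, h4⟩
              obtain ⟨hb2, rfl⟩ := pr0.1 hb
              have h1 : b = ι t := h1
              subst h1
              have ht := ιlt.1 hb2
              have h4 : nI j (m+1) ≤ nD j t := h4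
              have := nDm j (show t ≤ n by omega)
              omega
            · rintro ⟨b, f⟩ hb hnew
              obtain ⟨rfl, hf⟩ := pr1.1 hb
              obtain ⟨h1, ⟨m', rfl, h2⟩, h3⟩ := (hD _ _ _).1 hnew.1
              have hne : m' ≠ n := by
                rintro rfl
                rw [h] at h2
                simp at h2
              have h5 : ¬ nI j (m'+1) ≤ nD j n := fun h5 => oldD _ (by omega) h5 hnew
              have h6 := nI1 j m' h2
              have h7 : nI j m' = nI j m := by
                rw [show nI j m = nD j n from hm3]; omega
              exact hf (by rw [Nat.count_injective h2 hm2 h7])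
          · rintro h ⟨b, f⟩ hb hnew
            rw [pq1] at hb
            subst hb
            obtain ⟨h1, h2, h3⟩ := (hD _ _ _).1 hnew.1
            rw [nD2 j n h] at h3
            by_cases hf : f ≤ n
            · exact oldD f hf h3 hnew
            · have : f = n + 1 := by omega
              subst this
              have := nI1 j n (incS _ h2)
              have := le j n
              omega
          · rintro h ⟨b, f⟩ hb hIv
            rw [pq1] at hb
            subst hb
            obtain ⟨h1, h2⟩ := (hI _ _ _).1 hIv
            refine (hD _ _ _).2 ⟨h1, h2, ?_⟩
            have hRn := hrel n
            rw [h] at hRn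
            have a1 := hRn.1
            have a2 := hRn.2 j
            have a3 := cnt j (n+1)
            have a4 := nIm j h1
            omega

theorem complete_sat {p : CMDesc × ℕ × ℕ} (hrec : CMRecur p) (r : A) (ι : ℕ → A)
    (hι : StrictMono ι) (hr : ∀ n, ι n < r) (hA : ∀ a, a < r → (∃ n, a = ι n) ∨ a < ι 0)
    [Nonempty A] :
    (prodFrame2 A ℕ (fun a b => b < a) (fun m n => m ≠ n)).Sat (phiF p) := by
  obtain ⟨N, K, S, I, D, h⟩ := complete hrec r ι hι hr hA
  exact ⟨_, _, valOf_good h⟩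
end

theorem complete_nat {p : CMDesc × ℕ × ℕ} (hrec : CMRecur p) :
    (prodFrame2 (WithTop ℕ) ℕ (fun a b => b < a) (fun m n => m ≠ n)).Sat (phiF p) := by
  refine complete_sat hrec ⊤ (fun n => ((n : ℕ) : WithTop ℕ)) ?_ ?_ ?_
  · intro a b h; exact WithTop.coe_lt_coe.2 h
  · intro n; exact WithTop.coe_lt_top n
  · intro a ha
    obtain ⟨n, rfl⟩ := WithTop.ne_top_iff_exists.1 ha.ne
    exact Or.inl ⟨n, rfl⟩

theorem complete_int {p : CMDesc × ℕ × ℕ} (hrec : CMRecur p) :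
    (prodFrame2 (WithTop ℤ) ℕ (fun a b => b < a) (fun m n => m ≠ n)).Sat (phiF p) := by
  refine complete_sat hrec ⊤ (fun n => ((n : ℤ) : WithTop ℤ)) ?_ ?_ ?_
  · intro a b h; exact WithTop.coe_lt_coe.2 (by exact_mod_cast h)
  · intro n; exact WithTop.coe_lt_top _
  · intro a ha
    obtain ⟨n, rfl⟩ := WithTop.ne_top_iff_exists.1 ha.ne
    by_cases h : n < 0
    · right; exact WithTop.coe_lt_coe.2 (by exact_mod_cast h)
    · left
      exact ⟨n.toNat, by rw [Int.toNat_of_nonneg (by omega)]⟩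

/-! ### The theorem -/

theorem encodeB_inj : Function.Injective encodeB := by
  intro φ
  induction φ with
  | var n => intro ψ h; cases ψ <;> simp_all [encodeB, Nat.pair_eq_pair]
  | neg φ ih =>
    intro ψ h
    cases ψ <;> simp only [encodeB, Nat.pair_eq_pair] at h <;> try omega
    rw [ih h.2]
  | and φ χ ih1 ih2 =>
    intro ψ h
    cases ψ <;> simp only [encodeB, Nat.pair_eq_pair] at h <;> try omega
    rw [ih1 h.2.1, ih2 h.2.2]
  | dia0 φ ih =>
    intro ψ h
    cases ψ <;> simp only [encodeB, Nat.pair_eq_pair] at h <;> try omega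
    rw [ih h.2]
  | dia1 φ ih =>
    intro ψ h
    cases ψ <;> simp only [encodeB, Nat.pair_eq_pair] at h <;> try omega
    rw [ih h.2]

theorem bcodes_iff (P : BForm → Prop) (φ : BForm) : BCodes P (encodeB φ) ↔ P φ := by
  constructor
  · rintro ⟨ψ, h, hP⟩
    rwa [← encodeB_inj h]
  · exact fun h => ⟨φ, rfl, h⟩

theorem main_red
    (C : Frame2 → Prop)
    (hC : ∀ F, C F → ∀ φ ∈ Commutator DisK43 DiffLogic, F.Valid φ)
    (hmem : C (prodFrame2 (WithTop ℕ) ℕ (fun a b => b < a) (fun m n => m ≠ n)) ∨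
      C (prodFrame2 (WithTop ℤ) ℕ (fun a b => b < a) (fun m n => m ≠ n))) :
    ManyOneReducible CMRecur (BCodes (fun φ => ∃ F, C F ∧ F.Sat φ)) := by
  refine ⟨fun p => encodeB (redF p), prF_red.to_comp, fun p => ?_⟩
  rw [bcodes_iff]
  constructor
  · intro h
    have e : redF p = phiF p := if_pos h.1
    rw [e]
    rcases hmem with hm | hm
    · exact ⟨_, hm, complete_nat h⟩
    · exact ⟨_, hm, complete_int h⟩
  · rintro ⟨F, hF, val, w, hs⟩
    by_cases hwf : CMWF p.1
    · have e : redF p = phiF p := if_pos hwf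
      rw [e, sat_phi] at hs
      exact sound (frame_facts F (hC F hF)) hs hwf
    · have e : redF p = BForm.bot := if_neg hwf
      rw [e, sat_bot] at hs
      exact hs.elim

end

/-- For any class `C` of 2-frames that are frames for
`[DisK4.3,Diff]` and that contains the product frame `⟨ω+1,>⟩ × ⟨ω,≠⟩` or
`⟨{∞}∪ℤ,>⟩ × ⟨ω,≠⟩`, `C`-satisfiability is `Σ₁¹`-hard; in particular the
counter-machine recurrence problem is computably many-one reducible to it. -/
theorem disK43_diff_frames_Sigma11_hard (C : Frame2 → Prop)
    (hC : ∀ F, C F → ∀ φ ∈ Commutator DisK43 DiffLogic, F.Valid φ)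
    (hmem : C (prodFrame2 (WithTop ℕ) ℕ (fun a b => b < a) (fun m n => m ≠ n)) ∨
            C (prodFrame2 (WithTop ℤ) ℕ (fun a b => b < a) (fun m n => m ≠ n))) :
    Sigma11Hard (BCodes (fun φ => ∃ F, C F ∧ F.Sat φ)) ∧
    ManyOneReducible CMRecur (BCodes (fun φ => ∃ F, C F ∧ F.Sat φ)) := by
  have h := main_red C hC hmem
  exact ⟨fun B hB => (cmRecur_hard B hB).trans h, h⟩

end HK
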